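/- Assume the Riemann Hypothesis. Then μ_{D_d} ≤ 1.0522; that is, for every λ > 1.0522 one has liminf_{T→∞} D_d(λ,T) > 0, so a positive proportion of gaps between consecutive distinct zeros are at most λ times the average spacing of all zeros. -/

import Mathlib

open Filter MeasureTheory
open scoped Real

noncomputable section

/-- The multiplicity (order of vanishing) of the Riemann zeta function at a point `z`:
the least `n` such that the `n`-th derivative of `ζ` at `z` is nonzero. -/
def zetaMult (z : ℂ) : ℕ := sInf {n : ℕ | iteratedDeriv n riemannZeta z ≠ 0}

/-- Under RH, the set of ordinates `γ` with `0 < γ ≤ T` of nontrivial zeros `1/2 + iγ` of `ζ`. -/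
def zetaOrds (T : ℝ) : Set ℝ :=
  {γ : ℝ | 0 < γ ∧ γ ≤ T ∧ riemannZeta (1 / 2 + γ * Complex.I) = 0}

/-- The multiplicity of the zero of `ζ` at `1/2 + iγ`. -/
def ordMult (γ : ℝ) : ℕ := zetaMult (1 / 2 + γ * Complex.I)

/-- `N(T)`: the number of ordinates of nontrivial zeros in `(0, T]`, counted with multiplicity. -/
def zetaN (T : ℝ) : ℕ := ∑ᶠ γ ∈ zetaOrds T, ordMult γ

/-- The next ordinate of a nontrivial zero strictly above `γ`. -/
def nextOrd (γ : ℝ) : ℝ :=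
  sInf {γ' : ℝ | γ < γ' ∧ riemannZeta (1 / 2 + γ' * Complex.I) = 0}

/-- The number of distinct ordinates `0 < γ_d ≤ T` with `γ_d⁺ - γ_d ≤ 2πλ / log T`, where
`γ_d⁺` is the next distinct ordinate after `γ_d`. -/
def Ddcount (lam T : ℝ) : ℕ :=
  Nat.card {γ : ℝ | γ ∈ zetaOrds T ∧ nextOrd γ - γ ≤ 2 * π * lam / Real.log T}

/-- `D_d(λ, T)`: the number of distinct ordinates `0 < γ_d ≤ T` with
`γ_d⁺ - γ_d ≤ 2πλ / log T`, divided by `N(T)`. -/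
def Ddprop (lam T : ℝ) : ℝ := (Ddcount lam T : ℝ) / (zetaN T : ℝ)

open Real (log exp cos sin)
open Set (Icc)
open ENNReal (ofReal)

local notation "Λ" => ArithmeticFunction.vonMangoldt

lemma evenK_ge_one {t : ℝ} (ht : 0 < t) : 1 ≤ HurwitzZeta.evenKernel 0 t := by
  have h := HurwitzZeta.hasSum_int_evenKernel 0 ht
  have := le_hasSum h 0 (fun n _ => (Real.exp_pos _).le)
  simpa using this

lemma fmodif_nonneg (t : ℝ) : ∃ r : ℝ, 0 ≤ r ∧
    (HurwitzZeta.hurwitzEvenFEPair 0).f_modif t = (r : ℂ) := by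
  by_cases h1 : 1 < t
  · refine ⟨HurwitzZeta.evenKernel 0 t - 1, by linarith [evenK_ge_one (t := t) (by linarith)], ?_⟩
    simp [WeakFEPair.f_modif, h1, h1.le, HurwitzZeta.hurwitzEvenFEPair]
  by_cases h2 : t ∈ Set.Ioo 0 1
  · refine ⟨HurwitzZeta.evenKernel 0 t - t ^ (-(1/2) : ℝ), ?_, ?_⟩
    · have h3 := HurwitzZeta.evenKernel_functional_equation 0 t
      have h4 := evenK_ge_one (t := 1/t) (by have := h2.1; positivity)
      rw [HurwitzZeta.evenKernel_eq_cosKernel_of_zero] at h4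
      rw [h3, Real.rpow_neg h2.1.le]
      have : 0 < t ^ (1/2:ℝ) := Real.rpow_pos_of_pos h2.1 _
      rw [one_div, sub_nonneg]
      exact le_mul_of_one_le_right (by positivity) h4
    · simp [WeakFEPair.f_modif, h1, h2.1, h2.2, HurwitzZeta.hurwitzEvenFEPair]
  · refine ⟨0, le_rfl, ?_⟩
    simp only [Set.mem_Ioo] at h2
    simp [WeakFEPair.f_modif, h1, Set.indicator, h2]

lemma norm_completed₀_le (s : ℂ) : ‖completedRiemannZeta₀ s‖ ≤ ‖completedRiemannZeta₀ (s.re : ℂ)‖ := by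
  choose r hr hr2 using fmodif_nonneg
  have h : ∀ s : ℂ, completedRiemannZeta₀ s
      = (∫ t in Set.Ioi (0:ℝ), (t:ℂ) ^ (s/2 - 1) • ((r t : ℝ) : ℂ)) / 2 := by
    intro s
    simp only [completedRiemannZeta₀, HurwitzZeta.completedHurwitzZetaEven₀, WeakFEPair.Λ₀, mellin, hr2]
  rw [h, h, norm_div, norm_div]
  gcongr
  refine (norm_integral_le_integral_norm _).trans ?_
  have h2 : ∫ t in Set.Ioi (0:ℝ), (t:ℂ) ^ ((s.re:ℂ)/2 - 1) • ((r t : ℝ) : ℂ) =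
     ((∫ t in Set.Ioi (0:ℝ), t ^ (s.re/2 - 1) * r t : ℝ) : ℂ) := by
    rw [← integral_complex_ofReal]
    apply setIntegral_congr_fun measurableSet_Ioi
    intro t ht
    simp only [smul_eq_mul, Complex.ofReal_mul]
    rw [Complex.ofReal_cpow (le_of_lt ht)]
    push_cast; rfl
  rw [h2, Complex.norm_real]
  refine le_trans (le_of_eq ?_) (le_abs_self _)
  apply setIntegral_congr_fun measurableSet_Ioi
  intro t ht
  simp only [norm_smul, Complex.norm_real, Real.norm_eq_abs, abs_of_nonneg (hr t)]
  rw [Complex.norm_cpow_eq_rpow_re_of_pos ht]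
  simp

lemma Gamma_le_exp {x : ℝ} (hx : 1 ≤ x) : Real.Gamma x ≤ exp ((x+1) * log (x+1)) := by
  have h1 : Real.Gamma x ≤ Real.Gamma (x+1) := by
    rw [Real.Gamma_add_one (by linarith)]
    exact le_mul_of_one_le_left (Real.Gamma_nonneg_of_nonneg (by linarith)) hx
  have h2 : Real.Gamma (x+1) ≤ Real.Gamma (⌈x⌉₊ + 1) := by
    apply Real.Gamma_strictMonoOn_Ici.monotoneOn
    · simp; linarith
    · simp; have := Nat.le_ceil x; 
      have : 1 ≤ (⌈x⌉₊:ℝ) := by linarith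
      linarith
    · have := Nat.le_ceil x; linarith
  rw [Real.Gamma_nat_eq_factorial] at h2
  have h3 : ((⌈x⌉₊.factorial : ℕ) : ℝ) ≤ (⌈x⌉₊:ℝ) ^ ⌈x⌉₊ := by exact_mod_cast Nat.factorial_le_pow _
  have h4 : (⌈x⌉₊:ℝ) < x + 1 := Nat.ceil_lt_add_one (by linarith)
  have h5 : (⌈x⌉₊:ℝ) ^ ⌈x⌉₊ ≤ (x+1) ^ ⌈x⌉₊ := by gcongr
  have h6 : (x+1) ^ ⌈x⌉₊ ≤ exp ((x+1) * log (x+1)) := by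
    rw [← Real.rpow_natCast, Real.rpow_def_of_pos (by linarith), mul_comm]
    have : 0 ≤ log (x+1) := Real.log_nonneg (by linarith)
    gcongr
  linarith

/-- the entire even function. -/
def xif (z : ℂ) : ℂ :=
  1 + (1/2 + z) * (1/2 + z - 1) * completedRiemannZeta₀ (1/2 + z)

lemma xif_diff : Differentiable ℂ xif := by
  have := differentiable_completedZeta₀
  unfold xif
  fun_prop

lemma xif_neg (z : ℂ) : xif (-z) = xif z := by
  unfold xif
  rw [show (1/2 + -z : ℂ) = 1 - (1/2 + z) by ring, completedRiemannZeta₀_one_sub]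
  ring

lemma completed₀_bound : ∃ C : ℝ, 1 ≤ C ∧ ∀ s : ℂ, 1/2 ≤ s.re →
    ‖completedRiemannZeta₀ s‖ ≤ C * exp ((s.re+2) * log (s.re+2)) := by
  obtain ⟨C1, hC1⟩ := (isCompact_Icc (a := (1/2:ℝ)) (b := 2)).exists_bound_of_continuousOn
    (f := fun σ : ℝ => completedRiemannZeta₀ (σ:ℂ))
    (differentiable_completedZeta₀.continuous.comp Complex.continuous_ofReal).continuousOn
  have hz : ∃ C2, ∀ σ : ℝ, 2 ≤ σ → ‖riemannZeta σ‖ ≤ C2 := by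
    refine ⟨∑' n : ℕ, 1 / ((n:ℝ)) ^ (2:ℝ), fun σ hσ => ?_⟩
    rw [zeta_eq_tsum_one_div_nat_cpow (by simp; linarith)]
    have hs : Summable fun n : ℕ => 1 / ((n:ℝ)) ^ (2:ℝ) := Real.summable_one_div_nat_rpow.2 (by norm_num)
    refine tsum_of_norm_bounded hs.hasSum ?_
    intro n
    rcases Nat.eq_zero_or_pos n with rfl | hn
    · simp [Complex.zero_cpow (x := (σ:ℂ)) (by norm_cast; linarith)]
    · rw [norm_div, norm_one, Complex.norm_natCast_cpow_of_pos hn]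
      gcongr
      · exact_mod_cast hn
      · simpa using hσ
  obtain ⟨C2, hC2⟩ := hz
  refine ⟨|C1| + |C2| + 3, by linarith [abs_nonneg C1, abs_nonneg C2], fun s hs => ?_⟩
  refine (norm_completed₀_le s).trans ?_
  set σ := s.re
  have hexp : 1 ≤ exp ((σ+2) * log (σ+2)) := by
    apply Real.one_le_exp
    have : 0 ≤ log (σ+2) := Real.log_nonneg (by linarith)
    have : 0 ≤ σ + 2 := by linarith
    positivity
  rcases le_total σ 2 with h2 | h2
  · have := hC1 σ ⟨hs, h2⟩
    have h3 := le_abs_self C1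
    calc _ ≤ |C1| + |C2| + 3 := by linarith [abs_nonneg C2]
      _ ≤ _ := le_mul_of_one_le_right (by linarith [abs_nonneg C1, abs_nonneg C2]) hexp
  · have hσ0 : (σ:ℂ) ≠ 0 := by norm_cast; linarith
    have h3 : completedRiemannZeta₀ (σ:ℂ) = riemannZeta σ * Complex.Gammaℝ σ + 1/σ + 1/(1-σ) := by
      rw [riemannZeta_def_of_ne_zero hσ0, div_mul_cancel₀ _ (Complex.Gammaℝ_ne_zero_of_re_pos (by simp; linarith)),
        completedRiemannZeta_eq]
      ring
    have h4 : ‖Complex.Gammaℝ σ‖ ≤ exp ((σ+2) * log (σ+2)) := by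
      rw [Complex.Gammaℝ_def, norm_mul]
      have e1 : ‖(π:ℂ) ^ (-(σ:ℂ)/2)‖ ≤ 1 := by
        rw [Complex.norm_cpow_eq_rpow_re_of_pos Real.pi_pos]
        apply Real.rpow_le_one_of_one_le_of_nonpos
        · linarith [Real.pi_gt_three]
        · simp; linarith
      have e2 : ‖Complex.Gamma ((σ:ℂ)/2)‖ ≤ exp ((σ+2) * log (σ+2)) := by
        rw [show (σ:ℂ)/2 = ((σ/2:ℝ):ℂ) by push_cast; rfl, Complex.Gamma_ofReal, Complex.norm_real,
          Real.norm_of_nonneg (Real.Gamma_nonneg_of_nonneg (by linarith))]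
        refine (Gamma_le_exp (by linarith)).trans ?_
        have : 0 ≤ log (σ/2+1) := Real.log_nonneg (by linarith)
        apply Real.exp_le_exp.2
        apply mul_le_mul _ _ this (by linarith)
        · linarith
        · exact Real.log_le_log (by linarith) (by linarith)
      calc _ ≤ 1 * exp ((σ+2) * log (σ+2)) := by gcongr
        _ = _ := one_mul _
    have h5 : ‖1/(σ:ℂ)‖ ≤ 1 := by
      rw [norm_div, norm_one, Complex.norm_real, Real.norm_of_nonneg (by linarith)]
      rw [div_le_one (by linarith)]; linarith
    have h6 : ‖1/(1-(σ:ℂ))‖ ≤ 1 := by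
      rw [norm_div, norm_one, show (1-(σ:ℂ)) = ((1-σ:ℝ):ℂ) by push_cast; rfl, Complex.norm_real, Real.norm_eq_abs,
        abs_of_nonpos (by linarith)]
      rw [div_le_one (by linarith)]; linarith
    rw [h3]
    calc _ ≤ ‖riemannZeta σ‖ * ‖Complex.Gammaℝ σ‖ + ‖1/(σ:ℂ)‖ + ‖1/(1-(σ:ℂ))‖ := by
            rw [← norm_mul]; exact norm_add₃_le
      _ ≤ |C2| * exp ((σ+2) * log (σ+2)) + 1 + 1 := by
        gcongr
        exact (hC2 σ h2).trans (le_abs_self _)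
      _ ≤ _ := by nlinarith [abs_nonneg C1, abs_nonneg C2]

lemma xif_growth : ∃ C : ℝ, 1 ≤ C ∧ ∀ (R : ℝ) (z : ℂ), 0 ≤ R → ‖z‖ ≤ R →
    ‖xif z‖ ≤ C * (R+3)^2 * exp ((R+3) * log (R+3)) := by
  obtain ⟨C, hC, h⟩ := completed₀_bound
  refine ⟨C + 1, by linarith, ?_⟩
  have key : ∀ (R : ℝ) (z : ℂ), 0 ≤ R → ‖z‖ ≤ R → 0 ≤ z.re → 
    ‖xif z‖ ≤ (C+1) * (R+3)^2 * exp ((R+3) * log (R+3)) := by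
    intro R z hR hz hre
    have hb := h (1/2+z) (by simp [hre])
    have hre2 : (1/2 + z).re = 1/2 + z.re := by simp
    rw [hre2] at hb
    have hzr := (Complex.abs_re_le_norm z)
    rw [abs_of_nonneg hre] at hzr
    have e1 : exp ((1/2 + z.re+2) * log (1/2 + z.re+2)) ≤ exp ((R+3) * log (R+3)) := by
      have : 0 ≤ log (1/2 + z.re+2) := Real.log_nonneg (by linarith)
      apply Real.exp_le_exp.2
      apply mul_le_mul _ _ this (by linarith)
      · linarith
      · exact Real.log_le_log (by linarith) (by linarith)
    have hexp : 1 ≤ exp ((R+3) * log (R+3)) := by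
      apply Real.one_le_exp
      have : 0 ≤ log (R+3) := Real.log_nonneg (by linarith)
      positivity
    have n1 : ‖(1/2 + z)‖ ≤ R + 3 := by
      refine (norm_add_le _ _).trans ?_
      norm_num; linarith
    have n2 : ‖(1/2 + z - 1)‖ ≤ R + 3 := by
      rw [show (1/2 + z - 1 : ℂ) = z - 1/2 by ring]
      refine (norm_sub_le _ _).trans ?_
      norm_num; linarith
    unfold xif
    calc _ ≤ ‖(1:ℂ)‖ + ‖(1/2 + z)‖ * ‖(1/2 + z - 1)‖ * ‖completedRiemannZeta₀ (1/2 + z)‖ := by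
            rw [← norm_mul, ← norm_mul]; exact norm_add_le _ _
      _ ≤ 1 + (R+3) * (R+3) * (C * exp ((R+3) * log (R+3))) := by
        rw [norm_one]
        gcongr
        exact hb.trans (by gcongr)
      _ ≤ _ := by
        have : 1 ≤ (R+3)^2 * exp ((R+3) * log (R+3)) := by
          nlinarith
        nlinarith
  intro R z hR hz
  rcases le_total 0 z.re with h0 | h0
  · exact key R z hR hz h0
  · rw [← xif_neg]
    exact key R (-z) hR (by simpa using hz) (by simpa using h0)

/-- ordinates of critical zeros -/
def ZS : Set ℝ := {γ : ℝ | riemannZeta (1 / 2 + γ * Complex.I) = 0}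

lemma xif_eq_completed (z : ℂ) (h0 : 1/2 + z ≠ 0) (h1 : 1/2 + z ≠ 1) :
    xif z = (1/2+z) * (1/2+z-1) * completedRiemannZeta (1/2+z) := by
  unfold xif
  rw [completedRiemannZeta_eq]
  have h2 : 1 - (1/2 + z) ≠ 0 := sub_ne_zero.2 h1.symm
  generalize hs : 1/2+z = s at *
  field_simp
  ring

lemma zeta_eq_xif (z : ℂ) (h0 : 1/2 + z ≠ 0) (h1 : 1/2 + z ≠ 1) :
    riemannZeta (1/2+z) = (Complex.Gammaℝ (1/2+z))⁻¹ * ((1/2+z) * (1/2+z-1))⁻¹ * xif z := by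
  rw [riemannZeta_def_of_ne_zero h0, xif_eq_completed z h0 h1]
  have h2 : (1/2 + z) - 1 ≠ 0 := sub_ne_zero.2 h1
  generalize 1/2+z = s at *
  field_simp

lemma half_ne (γ : ℝ) : (1/2 + γ * Complex.I : ℂ) ≠ 0 ∧ (1/2 + γ * Complex.I : ℂ) ≠ 1 := by
  constructor <;> intro h <;> · have := congrArg Complex.re h; norm_num at this

lemma xif_zero_of_mem {γ : ℝ} (h : γ ∈ ZS) : xif (γ * Complex.I) = 0 := by
  have h1 : riemannZeta (1 / 2 + γ * Complex.I) = 0 := h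
  rw [zeta_eq_xif _ (half_ne γ).1 (half_ne γ).2] at h1
  rcases mul_eq_zero.1 h1 with h2 | h2
  · rcases mul_eq_zero.1 h2 with h3 | h3
    · exact absurd (inv_eq_zero.1 h3) (Complex.Gammaℝ_ne_zero_of_re_pos (by simp))
    · exfalso
      rcases mul_eq_zero.1 (inv_eq_zero.1 h3) with h4 | h4
      · exact (half_ne γ).1 h4
      · exact (half_ne γ).2 (sub_eq_zero.1 h4)
  · exact h2

lemma xif_ne_zero_of_re {z : ℂ} (h : 1/2 ≤ z.re) : xif z ≠ 0 := by
  have h0 : (1/2 + z) ≠ 0 := by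
    intro h0; have := congrArg Complex.re h0; simp at this; linarith
  by_cases h1 : 1/2 + z = 1
  · rw [xif, h1]; simp
  intro hx
  have := zeta_eq_xif z h0 h1
  rw [hx, mul_zero] at this
  exact riemannZeta_ne_zero_of_one_le_re (s := 1/2+z) (by simp; linarith) this

lemma xif_zero_imp (hRH : RiemannHypothesis) {z : ℂ} (h : xif z = 0) :
    ∃ γ ∈ ZS, z = (γ : ℝ) * Complex.I := by
  have h0 : (1/2 + z) ≠ 0 := by
    intro h0; rw [xif, h0] at h; simp at h
  have h1 : (1/2 + z) ≠ 1 := by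
    intro h0; rw [xif, h0] at h; simp at h
  have hz : riemannZeta (1/2+z) = 0 := by rw [zeta_eq_xif z h0 h1, h, mul_zero]
  have hre := hRH (1/2+z) hz (by
    rintro ⟨n, hn⟩
    apply xif_ne_zero_of_re (z := -z) _ (by rw [xif_neg, h])
    have := congrArg Complex.re hn
    simp at this ⊢
    have hn : (0:ℝ) ≤ n := Nat.cast_nonneg n
    linarith) h1
  have hre' : z.re = 0 := by simpa using hre
  have hzz : z = (z.im : ℝ) * Complex.I := by
    apply Complex.ext <;> simp [hre']
  exact ⟨z.im, by rw [ZS, Set.mem_ofPred_eq, ← hzz]; exact hz, hzz⟩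

lemma xif_analytic (w : ℂ) : AnalyticAt ℂ xif w := xif_diff.analyticAt w

lemma xif_order_ne_top (w : ℂ) : analyticOrderAt xif w ≠ ⊤ := by
  intro h
  rw [analyticOrderAt_eq_top] at h
  have h2 : AnalyticOnNhd ℂ xif Set.univ := fun x _ => xif_analytic x
  have := h2.eqOn_zero_of_preconnected_of_eventuallyEq_zero isPreconnected_univ (Set.mem_univ w) h
  exact xif_ne_zero_of_re (z := 1) (by norm_num) (this (Set.mem_univ 1))

lemma ordMult_eq (γ : ℝ) : ordMult γ = analyticOrderNatAt xif (γ * Complex.I) := by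
  set w : ℂ := γ * Complex.I
  have hs : (1/2 + w : ℂ) ≠ 0 := (half_ne γ).1
  have hs1 : (1/2 + w : ℂ) ≠ 1 := (half_ne γ).2
  have hzan : AnalyticAt ℂ riemannZeta (1/2 + w) := by
    apply DifferentiableOn.analyticAt (s := {1}ᶜ)
    · intro s hs; exact (differentiableAt_riemannZeta hs).differentiableWithinAt
    · exact isOpen_compl_singleton.mem_nhds hs1
  have h1 : analyticOrderAt riemannZeta (1/2+w) = analyticOrderAt xif w := by
    have e1 : analyticOrderAt (riemannZeta ∘ (fun z => 1/2 + z)) w = analyticOrderAt riemannZeta (1/2+w) := by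
      apply analyticOrderAt_comp_of_deriv_ne_zero
      · fun_prop
      · rw [deriv_const_add]; simp
    rw [← e1]
    set u : ℂ → ℂ := fun z => (Complex.Gammaℝ (1/2+z))⁻¹ * ((1/2+z) * (1/2+z-1))⁻¹
    have hev : (riemannZeta ∘ (fun z => 1/2 + z)) =ᶠ[nhds w] u * xif := by
      have c1 : ∀ᶠ z in nhds w, 1/2 + z ≠ 0 :=
        (continuous_const.add continuous_id).continuousAt.eventually_ne hs
      have c2 : ∀ᶠ z in nhds w, 1/2 + z ≠ 1 :=
        (continuous_const.add continuous_id).continuousAt.eventually_ne hs1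
      filter_upwards [c1, c2] with z h0 h1
      simp only [Function.comp, Pi.mul_apply, u]
      exact zeta_eq_xif z h0 h1
    have hu : AnalyticAt ℂ u w := by
      apply AnalyticAt.mul
      · exact (Complex.differentiable_Gammaℝ_inv.comp (differentiable_id.const_add (1/2))).analyticAt w
      · apply AnalyticAt.inv (by fun_prop)
        exact mul_ne_zero hs (sub_ne_zero.2 hs1)
    have hu0 : u w ≠ 0 := by
      apply mul_ne_zero (inv_ne_zero (Complex.Gammaℝ_ne_zero_of_re_pos (by simp [w])))
      exact inv_ne_zero (mul_ne_zero hs (sub_ne_zero.2 hs1))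
    rw [analyticOrderAt_congr hev, analyticOrderAt_mul hu (xif_analytic w), hu.analyticOrderAt_eq_zero.2 hu0, zero_add]
  have h2 : analyticOrderAt riemannZeta (1/2+w) = (analyticOrderNatAt xif w : ℕ∞) := by
    rw [h1, Nat.cast_analyticOrderNatAt (xif_order_ne_top w)]
  have h3 := (analyticOrderAt_eq_nat_iff_iteratedDeriv_eq_zero hzan).1 h2
  unfold ordMult zetaMult
  apply le_antisymm
  · exact Nat.sInf_le h3.2
  · apply le_csInf ⟨_, h3.2⟩
    intro n hn
    by_contra hlt
    exact hn (h3.1 n (not_le.1 hlt))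

lemma ordMult_neg (γ : ℝ) : ordMult (-γ) = ordMult γ := by
  rw [ordMult_eq, ordMult_eq]
  unfold analyticOrderNatAt
  have h : analyticOrderAt (xif ∘ (fun z => -z)) (γ * Complex.I) = analyticOrderAt xif (-(γ * Complex.I)) := by
    apply analyticOrderAt_comp_of_deriv_ne_zero
    · fun_prop
    · simp
  have h2 : xif ∘ (fun z => -z) = xif := by ext z; exact xif_neg z
  rw [h2] at h
  rw [h]
  push_cast
  rw [neg_mul]

lemma ordMult_pos {γ : ℝ} (h : γ ∈ ZS) : 0 < ordMult γ := by
  rw [Nat.pos_iff_ne_zero, ordMult_eq]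
  intro h0
  have h2 : analyticOrderAt xif (γ * Complex.I) = 0 := by
    rw [← Nat.cast_analyticOrderNatAt (xif_order_ne_top _), h0]; rfl
  exact (xif_analytic _).analyticOrderAt_eq_zero.1 h2 (xif_zero_of_mem h)

lemma ZS_finite (R : ℝ) : {γ ∈ ZS | |γ| ≤ R}.Finite := by
  have h := (isCompact_closedBall (0:ℂ) (|R|+1)).inter_riemannZetaZeros_finite
  refine Set.Finite.of_finite_image (f := fun γ : ℝ => (1/2 + γ * Complex.I : ℂ)) (h.subset ?_) ?_
  · rintro _ ⟨γ, ⟨h1, h2⟩, rfl⟩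
    refine ⟨?_, h1⟩
    rw [mem_closedBall_zero_iff]
    refine (norm_add_le _ _).trans ?_
    simp
    linarith [le_abs_self R]
  · intro a _ b _ hab
    simpa using hab

lemma ZS_countable : ZS.Countable := by
  have : ZS = ⋃ n : ℕ, {γ ∈ ZS | |γ| ≤ n} := by
    ext γ
    simp only [Set.mem_iUnion, Set.mem_ofPred_eq]
    constructor
    · intro h; obtain ⟨n, hn⟩ := exists_nat_ge |γ|; exact ⟨n, h, hn⟩
    · rintro ⟨n, h, _⟩; exact h
  rw [this]
  exact Set.countable_iUnion fun n => (ZS_finite n).countable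

lemma ZS_neg {γ : ℝ} (h : γ ∈ ZS) : -γ ∈ ZS := by
  have h1 := xif_zero_of_mem h
  have h2 : xif ((-γ : ℝ) * Complex.I) = 0 := by
    push_cast; rw [neg_mul, xif_neg]; exact h1
  have := zeta_eq_xif ((-γ : ℝ) * Complex.I) (half_ne (-γ)).1 (half_ne (-γ)).2
  rw [h2, mul_zero] at this
  exact this

open Metric

lemma divide_one {g : ℂ → ℂ} (hg : Differentiable ℂ g) (a : ℂ) (n : ℕ) (hn : analyticOrderAt g a = n) :
    ∃ h : ℂ → ℂ, Differentiable ℂ h ∧ h a ≠ 0 ∧ ∀ z, g z = (z - a)^n * h z := by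
  obtain ⟨h0, h1, h2, h3⟩ := ((hg.analyticAt a).analyticOrderAt_eq_natCast).1 hn
  classical
  set h : ℂ → ℂ := fun z => if z = a then h0 a else g z / (z-a)^n with hh
  have hev : h =ᶠ[nhds a] h0 := by
    filter_upwards [h3] with z hz
    by_cases hza : z = a
    · simp [hh, hza]
    · have : (z - a)^n ≠ 0 := pow_ne_zero _ (sub_ne_zero.2 hza)
      simp only [hh, hza, if_false, hz, smul_eq_mul]
      field_simp
  refine ⟨h, ?_, by simpa [hh] using h2, ?_⟩
  · intro z
    by_cases hza : z = a
    · subst hza; exact h1.differentiableAt.congr_of_eventuallyEq hev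
    · have : h =ᶠ[nhds z] fun z => g z / (z-a)^n := by
        filter_upwards [eventually_ne_nhds hza] with w hw
        simp [hh, hw]
      refine DifferentiableAt.congr_of_eventuallyEq ?_ this
      exact (hg z).div (by fun_prop) (pow_ne_zero _ (sub_ne_zero.2 hza))
  · intro z
    by_cases hza : z = a
    · subst hza
      have := h3.self_of_nhds
      simpa [hh] using this
    · have : (z - a)^n ≠ 0 := pow_ne_zero _ (sub_ne_zero.2 hza)
      simp only [hh, hza, if_false]
      field_simp

lemma divide_all (s : Finset ℂ) : ∃ g : ℂ → ℂ, Differentiable ℂ g ∧ (∀ ρ ∈ s, g ρ ≠ 0) ∧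
    ∀ z, xif z = (∏ ρ ∈ s, (z - ρ)^(analyticOrderNatAt xif ρ)) * g z := by
  classical
  induction s using Finset.induction_on with
  | empty => exact ⟨xif, xif_diff, by simp, by simp⟩
  | insert a s ha ih =>
    obtain ⟨g, hg, hg0, hgf⟩ := ih
    set P : ℂ → ℂ := fun z => ∏ ρ ∈ s, (z - ρ)^(analyticOrderNatAt xif ρ)
    have hP : Differentiable ℂ P := by
      apply Differentiable.fun_finsetProd; intro i _; fun_prop
    have hPa : P a ≠ 0 := by
      apply Finset.prod_ne_zero_iff.2
      intro ρ hρ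
      apply pow_ne_zero
      rw [sub_ne_zero]; rintro rfl; exact ha hρ
    have ho : analyticOrderAt g a = (analyticOrderNatAt xif a : ℕ∞) := by
      rw [Nat.cast_analyticOrderNatAt (xif_order_ne_top a)]
      have : xif = P * g := by ext z; exact hgf z
      rw [this, analyticOrderAt_mul (hP.analyticAt a) (hg.analyticAt a),
        (hP.analyticAt a).analyticOrderAt_eq_zero.2 hPa, zero_add]
    obtain ⟨h, hh, hh0, hhf⟩ := divide_one hg a _ ho
    refine ⟨h, hh, ?_, ?_⟩
    · intro ρ hρ
      rcases Finset.mem_insert.1 hρ with rfl | hρ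
      · exact hh0
      · have := hg0 ρ hρ
        rw [hhf] at this
        exact right_ne_zero_of_mul this
    · intro z
      rw [Finset.prod_insert ha, hgf, hhf]
      ring

lemma bc_bound {g : ℂ → ℂ} (hg : Differentiable ℂ g) {R M : ℝ} (hM : 0 < M) (hR : 16 ≤ R)
    (h0 : ∀ w ∈ ball (0:ℂ) R, g w ≠ 0) (hb : ∀ w ∈ ball (0:ℂ) R, ‖g w‖ ≤ exp M * ‖g 1‖) {w : ℂ}
    (hw : ‖w‖ ≤ R / 8) : ‖deriv (logDeriv g) w‖ ≤ 128 * M / R^2 := by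
  have hsub : ball (1:ℂ) (R-1) ⊆ ball 0 R := by
    apply ball_subset_ball'; simp
  have hq : DifferentiableOn ℂ (logDeriv g) (ball 0 R) := by
    intro z hz
    have : DifferentiableAt ℂ (fun z => deriv g z / g z) z :=
      (hg.deriv z).div (hg z) (h0 z hz)
    exact this.differentiableWithinAt
  obtain ⟨G0, hG0⟩ := (hq.mono hsub).isExactOn_ball
  set G := fun z => G0 z - G0 1
  have hG : ∀ z ∈ ball (1:ℂ) (R-1), HasDerivAt G (logDeriv g z) z := fun z hz => (hG0 z hz).sub_const _
  have hR1 : (0:ℝ) < R - 1 := by linarith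
  have h1m : (1:ℂ) ∈ ball (1:ℂ) (R-1) := mem_ball_self hR1
  have hexp : ∀ z ∈ ball (1:ℂ) (R-1), g z = g 1 * Complex.exp (G z) := by
    have hconst : ∀ z ∈ ball (1:ℂ) (R-1), HasDerivAt (fun z => g z * Complex.exp (-G z)) 0 z := by
      intro z hz
      have h1 := (hg z).hasDerivAt.mul ((hG z hz).neg.cexp)
      refine h1.congr_deriv ?_
      simp only [logDeriv_apply, Pi.neg_apply]
      have := h0 z (hsub hz)
      field_simp
      ring
    intro z hz
    have h2 := (isOpen_ball : IsOpen (ball (1:ℂ) (R-1))).is_const_of_deriv_eq_zero (convex_ball _ _).isPreconnected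
      (fun z hz => (hconst z hz).differentiableAt.differentiableWithinAt) (fun z hz => (hconst z hz).deriv) hz h1m
    simp only [G, sub_self, neg_zero, Complex.exp_zero, mul_one] at h2
    rw [← h2, mul_assoc, ← Complex.exp_add]
    simp [G]
  have hG1 : G 1 = 0 := by simp [G]
  have hre : ∀ z ∈ ball (1:ℂ) (R-1), (G z).re ≤ M := by
    intro z hz
    have h1 := hb z (hsub hz)
    rw [hexp z hz, norm_mul, Complex.norm_exp, mul_comm] at h1
    have h2 : 0 < ‖g 1‖ := norm_pos_iff.2 (h0 1 (hsub h1m))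
    exact Real.exp_le_exp.1 (le_of_mul_le_mul_right h1 h2)
  have hGb : ∀ z, ‖z - 1‖ ≤ (R-1)/2 → ‖G z‖ ≤ 2 * M := by
    intro z hz
    have h3 := Complex.borelCaratheodory_zero (f := fun u => G (1 + u)) (R := R-1) (z := z - 1) hM
      (fun u hu => by
        have : (1 + u) ∈ ball (1:ℂ) (R-1) := by simpa [mem_ball, dist_eq_norm] using hu
        have := (hG _ this).differentiableAt
        exact (this.comp u ((differentiableAt_id).const_add (1:ℂ))).differentiableWithinAt)
      (fun u hu => by
        have : (1 + u) ∈ ball (1:ℂ) (R-1) := by simpa [mem_ball, dist_eq_norm] using hu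
        exact hre _ this) hR1 (by rw [mem_ball_zero_iff]; linarith) (by simpa using hG1)
    simp only [add_sub_cancel] at h3
    refine h3.trans ?_
    rw [div_le_iff₀ (by linarith)]
    nlinarith
  -- first Cauchy
  have hq1 : ∀ z, ‖z‖ ≤ R/4 → ‖logDeriv g z‖ ≤ 2 * M / (R/8) := by
    intro z hz
    have hzin : ∀ u ∈ closedBall z (R/8), ‖u - 1‖ ≤ (R-1)/2 := by
      intro u hu
      rw [mem_closedBall, dist_eq_norm] at hu
      calc ‖u - 1‖ = ‖(u - z) + z - 1‖ := by ring_nf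
        _ ≤ ‖u - z‖ + ‖z‖ + ‖(1:ℂ)‖ := (norm_sub_le _ _).trans (by gcongr; exact norm_add_le _ _)
        _ ≤ _ := by rw [norm_one]; linarith
    have hin2 : ∀ u ∈ closedBall z (R/8), u ∈ ball (1:ℂ) (R-1) := fun u hu => by
      rw [mem_ball, dist_eq_norm]; have := hzin u hu; linarith
    rw [← (hG z (hin2 z (mem_closedBall_self (by linarith)))).deriv]
    apply Complex.norm_deriv_le_of_forall_mem_sphere_norm_le (by linarith)
    · apply DifferentiableOn.diffContOnCl_ball (U := closedBall z (R/8)) _ subset_rfl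
      exact fun u hu => (hG u (hin2 u hu)).differentiableAt.differentiableWithinAt
    · exact fun u hu => hGb u (hzin u (sphere_subset_closedBall hu))
  have := Complex.norm_deriv_le_of_forall_mem_sphere_norm_le (f := logDeriv g) (c := w) (R := R/8)
    (C := 2 * M / (R/8)) (by linarith) (by
      apply DifferentiableOn.diffContOnCl_ball (U := ball 0 R) hq
      intro u hu
      rw [mem_closedBall, dist_eq_norm] at hu
      rw [mem_ball_zero_iff]
      have := norm_le_norm_add_norm_sub' u w
      linarith) (by
      intro u hu
      apply hq1
      rw [mem_sphere, dist_eq_norm] at hu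
      have := norm_le_norm_add_norm_sub' u w
      linarith)
  refine this.trans (le_of_eq ?_)
  field_simp
  norm_num

open Metric

def ZF (R : ℝ) : Finset ℝ := (ZS_finite R).toFinset

lemma mem_ZF {R γ : ℝ} : γ ∈ ZF R ↔ γ ∈ ZS ∧ |γ| ≤ R := by simp [ZF]

lemma hadamard_step (hRH : RiemannHypothesis) : ∃ C : ℝ, 0 < C ∧ ∀ (R : ℝ), C ≤ R → ∀ z : ℂ, ‖z‖ ≤ R/8 → 1/2 ≤ z.re →
    ‖logDeriv xif z - ∑ γ ∈ ZF R, (ordMult γ : ℂ) / (z - γ * Complex.I)‖ ≤ C * ‖z‖ * (log R / R) := by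
  obtain ⟨C0, hC0, hgr⟩ := xif_growth
  set D := C0 / ‖xif 1‖ with hD
  have hx1 : xif 1 ≠ 0 := xif_ne_zero_of_re (by norm_num)
  have hx1p : 0 < ‖xif 1‖ := norm_pos_iff.2 hx1
  have hDpos : 0 < D := by positivity
  refine ⟨16 + 2 * 128 * (1 + |log D| + 6 * 10), by positivity, ?_⟩
  intro R hR z hz hzre
  have hR16 : 16 ≤ R := by linarith [abs_nonneg (log D)]
  classical
  set s : Finset ℂ := (ZF R).image (fun γ : ℝ => (γ : ℂ) * Complex.I) with hs
  have hinj : Set.InjOn (fun γ : ℝ => (γ : ℂ) * Complex.I) (ZF R) := by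
    intro a _ b _ hab; simpa using hab
  obtain ⟨g, hg, hg0, hgf⟩ := divide_all s
  have hsnorm : ∀ ρ ∈ s, ‖ρ‖ ≤ R := by
    intro ρ hρ
    obtain ⟨γ, hγ, rfl⟩ := Finset.mem_image.1 hρ
    simpa using (mem_ZF.1 hγ).2
  have hgne : ∀ w, ‖w‖ ≤ R → g w ≠ 0 := by
    intro w hw h0
    have hx : xif w = 0 := by rw [hgf, h0, mul_zero]
    obtain ⟨γ, hγ, rfl⟩ := xif_zero_imp hRH hx
    apply hg0 _ _ h0
    rw [hs]
    exact Finset.mem_image_of_mem _ (mem_ZF.2 ⟨hγ, by simpa using hw⟩)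
  set M := log D + 2 * log (2*R+4) + (2*R+4) * log (2*R+4) with hMdef
  have hexpM : exp M = D * (2*R+4)^2 * exp ((2*R+4) * log (2*R+4)) := by
    rw [hMdef, Real.exp_add, Real.exp_add, Real.exp_log hDpos, two_mul (log _), Real.exp_add,
      Real.exp_log (by linarith)]
    ring
  have hlogR1 : 1 ≤ log R := by
    rw [Real.le_log_iff_exp_le (by linarith)]
    linarith [Real.exp_one_lt_d9]
  have hlog4 : log (2*R+4) ≤ 2 * log R := by
    have : log (2*R+4) ≤ log (R^2) := Real.log_le_log (by linarith) (by nlinarith)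
    rw [Real.log_pow] at this; exact_mod_cast this
  have hlog4' : 1 ≤ log (2*R+4) := hlogR1.trans (Real.log_le_log (by linarith) (by linarith))
  set M' := (1 + |log D| + 6 * 10) * (R * log R)
  have hMM' : M ≤ M' := by
    have h1 : log D ≤ |log D| * (R * log R) := by
      refine (le_abs_self _).trans (le_mul_of_one_le_right (abs_nonneg _) ?_)
      nlinarith
    have h2 : 2 * log (2*R+4) + (2*R+4) * log (2*R+4) ≤ (6*10) * (R * log R) := by
      nlinarith
    have h3 : 0 ≤ R * log R := by nlinarith
    simp only [M, M']; nlinarith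
  have hM'pos : 0 < M' := by
    have : 0 < R * log R := by nlinarith
    positivity
  have hbound : ∀ w ∈ ball (0:ℂ) (2*R+1), ‖g w‖ ≤ exp M * ‖g 1‖ := by
    intro w hw
    apply Complex.norm_le_of_forall_mem_frontier_norm_le isBounded_ball hg.diffContOnCl _ (subset_closure hw)
    intro u hu
    rw [frontier_ball _ (by linarith), mem_sphere_zero_iff_norm] at hu
    have hxu := hgr (2*R+1) u (by linarith) hu.le
    have e1 : ‖∏ ρ ∈ s, ((1:ℂ) - ρ)^(analyticOrderNatAt xif ρ)‖ ≤ ‖∏ ρ ∈ s, (u - ρ)^(analyticOrderNatAt xif ρ)‖ := by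
      rw [norm_prod, norm_prod]
      apply Finset.prod_le_prod
      · intros; positivity
      · intro ρ hρ
        rw [norm_pow, norm_pow]
        gcongr
        have h1 := hsnorm ρ hρ
        have h2 : ‖(1:ℂ) - ρ‖ ≤ 1 + ‖ρ‖ := by simpa using norm_sub_le (1:ℂ) ρ
        have h3 := norm_sub_norm_le u ρ
        linarith
    have e2 : ‖∏ ρ ∈ s, (u - ρ)^(analyticOrderNatAt xif ρ)‖ * ‖g u‖ = ‖xif u‖ := by
      rw [← norm_mul, ← hgf]
    have e3 : ‖∏ ρ ∈ s, ((1:ℂ) - ρ)^(analyticOrderNatAt xif ρ)‖ * ‖g 1‖ = ‖xif 1‖ := by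
      rw [← norm_mul, ← hgf]
    have e4 : 0 < ‖∏ ρ ∈ s, ((1:ℂ) - ρ)^(analyticOrderNatAt xif ρ)‖ := by
      rcases (norm_nonneg (∏ ρ ∈ s, ((1:ℂ) - ρ)^(analyticOrderNatAt xif ρ))).lt_or_eq with h | h
      · exact h
      · rw [← h] at e3; linarith
    have e5 : exp M * ‖xif 1‖ = C0 * (2*R+4)^2 * exp ((2*R+4) * log (2*R+4)) := by
      rw [hexpM, hD]; field_simp
    rw [show 2*R+1+3 = 2*R+4 by ring, ← e5, ← e2, ← e3] at hxu
    have e6 : ‖∏ ρ ∈ s, ((1:ℂ) - ρ)^(analyticOrderNatAt xif ρ)‖ * ‖g u‖ ≤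
       ‖∏ ρ ∈ s, ((1:ℂ) - ρ)^(analyticOrderNatAt xif ρ)‖ * (exp M * ‖g 1‖) := by
      calc _ ≤ ‖∏ ρ ∈ s, (u - ρ)^(analyticOrderNatAt xif ρ)‖ * ‖g u‖ := by gcongr
        _ ≤ _ := by linarith
    exact le_of_mul_le_mul_left e6 e4
  have hderiv : ∀ w : ℂ, ‖w‖ ≤ R/8 → ‖deriv (logDeriv g) w‖ ≤ 128 * M' / R^2 := by
    intro w hw
    apply bc_bound hg hM'pos hR16 (fun w hw => hgne w (mem_ball_zero_iff.1 hw).le) _ hw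
    intro w hw
    refine (hbound w (ball_subset_ball (by linarith) hw)).trans ?_
    gcongr
  -- decomposition
  have hdec : ∀ w : ℂ, ‖w‖ ≤ R → xif w ≠ 0 →
      logDeriv xif w = ∑ γ ∈ ZF R, (ordMult γ : ℂ) / (w - γ * Complex.I) + logDeriv g w := by
    intro w hw hx
    have hne : ∀ ρ ∈ s, (w - ρ) ≠ 0 := by
      intro ρ hρ h0
      obtain ⟨γ, hγ, rfl⟩ := Finset.mem_image.1 hρ
      rw [sub_eq_zero] at h0
      exact hx (by rw [h0]; exact xif_zero_of_mem (mem_ZF.1 hγ).1)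
    have hfe : xif = fun z => (∏ ρ ∈ s, (z - ρ)^(analyticOrderNatAt xif ρ)) * g z := by
      ext z; exact hgf z
    conv_lhs => rw [hfe]
    rw [logDeriv_mul (f := fun z => ∏ ρ ∈ s, (z - ρ)^(analyticOrderNatAt xif ρ)) (g := g) w
      (Finset.prod_ne_zero_iff.2 fun ρ hρ => pow_ne_zero _ (hne ρ hρ)) (hgne w hw)
      (by apply DifferentiableAt.fun_finsetProd; intro i _; fun_prop) (hg w)]
    congr 1
    rw [logDeriv_prod (f := fun ρ z => (z - ρ)^(analyticOrderNatAt xif ρ)) (fun ρ hρ => pow_ne_zero _ (hne ρ hρ)) (fun ρ _ => by fun_prop)]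
    rw [hs, Finset.sum_image hinj]
    apply Finset.sum_congr rfl
    intro γ hγ
    rw [logDeriv_fun_pow (by fun_prop), ordMult_eq]
    simp only [logDeriv_apply]
    rw [deriv_sub_const, deriv_id'']
    ring
  have hxz : xif z ≠ 0 := xif_ne_zero_of_re hzre
  have hzR : ‖z‖ ≤ R := by linarith
  have hodd : logDeriv g (-z) = - logDeriv g z := by
    have h1 := hdec z hzR hxz
    have h2 := hdec (-z) (by simpa using hzR) (by rwa [xif_neg])
    have h3 : logDeriv xif (-z) = - logDeriv xif z := by
      rw [logDeriv_apply, logDeriv_apply, xif_neg]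
      have : xif = fun w => xif (-w) := by ext w; rw [xif_neg]
      have h4 : deriv xif z = - deriv xif (-z) := by
        conv_lhs => rw [this]
        rw [deriv_comp_neg]
      rw [h4]; ring
    have h5 : ∑ γ ∈ ZF R, (ordMult γ : ℂ) / (-z - γ * Complex.I) = - ∑ γ ∈ ZF R, (ordMult γ : ℂ) / (z - γ * Complex.I) := by
      rw [← Finset.sum_neg_distrib]
      apply Finset.sum_bij (fun γ _ => -γ)
      · intro γ hγ
        exact mem_ZF.2 ⟨ZS_neg (mem_ZF.1 hγ).1, by simpa using (mem_ZF.1 hγ).2⟩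
      · intro a _ b _ h; simpa using h
      · intro b hb
        exact ⟨-b, mem_ZF.2 ⟨ZS_neg (mem_ZF.1 hb).1, by simpa using (mem_ZF.1 hb).2⟩, by simp⟩
      · intro γ hγ
        rw [ordMult_neg, ← div_neg]
        congr 1
        push_cast; ring
    rw [h3, h5, h1] at h2
    linear_combination -h2
  have hmv := Convex.norm_image_sub_le_of_norm_deriv_le (𝕜 := ℂ) (f := logDeriv g) (s := closedBall (0:ℂ) (R/8)) (C := 128 * M' / R^2)
    (x := -z) (y := z) (fun w hw => by
      rw [mem_closedBall_zero_iff] at hw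
      exact (hg.deriv w).div (hg w) (hgne w (by linarith))) (fun w hw => hderiv w (mem_closedBall_zero_iff.1 hw))
      (convex_closedBall _ _) (by simpa using hz) (by simpa using hz)
  rw [hodd, sub_neg_eq_add, sub_neg_eq_add, ← two_mul, ← two_mul, norm_mul, norm_mul] at hmv
  rw [hdec z hzR hxz, add_sub_cancel_left]
  have hM'R : 128 * M' / R^2 = 128 * (1 + |log D| + 6 * 10) * (log R / R) := by
    simp only [M']; field_simp
  rw [hM'R] at hmv
  have : 0 ≤ log R / R := by positivity
  have h9 : 0 ≤ ‖z‖ * (log R / R) := by positivity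
  norm_num at hmv
  have := mul_nonneg (abs_nonneg (log D)) h9
  nlinarith [norm_nonneg z]

lemma hadamard (hRH : RiemannHypothesis) (z : ℂ) (hz : 1/2 ≤ z.re) :
    Tendsto (fun N : ℕ => ∑ γ ∈ ZF N, (ordMult γ : ℂ) / (z - γ * Complex.I)) atTop (nhds (logDeriv xif z)) := by
  obtain ⟨C, hC, h⟩ := hadamard_step hRH
  rw [tendsto_iff_norm_sub_tendsto_zero]
  have hlim : Tendsto (fun N : ℕ => C * ‖z‖ * (log N / N)) atTop (nhds 0) := by
    have h1 : Tendsto (fun x : ℝ => log x / x) atTop (nhds 0) := by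
      have := Real.isLittleO_log_id_atTop
      exact this.tendsto_div_nhds_zero
    simpa using ((h1.comp tendsto_natCast_atTop_atTop).const_mul (C * ‖z‖))
  refine squeeze_zero' (Eventually.of_forall fun _ => norm_nonneg _) ?_ hlim
  filter_upwards [tendsto_natCast_atTop_atTop.eventually_ge_atTop (max C (8 * ‖z‖))] with N hN
  rw [norm_sub_rev]
  apply h N ((le_max_left _ _).trans hN) z _ hz
  have := (le_max_right _ _).trans hN
  linarith

lemma gammaSeq_bound {s : ℂ} (h1 : 1/2 ≤ s.re) (h2 : s.re ≤ 3/2) {n : ℕ} (hn : n ≠ 0) :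
    ‖Complex.GammaSeq s n‖ ≤ Real.Gamma (1/2) + Real.Gamma (3/2) := by
  have hs : 0 < s.re := by linarith
  rw [Complex.GammaSeq_eq_approx_Gamma_integral hs hn, intervalIntegral.integral_of_le (Nat.cast_nonneg n)]
  have i1 := Real.GammaIntegral_convergent (s := 1/2) (by norm_num)
  have i2 := Real.GammaIntegral_convergent (s := 3/2) (by norm_num)
  have i12 := i1.add i2
  rw [Real.Gamma_eq_integral (by norm_num), Real.Gamma_eq_integral (by norm_num), ← integral_add i1 i2]
  refine (norm_integral_le_of_norm_le (i12.mono_set Set.Ioc_subset_Ioi_self) ?_).trans ?_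
  · refine (ae_restrict_iff' measurableSet_Ioc).2 (Eventually.of_forall fun x hx => ?_)
    have hx0 : 0 < x := hx.1
    have hnp : (0:ℝ) < n := by positivity
    rw [norm_mul, Complex.norm_real, Complex.norm_cpow_eq_rpow_re_of_pos hx0, Pi.add_apply, ← mul_add]
    have h0 : 0 ≤ 1 - x / n := by rw [sub_nonneg, div_le_one hnp]; exact hx.2
    rw [Real.norm_of_nonneg (by positivity)]
    refine mul_le_mul (Real.one_sub_div_pow_le_exp_neg hx.2) ?_ (by positivity) (by positivity)
    simp only [Complex.sub_re, Complex.one_re]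
    have p1 : 0 < x ^ ((1:ℝ)/2-1) := by positivity
    have p2 : 0 < x ^ ((3:ℝ)/2-1) := by positivity
    rcases le_total x 1 with h | h
    · have := Real.rpow_le_rpow_of_exponent_ge hx0 h (show (1:ℝ)/2-1 ≤ s.re - 1 by linarith)
      linarith
    · have := Real.rpow_le_rpow_of_exponent_le h (show s.re - 1 ≤ (3:ℝ)/2-1 by linarith)
      linarith
  · refine setIntegral_mono_set i12 ?_ (Set.Ioc_subset_Ioi_self.eventuallyLE)
    refine (ae_restrict_iff' measurableSet_Ioi).2 (Eventually.of_forall fun x hx => ?_)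
    have hx0 : 0 < x := hx
    simp only [Pi.zero_apply, Pi.add_apply]; positivity

lemma gammaSeq_ne {s : ℂ} (h1 : 0 < s.re) (j : ℕ) : s + j ≠ 0 := by
  intro h
  have := congrArg Complex.re h
  simp at this
  have h2 : (0:ℝ) ≤ j := Nat.cast_nonneg j
  linarith

lemma gammaSeq_diff {s : ℂ} (h1 : 0 < s.re) {n : ℕ} (hn : n ≠ 0) :
    DifferentiableAt ℂ (fun s => Complex.GammaSeq s n) s ∧
    logDeriv (fun s => Complex.GammaSeq s n) s = log n - ∑ j ∈ Finset.range (n+1), 1 / (s + j) := by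
  have hn' : (n:ℂ) ≠ 0 := by exact_mod_cast hn
  have d1 : HasDerivAt (fun s : ℂ => (n:ℂ)^s) ((n:ℂ)^s * Complex.log n) s := by
    simpa using (hasDerivAt_id s).const_cpow (c := (n:ℂ)) (Or.inl hn')
  have d1' := d1.mul_const ((n.factorial : ℕ) : ℂ)
  have d2 : DifferentiableAt ℂ (fun s : ℂ => ∏ j ∈ Finset.range (n+1), (s + j)) s := by fun_prop
  have nz : (∏ j ∈ Finset.range (n+1), (s + (j:ℂ))) ≠ 0 := Finset.prod_ne_zero_iff.2 fun j _ => gammaSeq_ne h1 j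
  have nf : ((n.factorial : ℕ) : ℂ) ≠ 0 := by exact_mod_cast n.factorial_ne_zero
  have nc : (n:ℂ)^s ≠ 0 := by simp [Complex.cpow_eq_zero_iff, hn']
  have e : (fun s => Complex.GammaSeq s n) = fun s : ℂ => ((n:ℂ)^s * (n.factorial : ℕ)) / ∏ j ∈ Finset.range (n+1), (s + (j:ℂ)) := rfl
  rw [e]
  refine ⟨d1'.differentiableAt.div d2 nz, ?_⟩
  rw [logDeriv_div (f := fun s : ℂ => ((n:ℂ)^s * (n.factorial : ℕ))) (g := fun s : ℂ => ∏ j ∈ Finset.range (n+1), (s + (j:ℂ))) s (mul_ne_zero nc nf) nz d1'.differentiableAt d2]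
  congr 1
  · rw [logDeriv_apply, d1'.deriv, Complex.ofReal_log (by positivity)]
    field_simp
    norm_num
  · rw [logDeriv_prod (fun j _ => gammaSeq_ne h1 j) (fun j _ => by fun_prop)]
    refine Finset.sum_congr rfl fun j _ => ?_
    rw [logDeriv_apply]; simp

lemma digamma_lim {z : ℂ} (hz : z.re = 1) :
    Tendsto (fun n : ℕ => (log n : ℂ) - ∑ j ∈ Finset.range (n+1), 1 / (z + j)) atTop
      (nhds (logDeriv Complex.Gamma z)) := by
  have hball : ∀ w ∈ Metric.closedBall z (1/2), 1/2 ≤ w.re ∧ w.re ≤ 3/2 := by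
    intro w hw
    have : |(w - z).re| ≤ 1/2 := (Complex.abs_re_le_norm _).trans (by simpa [dist_eq_norm] using hw)
    rw [abs_le, Complex.sub_re, hz] at this
    constructor <;> linarith
  have hcau : ∀ f : ℂ → ℂ, (∀ w ∈ Metric.closedBall z (1/2), DifferentiableAt ℂ f w) →
      ∮ w in C(z, 1/2), (1 / (w - z) ^ 2) • f w = (2 * π * Complex.I) • deriv f z := by
    intro f hf
    exact Complex.differentiable_on_off_countable_deriv_eq_smul_circleIntegral (by norm_num) Set.countable_empty
      (fun w hw => (hf w hw).continuousAt.continuousWithinAt) (fun w hw => hf w (Metric.ball_subset_closedBall hw.1))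
  have hG : ∀ w ∈ Metric.closedBall z (1/2), DifferentiableAt ℂ Complex.Gamma w := by
    intro w hw
    refine Complex.differentiableAt_Gamma w fun m h => ?_
    have := (hball w hw).1
    rw [h] at this; simp at this
    have h2 : (0:ℝ) ≤ m := Nat.cast_nonneg m
    linarith
  have hS : ∀ n : ℕ, n ≠ 0 → ∀ w ∈ Metric.closedBall z (1/2), DifferentiableAt ℂ (fun s => Complex.GammaSeq s n) w :=
    fun n hn w hw => (gammaSeq_diff (by linarith [(hball w hw).1]) hn).1
  have hitg : Tendsto (fun n : ℕ => ∮ w in C(z, 1/2), (1 / (w - z) ^ 2) • Complex.GammaSeq w n) atTop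
      (nhds (∮ w in C(z, 1/2), (1 / (w - z) ^ 2) • Complex.Gamma w)) := by
    unfold circleIntegral
    have hc : ∀ θ, circleMap z (1/2) θ ∈ Metric.closedBall z (1/2) := fun θ => circleMap_mem_closedBall z (by norm_num) θ
    have hcz : ∀ θ, circleMap z (1/2) θ - z ≠ 0 := fun θ => sub_ne_zero.2 (circleMap_ne_center (by norm_num))
    refine intervalIntegral.tendsto_integral_filter_of_dominated_convergence
      (fun _ => (1/2) * (4 * (Real.Gamma (1/2) + Real.Gamma (3/2)))) ?_ ?_ ?_ ?_
    · filter_upwards [eventually_ne_atTop 0] with n hn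
      refine (Continuous.aestronglyMeasurable ?_)
      refine continuous_iff_continuousAt.2 fun θ => ?_
      simp only [smul_eq_mul]
      refine ContinuousAt.mul ?_ ?_
      · have : deriv (circleMap z (1/2)) = fun θ => circleMap 0 (1/2) θ * Complex.I := by
          funext θ; simp
        rw [this]; fun_prop
      refine ContinuousAt.mul ?_ ?_
      · refine ContinuousAt.div (by fun_prop) (by fun_prop) (pow_ne_zero 2 (hcz θ))
      · exact ContinuousAt.comp (f := circleMap z (1/2)) (g := fun s => Complex.GammaSeq s n) (hS n hn _ (hc θ)).continuousAt (by fun_prop)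
    · filter_upwards [eventually_ne_atTop 0] with n hn
      refine Eventually.of_forall fun θ _ => ?_
      have hb := hball _ (hc θ)
      have := gammaSeq_bound hb.1 hb.2 hn
      rw [norm_smul, norm_smul]
      have e1 : ‖deriv (circleMap z (1/2)) θ‖ = 1/2 := by simp
      have e2 : ‖1 / (circleMap z (1/2) θ - z)^2‖ = 4 := by simp [circleMap]; norm_num
      rw [e1, e2]
      linarith
    · exact intervalIntegrable_const
    · refine Eventually.of_forall fun θ _ => ?_
      exact ((Complex.GammaSeq_tendsto_Gamma _).const_smul _).const_smul _
  have hd : Tendsto (fun n : ℕ => deriv (fun s => Complex.GammaSeq s n) z) atTop (nhds (deriv Complex.Gamma z)) := by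
    have h2 : (2 * π * Complex.I : ℂ) ≠ 0 := by simp [Real.pi_ne_zero]
    rw [hcau _ hG] at hitg
    have := hitg.const_mul (2 * π * Complex.I : ℂ)⁻¹
    rw [smul_eq_mul, inv_mul_cancel_left₀ h2] at this
    refine this.congr' ?_
    filter_upwards [eventually_ne_atTop 0] with n hn
    rw [hcau _ (hS n hn), smul_eq_mul, inv_mul_cancel_left₀ h2]
  have hne : Complex.Gamma z ≠ 0 := Complex.Gamma_ne_zero_of_re_pos (by rw [hz]; norm_num)
  refine (hd.div (Complex.GammaSeq_tendsto_Gamma z) hne).congr' ?_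
  filter_upwards [eventually_ne_atTop 0] with n hn
  rw [← (gammaSeq_diff (by rw [hz]; norm_num) hn).2]; rfl

/-- Poisson kernel -/
def PP (b u : ℝ) : ℝ := b / (b^2 + u^2)

lemma PP_re (b u : ℝ) : (1 / ((b:ℂ) + u * Complex.I)).re = PP b u := by
  rw [one_div, Complex.inv_re, PP]
  simp [Complex.normSq_apply, sq]

def muZ : Measure ℝ :=
  Measure.sum (fun γ : ZS => (ordMult γ : ENNReal) • Measure.dirac (γ : ℝ))

def vmS (t : ℝ) : ℝ := ∑' n : ℕ, ArithmeticFunction.vonMangoldt n * (n:ℝ)^(-2:ℝ) * cos (t * log n)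

lemma vm_summable : Summable (fun n : ℕ => ArithmeticFunction.vonMangoldt n * (n:ℝ)^(-2:ℝ)) := by
  have := ArithmeticFunction.LSeriesSummable_vonMangoldt (s := 2) (by norm_num)
  have h2 := this.norm
  refine h2.congr fun n => ?_
  rw [LSeries.norm_term_eq]
  split_ifs with h
  · simp [h]
  · rw [Complex.norm_real, Real.norm_of_nonneg ArithmeticFunction.vonMangoldt_nonneg, Real.rpow_neg (Nat.cast_nonneg n)]
    simp [div_eq_mul_inv]

lemma vm_re (t : ℝ) : (LSeries (fun n => (ArithmeticFunction.vonMangoldt n : ℂ)) (2 + t * Complex.I)).re = vmS t := by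
  have := ArithmeticFunction.LSeriesSummable_vonMangoldt (s := 2 + t * Complex.I) (by norm_num)
  rw [LSeries, Complex.re_tsum this, vmS]
  refine tsum_congr fun n => ?_
  rw [LSeries.term_def]
  split_ifs with h
  · simp [h]
  · have hn : (0:ℝ) < n := by positivity
    have hn' : (n:ℂ) ≠ 0 := by exact_mod_cast h
    rw [div_eq_mul_inv, Complex.re_ofReal_mul, ← Complex.cpow_neg, Complex.cpow_def_of_ne_zero hn', Complex.exp_re]
    rw [← Complex.natCast_log, Complex.re_ofReal_mul, Complex.im_ofReal_mul]
    simp only [neg_add_rev, Complex.add_re, Complex.neg_re, Complex.mul_re, Complex.ofReal_re, Complex.I_re, Complex.add_im, Complex.neg_im, Complex.mul_im, Complex.ofReal_im, Complex.I_im]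
    norm_num
    rw [mul_assoc]
    congr 2
    · rw [← Real.rpow_natCast, ← Real.rpow_neg hn.le, Real.rpow_def_of_pos hn]; norm_num
    · ring_nf

lemma logDeriv_xif_eq (t : ℝ) : logDeriv xif (3/2 + t * Complex.I) =
    1/(2 + t * Complex.I) + 1 / (1 + t * Complex.I) - log π / 2 + logDeriv Complex.Gamma (1 + t/2 * Complex.I) / 2
      + logDeriv riemannZeta (2 + t * Complex.I) := by
  set z : ℂ := 3/2 + t * Complex.I with hz
  have hzre : z.re = 3/2 := by simp [hz]
  have hs : 1/2 + z = 2 + t * Complex.I := by rw [hz]; ring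
  have ev : xif =ᶠ[nhds z] fun w => (1/2+w) * ((1/2+w-1) * ((π:ℂ)^(-(1/2+w)/2) * (Complex.Gamma ((1/2+w)/2) * riemannZeta (1/2+w)))) := by
    have : {w : ℂ | 1 < w.re} ∈ nhds z := (isOpen_lt continuous_const Complex.continuous_re).mem_nhds (by simp [hzre]; norm_num)
    filter_upwards [this] with w hw
    have hw : 1 < w.re := hw
    have h0 : 1/2 + w ≠ 0 := by intro h; have := congrArg Complex.re h; simp at this; linarith
    have h1 : 1/2 + w ≠ 1 := by intro h; have := congrArg Complex.re h; simp at this; linarith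
    rw [xif_eq_completed w h0 h1, riemannZeta_def_of_ne_zero h0, Complex.Gammaℝ]
    have g : Complex.Gamma ((1/2+w)/2) ≠ 0 := Complex.Gamma_ne_zero_of_re_pos (by simp; linarith)
    have p : (π:ℂ)^(-(1/2+w)/2) ≠ 0 := by simp [Complex.cpow_eq_zero_iff, Real.pi_ne_zero]
    generalize Complex.Gamma ((1/2+w)/2) = G at *
    generalize (π:ℂ)^(-(1/2+w)/2) = Q at *
    generalize completedRiemannZeta (1/2+w) = Z
    field_simp
  rw [logDeriv_apply, ev.deriv_eq, ev.eq_of_nhds, ← logDeriv_apply (fun w => (1/2+w) * ((1/2+w-1) * ((π:ℂ)^(-(1/2+w)/2) * (Complex.Gamma ((1/2+w)/2) * riemannZeta (1/2+w)))))]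
  have n1 : (2 + t * Complex.I : ℂ) ≠ 0 := by intro h; have := congrArg Complex.re h; simp at this
  have n2 : (1 + t * Complex.I : ℂ) ≠ 0 := by intro h; have := congrArg Complex.re h; simp at this
  have n2' : 1/2 + z - 1 ≠ 0 := by rw [hs]; convert n2 using 1; ring
  have n3 : (π:ℂ)^(-(1/2+z)/2) ≠ 0 := by simp [Complex.cpow_eq_zero_iff, Real.pi_ne_zero]
  have hg2 : (1/2+z)/2 = 1 + t/2 * Complex.I := by rw [hs]; ring
  have n4 : Complex.Gamma ((1/2+z)/2) ≠ 0 := Complex.Gamma_ne_zero_of_re_pos (by rw [hg2]; simp)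
  have n5 : riemannZeta (1/2+z) ≠ 0 := riemannZeta_ne_zero_of_one_lt_re (by rw [hs]; simp)
  have n6 : 1/2 + z ≠ 1 := by intro h; exact n2' (by rw [h]; ring)
  have dG : DifferentiableAt ℂ Complex.Gamma ((1/2+z)/2) := by
    refine Complex.differentiableAt_Gamma _ fun m h => ?_
    have := congrArg Complex.re h
    rw [hg2] at this; simp at this
    have h2 : (0:ℝ) ≤ m := Nat.cast_nonneg m
    linarith
  have d4 : DifferentiableAt ℂ (fun w : ℂ => Complex.Gamma ((1/2+w)/2)) z := dG.comp z (f := fun w : ℂ => (1/2+w)/2) (by fun_prop)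
  have dZ : DifferentiableAt ℂ riemannZeta (1/2+z) := differentiableAt_riemannZeta n6
  have d5 : DifferentiableAt ℂ (fun w : ℂ => riemannZeta (1/2+w)) z := dZ.comp z (f := fun w : ℂ => (1/2+w)) (by fun_prop)
  have d3' : HasDerivAt (fun w : ℂ => (π:ℂ)^(-(1/2+w)/2)) ((π:ℂ)^(-(1/2+z)/2) * Complex.log π * (-1/2)) z := by
    refine HasDerivAt.const_cpow (c := (π:ℂ)) (f := fun w : ℂ => -(1/2+w)/2) ?_ (Or.inl (by simp [Real.pi_ne_zero]))
    have := ((hasDerivAt_id z).const_add (1/2:ℂ)).neg.div_const 2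
    simpa using this
  have d3 := d3'.differentiableAt
  rw [logDeriv_mul (f := fun w : ℂ => 1/2+w) z (by rw [hs]; exact n1) (by simp only [mul_ne_zero_iff]; exact ⟨n2', n3, n4, n5⟩) (by fun_prop) (by fun_prop),
    logDeriv_mul (f := fun w : ℂ => 1/2+w-1) z n2' (by simp only [mul_ne_zero_iff]; exact ⟨n3, n4, n5⟩) (by fun_prop) (by fun_prop),
    logDeriv_mul (f := fun w : ℂ => (π:ℂ)^(-(1/2+w)/2)) z n3 (by simp only [mul_ne_zero_iff]; exact ⟨n4, n5⟩) (by fun_prop) (by fun_prop),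
    logDeriv_mul (f := fun w : ℂ => Complex.Gamma ((1/2+w)/2)) z n4 n5 d4 d5]
  have l1 : logDeriv (fun w : ℂ => 1/2+w) z = 1/(2 + t * Complex.I) := by
    rw [logDeriv_apply, hs]; simp
  have l2 : logDeriv (fun w : ℂ => 1/2+w-1) z = 1/(1 + t * Complex.I) := by
    rw [logDeriv_apply, hs]; simp; ring
  have l3 : logDeriv (fun w : ℂ => (π:ℂ)^(-(1/2+w)/2)) z = - log π / 2 := by
    rw [logDeriv_apply, d3'.deriv, Complex.ofReal_log Real.pi_pos.le]; field_simp
  have l4 : logDeriv (fun w : ℂ => Complex.Gamma ((1/2+w)/2)) z = logDeriv Complex.Gamma (1 + t/2 * Complex.I) / 2 := by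
    have := logDeriv_comp (f := Complex.Gamma) (g := fun w : ℂ => (1/2+w)/2) (x := z) dG (by fun_prop)
    rw [Function.comp_def] at this
    rw [this, hg2]; simp; ring
  have l5 : logDeriv (fun w : ℂ => riemannZeta (1/2+w)) z = logDeriv riemannZeta (2 + t * Complex.I) := by
    have := logDeriv_comp (f := riemannZeta) (g := fun w : ℂ => (1/2+w)) (x := z) dZ (by fun_prop)
    rw [Function.comp_def] at this
    rw [this, hs]; simp
  rw [l1, l2, l3, l4, l5]; ring

lemma lintegral_muZ (f : ℝ → ENNReal) (hf : Measurable f) : ∫⁻ x, f x ∂muZ = ∑' γ : ZS, (ordMult γ : ENNReal) * f γ := by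
  rw [muZ, lintegral_sum_measure]
  refine tsum_congr fun γ => ?_
  rw [lintegral_smul_measure, lintegral_dirac' _ hf]; rfl

lemma PP_meas (b : ℝ) : Continuous (PP b) ∨ b = 0 := by
  by_cases h : b = 0
  · exact Or.inr h
  · left
    unfold PP
    exact continuous_const.div (by fun_prop) fun x => by positivity

lemma PP_nonneg {b : ℝ} (hb : 0 ≤ b) (u : ℝ) : 0 ≤ PP b u := by unfold PP; positivity

lemma PP_cont {b : ℝ} (hb : 0 < b) : Continuous (PP b) := (PP_meas b).resolve_right hb.ne'

lemma zsum_re (t : ℝ) (N : ℕ) : (∑ γ ∈ ZF N, (ordMult γ : ℂ)/((3/2 + t * Complex.I) - γ*Complex.I)).re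
    = ∑ γ ∈ ZF N, (ordMult γ : ℝ) * PP (3/2) (t - γ) := by
  rw [Complex.re_sum]
  refine Finset.sum_congr rfl fun γ _ => ?_
  rw [← PP_re, div_eq_mul_one_div, ← Complex.ofReal_natCast, Complex.re_ofReal_mul]
  congr 3
  push_cast; ring

/-- real part of Hadamard: integrability and value of the Poisson integral -/
lemma hadamard_mu (hRH : RiemannHypothesis) (t : ℝ) : Integrable (fun γ => PP (3/2) (t - γ)) muZ ∧
    ∫ γ, PP (3/2) (t - γ) ∂muZ = (logDeriv xif (3/2 + t * Complex.I)).re := by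
  classical
  have hlim := (Complex.continuous_re.tendsto _).comp (hadamard hRH (3/2 + t * Complex.I) (by simp; norm_num))
  have hcont : Continuous (fun γ => PP (3/2) (t - γ)) := (PP_cont (by norm_num)).comp (by fun_prop)
  set g : ZS → ℝ := fun γ => (ordMult γ : ℝ) * PP (3/2) (t - γ) with hg
  have hg0 : ∀ γ, 0 ≤ g γ := fun γ => mul_nonneg (Nat.cast_nonneg _) (PP_nonneg (by norm_num) _)
  set S : ℕ → Finset ZS := fun N => (ZF N).subtype (· ∈ ZS) with hS
  have hsum : ∀ N, ∑ γ ∈ S N, g γ = (∑ γ ∈ ZF N, (ordMult γ : ℂ)/((3/2 + t * Complex.I) - γ*Complex.I)).re := by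
    intro N
    rw [zsum_re, hS]
    exact Finset.sum_subtype_of_mem (p := (· ∈ ZS)) (fun γ => (ordMult γ : ℝ) * PP (3/2) (t - γ)) (fun x hx => (mem_ZF.1 hx).1)
  have hlim2 : Tendsto (fun N => ∑ γ ∈ S N, g γ) atTop (nhds (logDeriv xif (3/2 + t * Complex.I)).re) := by
    simp only [hsum]; exact hlim
  have hmono : Monotone S := by
    intro a b hab x hx
    simp only [hS, Finset.mem_subtype, mem_ZF] at hx ⊢
    exact ⟨hx.1, hx.2.trans (by exact_mod_cast hab)⟩
  have hcov : ∀ x : ZS, ∃ n, x ∈ S n := by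
    intro x
    obtain ⟨n, hn⟩ := exists_nat_ge |(x:ℝ)|
    exact ⟨n, by simp only [hS, Finset.mem_subtype, mem_ZF]; exact ⟨x.2, hn⟩⟩
  have htop := tendsto_atTop_finset_of_monotone hmono hcov
  have hbd : ∀ s : Finset ZS, ∑ γ ∈ s, g γ ≤ (logDeriv xif (3/2 + t * Complex.I)).re := by
    intro s
    obtain ⟨N, hN⟩ := (htop.eventually (eventually_ge_atTop s)).exists
    refine (Finset.sum_le_sum_of_subset_of_nonneg hN (fun i _ _ => hg0 i)).trans ?_
    refine Monotone.ge_of_tendsto ?_ hlim2 N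
    intro a b hab
    exact Finset.sum_le_sum_of_subset_of_nonneg (hmono hab) (fun i _ _ => hg0 i)
  have hsm : Summable g := summable_of_sum_le hg0 hbd
  have htsum : ∑' γ, g γ = (logDeriv xif (3/2 + t * Complex.I)).re :=
    tendsto_nhds_unique (hsm.hasSum.comp htop) hlim2
  have hlint : ∫⁻ γ, ofReal (PP (3/2) (t - γ)) ∂muZ = ofReal (∑' γ, g γ) := by
    rw [lintegral_muZ _ (hcont.measurable.ennreal_ofReal), ENNReal.ofReal_tsum_of_nonneg hg0 hsm]
    refine tsum_congr fun γ => ?_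
    rw [hg, ENNReal.ofReal_mul (Nat.cast_nonneg _), ENNReal.ofReal_natCast]
  have hnn : 0 ≤ᵐ[muZ] (fun γ => PP (3/2) (t - γ)) := Eventually.of_forall fun γ => PP_nonneg (by norm_num) _
  constructor
  · refine ⟨hcont.aestronglyMeasurable, ?_⟩
    rw [hasFiniteIntegral_iff_ofReal hnn, hlint]; exact ENNReal.ofReal_lt_top
  · rw [integral_eq_lintegral_of_nonneg_ae hnn hcont.aestronglyMeasurable, hlint, ENNReal.toReal_ofReal (tsum_nonneg hg0), htsum]

/-- partial right side of the star identity -/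
def starR (t : ℝ) (N : ℕ) : ℝ :=
  PP 1 t - log π / 2 - vmS t + (log N / 2 - ∑ n ∈ Finset.range N, PP (2*n+4) t)

lemma star (hRH : RiemannHypothesis) (t : ℝ) :
    Tendsto (starR t) atTop (nhds (∫ γ, PP (3/2) (t - γ) ∂muZ)) := by
  rw [(hadamard_mu hRH t).2, logDeriv_xif_eq]
  have h1 := (digamma_lim (z := 1 + t/2 * Complex.I) (by simp)).div_const 2
  have h2 := (h1.const_add (1/(2 + t * Complex.I) + 1 / (1 + t * Complex.I) - log π / 2)).add_const (logDeriv riemannZeta (2 + t * Complex.I))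
  refine ((Complex.continuous_re.tendsto _).comp h2).congr fun N => ?_
  have hz : logDeriv riemannZeta (2 + t * Complex.I) = - LSeries (fun n => (ArithmeticFunction.vonMangoldt n : ℂ)) (2 + t * Complex.I) := by
    rw [ArithmeticFunction.LSeries_vonMangoldt_eq_deriv_riemannZeta_div (by simp), logDeriv_apply]; ring
  have e2 := PP_re 2 t
  have e1 := PP_re 1 t
  push_cast at e2 e1
  simp only [Function.comp, Complex.add_re, Complex.sub_re, hz, Complex.neg_re, vm_re, e1, e2, starR]
  have e3 : (((log N : ℂ) - ∑ j ∈ Finset.range (N+1), 1 / ((1 + t/2 * Complex.I) + j))/2).re = log N / 2 - (∑ n ∈ Finset.range N, PP (2*n+4) t + PP 2 t) := by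
    rw [Finset.sum_range_succ', sub_div, add_div, Finset.sum_div, Complex.sub_re, Complex.add_re, Complex.re_sum]
    congr 1
    · rw [← Complex.ofReal_ofNat, ← Complex.ofReal_div, Complex.ofReal_re]
    · rw [← e2]
      congr 1
      · refine Finset.sum_congr rfl fun n _ => ?_
        rw [← PP_re]
        congr 1
        rw [div_div]
        congr 1; push_cast; ring
      · congr 1
        rw [div_div]
        congr 1; push_cast; ring
  rw [e3]
  have : ((log π : ℂ)/2).re = log π / 2 := by
    rw [← Complex.ofReal_ofNat, ← Complex.ofReal_div, Complex.ofReal_re]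
  rw [this]; ring

/-- cosine transform -/
def ct (f : ℝ → ℝ) (u : ℝ) : ℝ := ∫ η, f η * cos (η * u)

lemma int_odd_zero {g : ℝ → ℝ} (h : ∀ x, g (-x) = - g x) : ∫ x, g x = 0 := by
  have := integral_neg_eq_self g volume
  simp_rw [h, integral_neg] at this
  linarith

lemma int_mul_cos {f : ℝ → ℝ} (hf : Integrable f) (a : ℝ) : Integrable (fun x => f x * cos (x * a)) := by
  refine hf.mul_bdd (c := 1) (by fun_prop) (Eventually.of_forall fun x => ?_)
  exact Real.abs_cos_le_one _

lemma int_mul_sin {f : ℝ → ℝ} (hf : Integrable f) (a : ℝ) : Integrable (fun x => f x * sin (x * a)) := by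
  refine hf.mul_bdd (c := 1) (by fun_prop) (Eventually.of_forall fun x => ?_)
  exact Real.abs_sin_le_one _

lemma exp_even_int {f : ℝ → ℝ} (hf : Integrable f) (he : ∀ x, f (-x) = f x) (a : ℝ) :
    ∫ x : ℝ, Complex.exp (((x * a : ℝ) : ℂ) * Complex.I) * (f x : ℂ) = (ct f a : ℂ) := by
  have h1 : ∀ x : ℝ, Complex.exp (((x * a : ℝ) : ℂ) * Complex.I) * (f x : ℂ) =
      ((f x * cos (x * a) : ℝ) : ℂ) + ((f x * sin (x * a) : ℝ) : ℂ) * Complex.I := by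
    intro x
    rw [Complex.exp_mul_I]; push_cast; ring
  simp_rw [h1]
  rw [integral_add (int_mul_cos hf a).ofReal ((int_mul_sin hf a).ofReal.mul_const _), integral_mul_const,
    integral_complex_ofReal, integral_complex_ofReal, int_odd_zero (g := fun x => f x * sin (x * a)) (fun x => by rw [he]; simp)]
  simp [ct]

lemma ct_even (f : ℝ → ℝ) (u : ℝ) : ct f (-u) = ct f u := by
  simp [ct]

lemma ct_inv {f : ℝ → ℝ} (hc : Continuous f) (hf : Integrable f) (he : ∀ x, f (-x) = f x) (hct : Integrable (ct f)) (x : ℝ) :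
    ct (ct f) x = 2 * π * f x := by
  have hF : ∀ w : ℝ, FourierTransform.fourier (fun x => (f x : ℂ)) w = (ct f (2 * π * w) : ℂ) := by
    intro w
    rw [Real.fourier_real_eq_integral_exp_smul, ← ct_even, ← exp_even_int hf he]
    refine integral_congr_ae (Eventually.of_forall fun v => ?_)
    simp only [smul_eq_mul]
    congr 3; push_cast; ring
  have h2p : (2 * π) ≠ 0 := by positivity
  have hi : Integrable (fun w => ct f (2 * π * w)) := hct.comp_mul_left' h2p
  have key := congrFun ((Complex.continuous_ofReal.comp hc).fourierInv_fourier_eq (f := fun x => (f x : ℂ)) hf.ofReal (by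
    refine hi.ofReal.congr (Eventually.of_forall fun w => ?_)
    exact (hF w).symm)) x
  rw [Real.fourierInv_eq'] at key
  have e2 : ∀ v : ℝ, Complex.exp (((2 * π * inner ℝ v x : ℝ) : ℂ) * Complex.I) • FourierTransform.fourier (fun x => (f x : ℂ)) v
      = Complex.exp (((v * (2 * π * x) : ℝ) : ℂ) * Complex.I) * ((fun w => ct f (2 * π * w)) v : ℂ) := by
    intro v
    rw [hF, smul_eq_mul]
    congr 3
    simp; ring
  simp_rw [e2] at key
  rw [exp_even_int (f := fun w => ct f (2 * π * w)) hi (fun w => by rw [mul_neg, ct_even])] at key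
  have key2 : ct (fun w => ct f (2 * π * w)) (2 * π * x) = f x := by exact_mod_cast key
  have h3 := Measure.integral_comp_mul_left (fun u => ct f u * cos (u * x)) (2 * π)
  rw [← key2]
  simp only [ct] at h3 ⊢
  have e3 : ∀ w : ℝ, cos (w * (2 * π * x)) = cos (2 * π * w * x) := fun w => by congr 1; ring
  simp_rw [e3]
  rw [h3, abs_of_pos (by positivity), smul_eq_mul, ← mul_assoc, mul_inv_cancel₀ h2p, one_mul]

lemma PP_int {b : ℝ} (hb : 0 < b) : Integrable (PP b) := by
  have := (integrable_inv_one_add_sq.comp_mul_left' (inv_ne_zero hb.ne')).mul_const b⁻¹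
  refine this.congr (Eventually.of_forall fun x => ?_)
  simp only [PP]; field_simp

lemma expabs_int {b : ℝ} (hb : 0 < b) : Integrable (fun η : ℝ => exp (-b * |η|)) := by
  rw [← integrableOn_univ, ← Set.Iic_union_Ioi (a := (0:ℝ)), integrableOn_union]
  constructor
  · refine ((integrableOn_exp_mul_Iic hb 0)).congr_fun (fun x hx => ?_) measurableSet_Iic
    simp only [abs_of_nonpos (show x ≤ 0 from hx)]; ring_nf
  · refine ((integrableOn_exp_mul_Ioi (a := -b) (by linarith) 0)).congr_fun (fun x hx => ?_) measurableSet_Ioi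
    simp only [abs_of_pos (show 0 < x from hx)]

lemma ct_exp {b : ℝ} (hb : 0 < b) (u : ℝ) : ct (fun η => exp (-b * |η|)) u = 2 * PP b u := by
  have h1 : ct (fun η => exp (-b * |η|)) u = ∫ x, (fun y => exp (-b * y) * cos (y * u)) |x| := by
    rw [ct]
    refine integral_congr_ae (Eventually.of_forall fun x => ?_)
    simp only
    rw [← Real.cos_abs (x * u), ← Real.cos_abs (|x| * u), abs_mul, abs_mul, abs_abs]
  rw [h1, integral_comp_abs (f := fun y => exp (-b * y) * cos (y * u))]
  congr 1
  have ha : (-(b:ℂ) + u * Complex.I).re < 0 := by simp [hb]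
  have h2 := integral_exp_mul_complex_Ioi ha 0
  have h3 : ∫ x in Set.Ioi (0:ℝ), exp (-b * x) * cos (x * u) = (∫ x : ℝ in Set.Ioi 0, Complex.exp ((-(b:ℂ) + u * Complex.I) * x)).re := by
    have : ∀ x : ℝ, exp (-b * x) * cos (x * u) = RCLike.re (Complex.exp ((-(b:ℂ) + u * Complex.I) * x)) := by
      intro x
      simp only [RCLike.re_eq_complex_re, Complex.exp_re]
      simp [mul_comm x u]
    simp_rw [this]
    exact integral_re (integrableOn_exp_mul_complex_Ioi ha 0)
  rw [h3, h2, ← PP_re, ← Complex.conj_re (1 / _)]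
  congr 1
  simp only [Complex.ofReal_zero, mul_zero, Complex.exp_zero, map_div₀, map_one, map_add, map_mul, Complex.conj_ofReal, Complex.conj_I]
  rw [neg_div, ← div_neg]
  congr 1; ring

lemma ct_PP {b : ℝ} (hb : 0 < b) (η : ℝ) : ct (PP b) η = π * exp (-b * |η|) := by
  have e : ct (fun η => exp (-b * |η|)) = fun u => 2 * PP b u := funext (ct_exp hb)
  have := ct_inv (f := fun η => exp (-b * |η|)) (by fun_prop) (expabs_int hb) (fun x => by simp) (by rw [e]; exact (PP_int hb).const_mul 2) η
  rw [e] at this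
  have h2 : ct (fun u => 2 * PP b u) η = 2 * ct (PP b) η := by
    simp only [ct, mul_assoc]; rw [integral_const_mul]
  rw [h2] at this; linarith

lemma PP_even (b u : ℝ) : PP b (-u) = PP b u := by simp [PP]

lemma PP_shift {b : ℝ} (hb : 0 < b) (x η : ℝ) : ∫ u, PP b (x - u) * cos (η * u) = π * exp (-b * |η|) * cos (η * x) := by
  rw [← integral_sub_left_eq_self _ volume x]
  have e : ∀ w, PP b (x - (x - w)) * cos (η * (x - w)) = (PP b w * cos (w * η)) * cos (η * x) + (PP b w * sin (w * η)) * sin (η * x) := by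
    intro w
    rw [sub_sub_cancel, mul_sub, Real.cos_sub, mul_comm w η]; ring
  simp_rw [e]
  rw [integral_add ((int_mul_cos (PP_int hb) η).mul_const _) ((int_mul_sin (PP_int hb) η).mul_const _), integral_mul_const, integral_mul_const,
    int_odd_zero (g := fun x => PP b x * sin (x * η)) (fun x => by rw [PP_even]; simp)]
  have := ct_PP hb η
  rw [ct] at this; rw [this]; ring

lemma ct_cont {f : ℝ → ℝ} (hf : Integrable f) : Continuous (ct f) := by
  refine continuous_of_dominated (bound := fun x => ‖f x‖) (fun u => (int_mul_cos hf u).aestronglyMeasurable) ?_ hf.norm ?_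
  · refine fun u => Eventually.of_forall fun x => ?_
    rw [norm_mul]
    exact mul_le_of_le_one_right (norm_nonneg _) (Real.abs_cos_le_one _)
  · exact Eventually.of_forall fun x => by fun_prop

lemma PK {b : ℝ} (hb : 0 < b) {f : ℝ → ℝ} (hf : Integrable f) (x : ℝ) :
    ∫ u, PP b (x - u) * ct f u = π * ∫ η, f η * exp (-b * |η|) * cos (η * x) := by
  have hP : Integrable (fun u => PP b (x - u)) := (PP_int hb).comp_sub_left x
  have h1 : ∀ u, PP b (x - u) * ct f u = ∫ η, PP b (x - u) * (f η * cos (η * u)) := fun u => by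
    rw [integral_const_mul]; rfl
  simp_rw [h1]
  rw [integral_integral_swap]
  · rw [← integral_const_mul]
    refine integral_congr_ae (Eventually.of_forall fun η => ?_)
    simp only
    rw [show (∫ u, PP b (x - u) * (f η * cos (η * u))) = ∫ u, f η * (PP b (x - u) * cos (η * u)) by
      refine integral_congr_ae (Eventually.of_forall fun u => ?_); simp only; ring, integral_const_mul, PP_shift hb]
    ring
  · have := (hP.mul_prod hf).mul_bdd (c := 1) (g := fun p : ℝ × ℝ => cos (p.2 * p.1)) (by fun_prop) (Eventually.of_forall fun p => Real.abs_cos_le_one _)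
    refine this.congr (Eventually.of_forall fun p => ?_)
    simp [Function.uncurry]; ring

lemma int_abs_cos {f : ℝ → ℝ} {B : ℝ} (hB : 0 < B) (h0 : ∀ x, B ≤ x → f x = 0) (u : ℝ) :
    ct (fun x => f |x|) u = 2 * ∫ y in (0:ℝ)..B, f y * cos (y * u) := by
  have h1 : ct (fun x => f |x|) u = ∫ x, (fun y => f y * cos (y * u)) |x| := by
    rw [ct]
    refine integral_congr_ae (Eventually.of_forall fun x => ?_)
    simp only
    rw [← Real.cos_abs (x * u), ← Real.cos_abs (|x| * u), abs_mul, abs_mul, abs_abs]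
  rw [h1, integral_comp_abs (f := fun y => f y * cos (y * u)), intervalIntegral.integral_of_le hB.le]
  congr 1
  refine (setIntegral_eq_of_subset_of_forall_sdiff_eq_zero measurableSet_Ioi Set.Ioc_subset_Ioi_self ?_)
  intro x hx
  have : B ≤ x := by
    by_contra h
    exact hx.2 ⟨hx.1, by linarith⟩
  rw [h0 x this, zero_mul]

lemma ct_decay {f : ℝ → ℝ} {B : ℝ} (hB : 0 < B) (hf : ContDiff ℝ 2 f) (h0 : ∀ x, B ≤ x → f x = 0) :
    ∃ C, 0 < C ∧ ∀ u, |ct (fun x => f |x|) u| ≤ C / (1 + u^2) := by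
  have hd1 : ∀ x, HasDerivAt f (deriv f x) x := fun x => (hf.differentiable (by norm_num) x).hasDerivAt
  have hf1 : ContDiff ℝ 1 (deriv f) := ((contDiff_succ_iff_deriv (n := 1)).1 hf).2.2
  have hd2 : ∀ x, HasDerivAt (deriv f) (deriv (deriv f) x) x := fun x => (hf1.differentiable (by norm_num) x).hasDerivAt
  have hc2 : Continuous (deriv (deriv f)) := hf1.continuous_deriv (by norm_num)
  set C0 := ∫ y in (0:ℝ)..B, |f y|
  set C1 := ∫ y in (0:ℝ)..B, |deriv (deriv f) y|
  have hbd : ∀ g : ℝ → ℝ, Continuous g → ∀ u, |∫ y in (0:ℝ)..B, g y * cos (y * u)| ≤ ∫ y in (0:ℝ)..B, |g y| := by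
    intro g hg u
    refine (intervalIntegral.abs_integral_le_integral_abs hB.le).trans ?_
    refine intervalIntegral.integral_mono_on hB.le (by apply Continuous.intervalIntegrable; fun_prop) (by apply Continuous.intervalIntegrable; fun_prop) fun x _ => ?_
    rw [abs_mul]
    exact mul_le_of_le_one_right (abs_nonneg _) (Real.abs_cos_le_one _)
  refine ⟨2 * (C0 + (|deriv f B| + |deriv f 0| + C1)) + 1, ?_, fun u => ?_⟩
  · have : 0 ≤ C0 := intervalIntegral.integral_nonneg hB.le fun _ _ => abs_nonneg _
    have : 0 ≤ C1 := intervalIntegral.integral_nonneg hB.le fun _ _ => abs_nonneg _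
    positivity
  rw [int_abs_cos hB h0, le_div_iff₀ (by positivity)]
  have e1 := hbd f hf.continuous u
  have e2 := hbd _ hc2 u
  have ftc : ∫ y in (0:ℝ)..B, (u^2 * (f y * cos (y * u)) + deriv (deriv f) y * cos (y * u)) =
      (u * (f B * sin (B * u)) + deriv f B * cos (B * u)) - (u * (f 0 * sin (0 * u)) + deriv f 0 * cos (0 * u)) := by
    refine intervalIntegral.integral_eq_sub_of_hasDerivAt (f := fun y => u * (f y * sin (y * u)) + deriv f y * cos (y * u)) (fun x _ => ?_) (by apply Continuous.intervalIntegrable; have := hf.continuous; fun_prop)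
    have hs : HasDerivAt (fun y => sin (y * u)) (cos (x * u) * u) x := (Real.hasDerivAt_sin _).comp x (hasDerivAt_mul_const u)
    have hc : HasDerivAt (fun y => cos (y * u)) (-sin (x * u) * u) x := (Real.hasDerivAt_cos _).comp x (hasDerivAt_mul_const u)
    refine ((((hd1 x).fun_mul hs).const_mul u).fun_add ((hd2 x).fun_mul hc)).congr_deriv ?_
    ring
  rw [intervalIntegral.integral_add (by apply Continuous.intervalIntegrable; have := hf.continuous; fun_prop) (by apply Continuous.intervalIntegrable; fun_prop), intervalIntegral.integral_const_mul, h0 B le_rfl] at ftc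
  have e3 : u^2 * |∫ y in (0:ℝ)..B, f y * cos (y * u)| ≤ |deriv f B| + |deriv f 0| + C1 := by
    rw [← abs_of_nonneg (sq_nonneg u), ← abs_mul]
    have : u^2 * (∫ y in (0:ℝ)..B, f y * cos (y * u)) = deriv f B * cos (B * u) - deriv f 0 - ∫ y in (0:ℝ)..B, deriv (deriv f) y * cos (y * u) := by
      simp at ftc ⊢; linarith
    rw [this]
    refine (abs_sub _ _).trans (add_le_add ((abs_sub _ _).trans (add_le_add ?_ le_rfl)) e2)
    rw [abs_mul]
    exact mul_le_of_le_one_right (abs_nonneg _) (Real.abs_cos_le_one _)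
  rw [abs_mul, abs_of_pos (by norm_num : (0:ℝ) < 2)]
  nlinarith

lemma vmS_le (t : ℝ) : |vmS t| ≤ ∑' n : ℕ, ArithmeticFunction.vonMangoldt n * (n:ℝ)^(-2:ℝ) := by
  refine tsum_of_norm_bounded (f := fun n : ℕ => ArithmeticFunction.vonMangoldt n * (n:ℝ)^(-2:ℝ) * cos (t * log n)) vm_summable.hasSum fun n => ?_
  rw [Real.norm_eq_abs, abs_mul, abs_of_nonneg (mul_nonneg ArithmeticFunction.vonMangoldt_nonneg (by positivity))]
  exact mul_le_of_le_one_right (mul_nonneg ArithmeticFunction.vonMangoldt_nonneg (by positivity)) (Real.abs_cos_le_one _)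

lemma harm_aux (N : ℕ) (hN : 1 ≤ N) : |log N / 2 - ∑ n ∈ Finset.range N, 1/(2*(n:ℝ)+4)| ≤ 1 := by
  have h1 := log_add_one_le_harmonic (N+1)
  have h2 := harmonic_le_one_add_log (N+1)
  have e : ((harmonic (N+1) : ℚ) : ℝ) = 1 + 2 * ∑ n ∈ Finset.range N, 1/(2*(n:ℝ)+4) := by
    rw [harmonic, Finset.sum_range_succ', Finset.mul_sum]
    push_cast
    rw [add_comm]
    congr 1
    · norm_num
    · refine Finset.sum_congr rfl fun n _ => ?_
      field_simp; ring
  rw [e] at h1 h2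
  have hNp : (1:ℝ) ≤ N := by exact_mod_cast hN
  have l1 : log N ≤ log (((N+1:ℕ):ℝ)+1) := Real.log_le_log (by linarith) (by push_cast; linarith)
  have l2 : log ((N+1:ℕ):ℝ) ≤ log N + 1 := by
    have := Real.log_le_log (show (0:ℝ) < ((N+1:ℕ):ℝ) by positivity) (show ((N+1:ℕ):ℝ) ≤ N * 2 by push_cast; linarith)
    rw [Real.log_mul (by positivity) (by norm_num)] at this
    have := Real.log_two_lt_d9
    linarith
  rw [abs_le]; constructor <;> push_cast at * <;> linarith

lemma starR_bound : ∃ C, 0 < C ∧ ∀ t : ℝ, ∀ N : ℕ, 1 ≤ N → |starR t N| ≤ C * (1 + |t|^((1:ℝ)/2)) := by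
  have hsm : Summable (fun n : ℕ => (2*(n:ℝ)+4)^(-(3:ℝ)/2)) := by
    have h := (summable_nat_add_iff 1).2 (Real.summable_nat_rpow.2 (show (-(3:ℝ)/2) < -1 by norm_num))
    refine Summable.of_nonneg_of_le (fun n => by positivity) (fun n => ?_) h
    exact Real.rpow_le_rpow_of_nonpos (by positivity) (by push_cast; linarith [Nat.cast_nonneg (α := ℝ) n]) (by norm_num)
  set S := ∑' n : ℕ, (2*(n:ℝ)+4)^(-(3:ℝ)/2)
  set V := ∑' n : ℕ, ArithmeticFunction.vonMangoldt n * (n:ℝ)^(-2:ℝ)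
  have hS : 0 ≤ S := tsum_nonneg fun n => by positivity
  have hV : 0 ≤ V := (abs_nonneg _).trans (vmS_le 0)
  refine ⟨1 + |log π / 2| + V + 1 + S, by positivity, fun t N hN => ?_⟩
  set r := |t|^((1:ℝ)/2) with hr
  have hr0 : 0 ≤ r := by positivity
  have hr2 : r^2 = |t| := by rw [hr, ← Real.sqrt_eq_rpow, Real.sq_sqrt (abs_nonneg _)]
  have h1 : |PP 1 t| ≤ 1 := by
    rw [abs_of_nonneg (PP_nonneg (by norm_num) _), PP, div_le_one (by positivity)]; nlinarith [sq_nonneg t]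
  have hP : ∀ b : ℝ, 0 < b → 1/b - PP b t ≤ b^(-(3:ℝ)/2) * r ∧ 0 ≤ 1/b - PP b t := by
    intro b hb
    set c := b^((1:ℝ)/2) with hc
    have hc0 : 0 < c := by positivity
    have hc2 : c^2 = b := by rw [hc, ← Real.sqrt_eq_rpow, Real.sq_sqrt hb.le]
    have e : b^(-(3:ℝ)/2) = 1 / (c * b) := by
      rw [hc, ← Real.rpow_add_one hb.ne', one_div, ← Real.rpow_neg hb.le]; norm_num
    have e2 : 1/b - PP b t = t^2 / (b * (b^2 + t^2)) := by
      rw [PP]; field_simp; ring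
    rw [e, e2]
    refine ⟨?_, by positivity⟩
    rw [one_div_mul_eq_div, div_le_div_iff₀ (by positivity) (by positivity)]
    have ht : t^2 = r^4 := by rw [← sq_abs, ← hr2]; ring
    rw [ht, ← hc2]
    have : c * r^4 ≤ r * (c^4 + r^4) := by
      rcases le_total c r with h | h
      · nlinarith [mul_le_mul_of_nonneg_right h (pow_nonneg hr0 4), mul_nonneg hr0 (pow_nonneg hc0.le 4)]
      · have : r^3 ≤ c^3 := pow_le_pow_left₀ hr0 h 3
        nlinarith [mul_le_mul_of_nonneg_left this (mul_nonneg hr0 hc0.le), pow_nonneg hr0 5]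
    have := mul_le_mul_of_nonneg_left this (by positivity : 0 ≤ c^2)
    nlinarith
  have h3 : |∑ n ∈ Finset.range N, (1/(2*(n:ℝ)+4) - PP (2*n+4) t)| ≤ S * r := by
    have hnn : ∀ n ∈ Finset.range N, 0 ≤ 1/(2*(n:ℝ)+4) - PP (2*n+4) t := fun n _ => (hP (2*(n:ℝ)+4) (by positivity)).2
    have hnm : ∀ n ∈ Finset.range N, 1/(2*(n:ℝ)+4) - PP (2*n+4) t ≤ (2*(n:ℝ)+4)^(-(3:ℝ)/2) * r := fun n _ => (hP (2*(n:ℝ)+4) (by positivity)).1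
    rw [abs_of_nonneg (Finset.sum_nonneg hnn)]
    refine (Finset.sum_le_sum hnm).trans ?_
    rw [← Finset.sum_mul]
    exact mul_le_mul_of_nonneg_right (hsm.sum_le_tsum _ (fun n _ => by positivity)) hr0
  have e : starR t N = PP 1 t - log π / 2 - vmS t + ((log N / 2 - ∑ n ∈ Finset.range N, 1/(2*(n:ℝ)+4)) + ∑ n ∈ Finset.range N, (1/(2*(n:ℝ)+4) - PP (2*n+4) t)) := by
    rw [starR, Finset.sum_sub_distrib]; ring
  rw [e]
  have a1 := abs_add_le (PP 1 t - log π / 2 - vmS t) ((log N / 2 - ∑ n ∈ Finset.range N, 1/(2*(n:ℝ)+4)) + ∑ n ∈ Finset.range N, (1/(2*(n:ℝ)+4) - PP (2*n+4) t))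
  have a2 := abs_sub (PP 1 t - log π / 2) (vmS t)
  have a3 := abs_sub (PP 1 t) (log π / 2)
  have a4 := abs_add_le (log N / 2 - ∑ n ∈ Finset.range N, 1/(2*(n:ℝ)+4)) (∑ n ∈ Finset.range N, (1/(2*(n:ℝ)+4) - PP (2*n+4) t))
  have a5 := vmS_le t
  have a6 := harm_aux N hN
  have a7 : 0 ≤ (1 + |log π / 2| + V + 1) * r := by positivity
  nlinarith

lemma vmS_cont : Continuous vmS := by
  refine continuous_tsum (fun n => by fun_prop) vm_summable (fun n t => ?_)
  have h0 : 0 ≤ ArithmeticFunction.vonMangoldt n * (n:ℝ)^(-2:ℝ) := mul_nonneg ArithmeticFunction.vonMangoldt_nonneg (by positivity)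
  rw [Real.norm_eq_abs, abs_mul, abs_of_nonneg h0]
  exact mul_le_of_le_one_right h0 (Real.abs_cos_le_one _)

lemma starR_cont (N : ℕ) : Continuous (fun t => starR t N) := by
  unfold starR
  refine (((PP_cont one_pos).sub continuous_const).sub vmS_cont).add (continuous_const.sub ?_)
  exact continuous_finsetSum _ fun n _ => PP_cont (by positivity)

lemma dom_int : Integrable (fun t : ℝ => (1 + |t|^((1:ℝ)/2)) / (1 + t^2)) := by
  have h := (integrable_rpow_neg_one_add_norm_sq (E := ℝ) (μ := volume) (r := 3/2) (by norm_num)).const_mul 2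
  refine h.mono' (by apply Measurable.aestronglyMeasurable; fun_prop) (Eventually.of_forall fun t => ?_)
  rw [Real.norm_eq_abs, abs_of_nonneg (by positivity), div_le_iff₀ (by positivity), Real.norm_eq_abs, sq_abs,
    mul_assoc, ← Real.rpow_add_one (by positivity)]
  have h1 : (1:ℝ) ≤ (1+t^2)^((1:ℝ)/4) := Real.one_le_rpow (by nlinarith [sq_nonneg t]) (by norm_num)
  have h2 : |t|^((1:ℝ)/2) ≤ (1+t^2)^((1:ℝ)/4) := by
    have : |t|^((1:ℝ)/2) = (t^2)^((1:ℝ)/4) := by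
      rw [← sq_abs, ← Real.rpow_natCast, ← Real.rpow_mul (abs_nonneg _)]; norm_num
    rw [this]
    exact Real.rpow_le_rpow (by positivity) (by linarith) (by norm_num)
  norm_num at *
  linarith

instance : SFinite muZ := by
  unfold muZ
  have : Countable ZS := ZS_countable.to_subtype
  infer_instance

set_option maxHeartbeats 1600000 in
lemma EF (hRH : RiemannHypothesis) {φ : ℝ → ℝ} {B : ℝ} (hB : 0 < B) (hφ : ContDiff ℝ 2 φ) (he : ∀ x, φ (-x) = φ x)
    (h0 : ∀ x, B ≤ x → φ x = 0) : Integrable (ct φ) muZ ∧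
    Tendsto (fun N : ℕ => (∫ η, φ η * exp (|η|/2)) - log π * φ 0
      - 2 * (∑' n : ℕ, ArithmeticFunction.vonMangoldt n * (n:ℝ)^(-(1:ℝ)/2) * φ (log n))
      + (φ 0 * log N - ∑ n ∈ Finset.range N, ∫ η, φ η * exp (-(2*n+5/2)*|η|))) atTop (nhds (∫ γ, ct φ γ ∂muZ)) := by
  set f : ℝ → ℝ := fun x => φ x * exp (3/2 * x) with hf
  have hfc : ContDiff ℝ 2 f := hφ.mul (by fun_prop)
  have hf0 : ∀ x, B ≤ x → f x = 0 := fun x hx => by simp [hf, h0 x hx]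
  obtain ⟨C, hC, hk⟩ := ct_decay hB hfc hf0
  obtain ⟨D, hD, hs⟩ := starR_bound
  set ψ : ℝ → ℝ := fun x => f |x| with hψ
  have hφa : ∀ x, φ |x| = φ x := fun x => by rcases abs_choice x with h | h <;> simp [h, he]
  have hψ1 : ∀ x, ψ x = φ x * exp (3/2*|x|) := fun x => by simp only [hψ, hf, hφa]
  have hψc : Continuous ψ := hfc.continuous.comp continuous_abs
  have hψs : HasCompactSupport ψ := HasCompactSupport.intro (K := Icc (-B) B) isCompact_Icc fun x hx => by
    refine hf0 _ ?_
    by_contra h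
    exact hx ⟨by linarith [neg_abs_le x], by linarith [le_abs_self x]⟩
  have hψi : Integrable ψ := hψc.integrable_of_hasCompactSupport hψs
  have hψe : ∀ x, ψ (-x) = ψ x := fun x => by simp [hψ]
  set k := ct ψ with hkd
  have hkc : Continuous k := ct_cont hψi
  have hki : Integrable k := by
    refine (integrable_inv_one_add_sq.const_mul C).mono' hkc.aestronglyMeasurable (Eventually.of_forall fun t => ?_)
    rw [← div_eq_mul_inv]; exact hk t
  have hpk : ∀ b : ℝ, 0 < b → ∀ x, ∫ t, k t * PP b (t - x) = π * ∫ η, φ η * exp (-(b-3/2)*|η|) * cos (η*x) := by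
    intro b hb x
    have := PK hb hψi x
    rw [show (fun t => k t * PP b (t-x)) = fun t => PP b (x-t) * ct ψ t from funext fun t => by rw [← PP_even, neg_sub, mul_comm], this]
    congr 2; ext η
    rw [hψ1, mul_assoc (φ η), ← Real.exp_add]; ring_nf
  have hpki : ∀ b : ℝ, 0 < b → ∀ x, Integrable (fun t => k t * PP b (t - x)) := by
    intro b hb x
    refine hki.mul_bdd (c := 1/b) ((PP_cont hb).comp (by fun_prop)).aestronglyMeasurable (Eventually.of_forall fun t => ?_)
    rw [Real.norm_eq_abs, abs_of_nonneg (PP_nonneg hb.le _), PP, div_le_div_iff₀ (by positivity) hb]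
    nlinarith [sq_nonneg (t-x)]
  have hdom : Integrable (fun t => C * D * ((1 + |t|^((1:ℝ)/2)) / (1 + t^2))) := dom_int.const_mul _
  have hkb : ∀ t y, |y| ≤ D * (1 + |t|^((1:ℝ)/2)) → |k t * y| ≤ C * D * ((1 + |t|^((1:ℝ)/2)) / (1 + t^2)) := by
    intro t y hy
    rw [abs_mul]
    refine (mul_le_mul (hk t) hy (abs_nonneg _) (by positivity)).trans (le_of_eq (by ring))
  set F : ℝ → ℝ := fun t => ∫ γ, PP (3/2) (t-γ) ∂muZ with hF
  have hFb : ∀ t, |F t| ≤ D * (1 + |t|^((1:ℝ)/2)) := fun t =>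
    le_of_tendsto (star hRH t).abs (eventually_atTop.2 ⟨1, fun N hN => hs t N hN⟩)
  have lim1 : Tendsto (fun N : ℕ => ∫ t, k t * starR t N) atTop (nhds (∫ t, k t * F t)) := by
    refine tendsto_integral_filter_of_dominated_convergence _ (Eventually.of_forall fun N => (hkc.mul (starR_cont N)).aestronglyMeasurable)
      (eventually_atTop.2 ⟨1, fun N hN => Eventually.of_forall fun t => hkb t _ (hs t N hN)⟩) hdom
      (Eventually.of_forall fun t => (star hRH t).const_mul _)
  have hprod : Integrable (fun p : ℝ × ℝ => k p.1 * PP (3/2) (p.1 - p.2)) (volume.prod muZ) := by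
    have hm : AEStronglyMeasurable (fun p : ℝ × ℝ => k p.1 * PP (3/2) (p.1 - p.2)) (volume.prod muZ) :=
      ((hkc.comp continuous_fst).mul ((PP_cont (by norm_num)).comp (by fun_prop))).aestronglyMeasurable
    rw [integrable_prod_iff hm]
    refine ⟨Eventually.of_forall fun t => (hadamard_mu hRH t).1.const_mul (k t), ?_⟩
    refine hdom.mono' hm.norm.integral_prod_right' (Eventually.of_forall fun t => ?_)
    have : (fun γ => ‖k t * PP (3/2) (t - γ)‖) = fun γ => |k t| * PP (3/2) (t-γ) := by
      ext γ; rw [Real.norm_eq_abs, abs_mul, abs_of_nonneg (PP_nonneg (by norm_num) _)]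
    simp only [this]
    rw [integral_const_mul, Real.norm_eq_abs, abs_mul, abs_abs, ← abs_mul]
    exact hkb t _ (hFb t)
  have hin : ∀ γ, ∫ t, k t * PP (3/2) (t - γ) = π * ct φ γ := fun γ => by
    rw [hpk _ (by norm_num), ct]; simp
  constructor
  · have := hprod.integral_prod_right.const_mul π⁻¹
    refine this.congr (Eventually.of_forall fun γ => ?_)
    simp only [hin]; field_simp
  have e1 : ∫ t, k t * F t = π * ∫ γ, ct φ γ ∂muZ := by
    simp_rw [hF, ← integral_const_mul, ← hin]
    rw [integral_integral_swap hprod]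
  have hk0 : ∫ t, k t = 2 * π * φ 0 := by
    have := ct_inv hψc hψi hψe hki 0
    rw [hψ1] at this
    simpa [ct, hkd] using this
  have hkcos : ∀ n : ℕ, ArithmeticFunction.vonMangoldt n * ∫ t, k t * cos (t * log n) =
      ArithmeticFunction.vonMangoldt n * (2 * π * (φ (log n) * (n:ℝ)^((3:ℝ)/2))) := by
    intro n
    rcases Nat.eq_zero_or_pos n with rfl | hn
    · simp
    have := ct_inv hψc hψi hψe hki (log n)
    rw [hψ1, abs_of_nonneg (Real.log_natCast_nonneg n)] at this
    rw [ct] at this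
    rw [this, Real.rpow_def_of_pos (by positivity : (0:ℝ) < n)]; ring_nf
  have hvm : ∫ t, k t * vmS t = 2 * π * ∑' n : ℕ, ArithmeticFunction.vonMangoldt n * (n:ℝ)^(-(1:ℝ)/2) * φ (log n) := by
    have e : ∀ t, k t * vmS t = ∑' n : ℕ, ArithmeticFunction.vonMangoldt n * (n:ℝ)^(-2:ℝ) * (k t * cos (t * log n)) := by
      intro t
      rw [vmS, ← tsum_mul_left]; congr 1; ext n; ring
    simp_rw [e]
    rw [← integral_tsum_of_summable_integral_norm (fun n => (int_mul_cos hki _).const_mul _), ← tsum_mul_left]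
    · congr 1; ext n
      rw [integral_const_mul, mul_right_comm, hkcos]
      rcases Nat.eq_zero_or_pos n with rfl | hn
      · simp
      have : (n:ℝ)^((3:ℝ)/2) * (n:ℝ)^(-2:ℝ) = (n:ℝ)^(-(1:ℝ)/2) := by rw [← Real.rpow_add (by positivity)]; norm_num
      rw [← this]; ring
    · refine Summable.of_nonneg_of_le (fun n => integral_nonneg fun _ => norm_nonneg _) (fun n => ?_) (vm_summable.mul_right (∫ t, |k t|))
      have hn0 : 0 ≤ ArithmeticFunction.vonMangoldt n * (n:ℝ)^(-2:ℝ) := mul_nonneg ArithmeticFunction.vonMangoldt_nonneg (by positivity)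
      rw [← integral_const_mul]
      refine integral_mono (((int_mul_cos hki _).const_mul _).norm) (hki.abs.const_mul _) fun t => ?_
      simp only [Real.norm_eq_abs, abs_mul, abs_of_nonneg hn0]
      exact mul_le_mul_of_nonneg_left (mul_le_of_le_one_right (abs_nonneg _) (Real.abs_cos_le_one _)) hn0
  have hp0 : ∀ b : ℝ, 0 < b → ∫ t, k t * PP b t = π * ∫ η, φ η * exp (-(b-3/2)*|η|) := by
    intro b hb; simpa using hpk b hb 0
  have hpi0 : ∀ b : ℝ, 0 < b → Integrable (fun t => k t * PP b t) := by
    intro b hb; simpa using hpki b hb 0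
  have hvmi : Integrable (fun t => k t * vmS t) :=
    hki.mul_bdd (c := ∑' n : ℕ, ArithmeticFunction.vonMangoldt n * (n:ℝ)^(-2:ℝ)) vmS_cont.aestronglyMeasurable (Eventually.of_forall fun t => vmS_le t)
  have e2 : ∀ N : ℕ, ∫ t, k t * starR t N = π * ((∫ η, φ η * exp (|η|/2)) - log π * φ 0
      - 2 * (∑' n : ℕ, ArithmeticFunction.vonMangoldt n * (n:ℝ)^(-(1:ℝ)/2) * φ (log n))
      + (φ 0 * log N - ∑ n ∈ Finset.range N, ∫ η, φ η * exp (-(2*n+5/2)*|η|))) := by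
    intro N
    have e : (fun t => k t * starR t N) = fun t => k t * PP 1 t - k t * (log π / 2) - k t * vmS t + (k t * (log N / 2) - ∑ n ∈ Finset.range N, k t * PP (2*n+4) t) := by
      ext t; rw [starR, ← Finset.mul_sum]; ring
    have i1 := hpi0 1 one_pos
    have i2 := hki.mul_const (log π / 2)
    have i3 := hki.mul_const (log N / 2)
    have i4 : ∀ n ∈ Finset.range N, Integrable (fun t => k t * PP (2*n+4) t) := fun n _ => hpi0 (2*(n:ℝ)+4) (by positivity)
    have i5 : Integrable (fun t => k t * PP 1 t - k t * (log π / 2)) := i1.sub i2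
    have i6 : Integrable (fun t => k t * PP 1 t - k t * (log π / 2) - k t * vmS t) := i5.sub hvmi
    have i7 : Integrable (fun t => k t * (log N / 2) - ∑ n ∈ Finset.range N, k t * PP (2*n+4) t) := i3.sub (integrable_finsetSum _ i4)
    rw [e, integral_add i6 i7, integral_sub i5 hvmi, integral_sub i1 i2,
      integral_sub i3 (integrable_finsetSum _ i4), integral_finsetSum _ i4, integral_mul_const, integral_mul_const, hk0, hvm, hp0 1 one_pos]
    have : ∀ n ∈ Finset.range N, ∫ t, k t * PP (2*n+4) t = π * ∫ η, φ η * exp (-(2*n+5/2)*|η|) := fun n _ => by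
      rw [hp0 (2*(n:ℝ)+4) (by positivity)]; congr 2; ext η; ring_nf
    rw [Finset.sum_congr rfl this, ← Finset.mul_sum]
    have : (fun η => φ η * exp (-(1-3/2)*|η|)) = fun η => φ η * exp (|η|/2) := by ext η; ring_nf
    rw [this]; ring
  rw [e1] at lim1
  have := lim1.const_mul π⁻¹
  have hpi : π ≠ 0 := Real.pi_ne_zero
  rw [inv_mul_cancel_left₀ hpi] at this
  refine this.congr fun N => ?_
  rw [e2, inv_mul_cancel_left₀ hpi]

lemma mertens_nat (N : ℕ) (hN : 1 ≤ N) : |∑ n ∈ Finset.Icc 0 N, Λ n / n - log N| ≤ log 4 + 5 := by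
  have h1 := ArithmeticFunction.sum_Ioc_mul_zeta_eq_sum (R := ℝ) Λ N
  rw [ArithmeticFunction.vonMangoldt_mul_zeta] at h1
  have hN0 : (0:ℝ) < N := by positivity
  have hlf : ∑ n ∈ Finset.Ioc 0 N, ArithmeticFunction.log n = log (N.factorial : ℝ) := by
    have : Finset.Ioc 0 N = Finset.Ico 1 (N+1) := by ext; simp; omega
    rw [this, ← Finset.prod_Ico_id_eq_factorial]
    push_cast
    rw [Real.log_prod (fun i hi => by have := (Finset.mem_Ico.1 hi).1; positivity)]
    rfl
  have hub : log (N.factorial : ℝ) ≤ N * log N := by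
    rw [← Real.log_pow]
    refine Real.log_le_log (by positivity) ?_
    exact_mod_cast Nat.factorial_le_pow N
  have hlb : N * log N - N ≤ log (N.factorial : ℝ) := by
    have := Real.log_le_log (by positivity) (Real.pow_div_factorial_le_exp (x := N) (by positivity) N)
    rw [Real.log_exp, Real.log_div (by positivity) (by positivity), Real.log_pow] at this
    linarith
  have hpsi := Chebyshev.psi_le_const_mul_self (x := N) (by positivity)
  rw [Chebyshev.psi, Nat.floor_natCast] at hpsi
  have e0 : ∑ n ∈ Finset.Icc 0 N, Λ n / n = ∑ n ∈ Finset.Ioc 0 N, Λ n / n := by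
    rw [← Finset.add_sum_Ioc_eq_sum_Icc (Nat.zero_le _)]; simp
  have hL : ∑ n ∈ Finset.Ioc 0 N, Λ n * ((N / n : ℕ) : ℝ) ≤ N * ∑ n ∈ Finset.Ioc 0 N, Λ n / n := by
    rw [Finset.mul_sum]
    refine Finset.sum_le_sum fun n _ => ?_
    refine (mul_le_mul_of_nonneg_left (Nat.cast_div_le (α := ℝ)) ArithmeticFunction.vonMangoldt_nonneg).trans (le_of_eq (by ring))
  have hU : N * ∑ n ∈ Finset.Ioc 0 N, Λ n / n ≤ ∑ n ∈ Finset.Ioc 0 N, Λ n * ((N / n : ℕ) : ℝ) + ∑ n ∈ Finset.Ioc 0 N, Λ n := by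
    rw [Finset.mul_sum, ← Finset.sum_add_distrib]
    refine Finset.sum_le_sum fun n hn => ?_
    have hn0 : 0 < n := (Finset.mem_Ioc.1 hn).1
    have : (N:ℝ) / n ≤ ((N / n : ℕ) : ℝ) + 1 := by
      rw [div_le_iff₀ (by positivity)]
      have := Nat.lt_div_mul_add (a := N) hn0
      have h2 : ((N:ℕ):ℝ) ≤ ((N / n * n + n : ℕ) : ℝ) := by exact_mod_cast this.le
      push_cast at h2; linarith
    have h3 : 0 ≤ Λ n := ArithmeticFunction.vonMangoldt_nonneg
    have := mul_le_mul_of_nonneg_left this h3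
    calc _ = Λ n * (N / n) := by ring
      _ ≤ _ := this
      _ = _ := by ring
  rw [e0]
  rw [hlf] at h1
  rw [← h1] at hL hU
  set s := ∑ n ∈ Finset.Ioc 0 N, Λ n / n
  have hl4 : 0 ≤ log 4 := Real.log_nonneg (by norm_num)
  rw [abs_le]
  constructor
  · have : N * (log N - 1) ≤ N * s := by linarith
    have := le_of_mul_le_mul_left this hN0
    linarith
  · have : N * s ≤ N * (log N + (log 4 + 4)) := by linarith
    have := le_of_mul_le_mul_left this hN0
    linarith

lemma mertens (x : ℝ) (hx : 1 ≤ x) : |∑ n ∈ Finset.Icc 0 ⌊x⌋₊, Λ n / n - log x| ≤ log 4 + 6 := by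
  have hf : 1 ≤ ⌊x⌋₊ := (Nat.one_le_floor_iff _).2 hx
  have hf1 : (1:ℝ) ≤ ⌊x⌋₊ := by exact_mod_cast hf
  have h := mertens_nat _ hf
  have h1 := Nat.lt_floor_add_one x
  have h2 := Nat.floor_le (zero_le_one.trans hx)
  have h3 : log ⌊x⌋₊ ≤ log x := Real.log_le_log (by positivity) h2
  have h4 : log x ≤ log ⌊x⌋₊ + 1 := by
    have : log x ≤ log (⌊x⌋₊ * 2) := Real.log_le_log (by positivity) (by linarith)
    rw [Real.log_mul (by positivity) (by norm_num)] at this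
    linarith [Real.log_two_lt_d9]
  rw [abs_le] at *
  constructor <;> linarith

lemma abel_gen (c : ℕ → ℝ) (hc : c 0 = 0) {f f' H H' : ℝ → ℝ} {x E : ℝ} (hx : 1 ≤ x)
    (hf : ∀ t ∈ Icc 1 x, HasDerivAt f (f' t) t) (hH : ∀ t ∈ Icc 1 x, HasDerivAt H (H' t) t)
    (hf' : ContinuousOn f' (Icc 1 x)) (hH' : ContinuousOn H' (Icc 1 x)) (hH1 : H 1 = 0)
    (hE : ∀ t ∈ Icc 1 x, |∑ k ∈ Finset.Icc 0 ⌊t⌋₊, c k - H t| ≤ E) :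
    |∑ k ∈ Finset.Icc 0 ⌊x⌋₊, f k * c k - ∫ t in (1:ℝ)..x, f t * H' t| ≤ E * (|f x| + ∫ t in (1:ℝ)..x, |f' t|) := by
  have hfc : ContinuousOn f (Icc 1 x) := fun t ht => (hf t ht).continuousAt.continuousWithinAt
  have hHc : ContinuousOn H (Icc 1 x) := fun t ht => (hH t ht).continuousAt.continuousWithinAt
  have hde : Set.EqOn f' (deriv f) (Icc 1 x) := fun t ht => (hf t ht).deriv.symm
  have hi' : IntegrableOn f' (Icc 1 x) := hf'.integrableOn_Icc
  have hi : IntegrableOn (deriv f) (Icc 1 x) := hi'.congr_fun hde measurableSet_Icc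
  have h1 := sum_mul_eq_sub_integral_mul₀ (f := f) c hc x (fun t ht => (hf t ht).differentiableAt) hi
  have h2 : ∫ t in Set.Ioc 1 x, deriv f t * ∑ k ∈ Finset.Icc 0 ⌊t⌋₊, c k = ∫ t in (1:ℝ)..x, f' t * ∑ k ∈ Finset.Icc 0 ⌊t⌋₊, c k := by
    rw [intervalIntegral.integral_of_le hx]
    refine setIntegral_congr_fun measurableSet_Ioc fun t ht => ?_
    simp only [hde (Set.Ioc_subset_Icc_self ht)]
  have h3 : ∫ t in (1:ℝ)..x, (f' t * H t + f t * H' t) = f x * H x - f 1 * H 1 := by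
    refine intervalIntegral.integral_eq_sub_of_hasDerivAt (f := fun t => f t * H t) (fun t ht => ?_) ?_
    · rw [Set.uIcc_of_le hx] at ht
      exact (hf t ht).fun_mul (hH t ht)
    · exact ((hf'.mul hHc).add (hfc.mul hH')).intervalIntegrable_of_Icc hx
  have i1 : IntervalIntegrable (fun t => f' t * H t) volume 1 x := (hf'.mul hHc).intervalIntegrable_of_Icc hx
  have i2 : IntervalIntegrable (fun t => f t * H' t) volume 1 x := (hfc.mul hH').intervalIntegrable_of_Icc hx
  have i3 : IntervalIntegrable (fun t => f' t * ∑ k ∈ Finset.Icc 0 ⌊t⌋₊, c k) volume 1 x := by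
    rw [intervalIntegrable_iff_integrableOn_Icc_of_le hx]
    exact integrableOn_mul_sum_Icc c (by norm_num) hi'
  rw [intervalIntegral.integral_add i1 i2, hH1, mul_zero, sub_zero] at h3
  have h4 := intervalIntegral.integral_sub i3 i1
  have e : ∑ k ∈ Finset.Icc 0 ⌊x⌋₊, f k * c k - ∫ t in (1:ℝ)..x, f t * H' t = f x * (∑ k ∈ Finset.Icc 0 ⌊x⌋₊, c k - H x)
     - ∫ t in (1:ℝ)..x, (f' t * ∑ k ∈ Finset.Icc 0 ⌊t⌋₊, c k - f' t * H t) := by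
    rw [h1, h2, h4]; linarith
  rw [e]
  refine (abs_sub _ _).trans ?_
  rw [mul_add, abs_mul, mul_comm E]
  refine add_le_add (mul_le_mul_of_nonneg_left (hE x ⟨hx, le_rfl⟩) (abs_nonneg _)) ?_
  refine (intervalIntegral.abs_integral_le_integral_abs hx).trans ?_
  rw [← intervalIntegral.integral_const_mul]
  refine intervalIntegral.integral_mono_on hx (i3.sub i1).abs (hf'.abs.intervalIntegrable_of_Icc hx |>.const_mul _) fun t ht => ?_
  rw [← mul_sub, abs_mul, mul_comm]
  exact mul_le_mul_of_nonneg_right (hE t ht) (abs_nonneg _)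

lemma S_asymp : ∃ C, 0 < C ∧ ∀ x, 1 ≤ x → |∑ n ∈ Finset.Icc 0 ⌊x⌋₊, (Λ n)^2 / n - (log x)^2 / 2| ≤ C * log x := by
  have hs : Summable fun n : ℕ ↦ (if n.Prime then 0 else Λ n) / n := by
    refine (ArithmeticFunction.vonMangoldt.summable_residueClass_non_primes_div (q := 1) 0).congr fun n => ?_
    simp [ArithmeticFunction.vonMangoldt.residueClass, Set.indicator, Subsingleton.elim (n : ZMod 1) 0]
  set P := ∑' n : ℕ, (if n.Prime then 0 else Λ n) / n
  have hnn : ∀ n : ℕ, 0 ≤ (if n.Prime then 0 else Λ n) / n := fun n => by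
    split_ifs <;> [simp; exact div_nonneg ArithmeticFunction.vonMangoldt_nonneg (by positivity)]
  have hP : 0 ≤ P := tsum_nonneg hnn
  have hl4 : 0 ≤ log 4 := Real.log_nonneg (by norm_num)
  refine ⟨2 * (log 4 + 6) + P, by positivity, fun x hx => ?_⟩
  have hlx := Real.log_nonneg hx
  have h1 := abel_gen (fun n => Λ n / n) (by simp) (f := log) (f' := fun t => t⁻¹) (H := log) (H' := fun t => t⁻¹) (E := log 4 + 6) hx
    (fun t ht => Real.hasDerivAt_log (by linarith [ht.1])) (fun t ht => Real.hasDerivAt_log (by linarith [ht.1]))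
    (fun t ht => (continuousAt_inv₀ (by linarith [ht.1])).continuousWithinAt) (fun t ht => (continuousAt_inv₀ (by linarith [ht.1])).continuousWithinAt)
    Real.log_one (fun t ht => mertens t ht.1)
  have h2 : ∫ t in (1:ℝ)..x, log t * t⁻¹ = (log x)^2/2 := by
    have : ∫ t in (1:ℝ)..x, log t * t⁻¹ = (log x)^2/2 - (log 1)^2/2 := by
      refine intervalIntegral.integral_eq_sub_of_hasDerivAt (f := fun t => (log t)^2/2) (fun t ht => ?_) ?_
      · rw [Set.uIcc_of_le hx] at ht
        refine (((Real.hasDerivAt_log (by linarith [ht.1])).fun_pow 2).div_const 2).congr_deriv ?_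
        ring
      · refine ContinuousOn.intervalIntegrable_of_Icc hx fun t ht => ?_
        have h0 : t ≠ 0 := by linarith [ht.1]
        exact ((Real.continuousAt_log h0).mul (continuousAt_inv₀ h0)).continuousWithinAt
    simpa using this
  have h3 : ∫ t in (1:ℝ)..x, |t⁻¹| = log x := by
    rw [← div_one x, ← integral_inv_of_pos one_pos (by linarith), div_one]
    refine intervalIntegral.integral_congr fun t ht => ?_
    rw [Set.uIcc_of_le hx] at ht
    exact abs_of_pos (inv_pos.2 (by linarith [ht.1]))
  rw [h2, h3, abs_of_nonneg hlx] at h1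
  have h4 : |∑ k ∈ Finset.Icc 0 ⌊x⌋₊, log k * (Λ k / k) - ∑ n ∈ Finset.Icc 0 ⌊x⌋₊, (Λ n)^2 / n| ≤ P * log x := by
    rw [← Finset.sum_sub_distrib, abs_of_nonneg]
    · have : ∀ k ∈ Finset.Icc 0 ⌊x⌋₊, log k * (Λ k / k) - (Λ k)^2 / k ≤ (if k.Prime then 0 else Λ k) / k * log x := by
        intro k hk
        have hkx : (k:ℝ) ≤ x := (Nat.cast_le.2 (Finset.mem_Icc.1 hk).2).trans (Nat.floor_le (by linarith))
        rcases Nat.eq_zero_or_pos k with rfl | hk0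
        · simp
        split_ifs with hp
        · rw [ArithmeticFunction.vonMangoldt_apply_prime hp]; apply le_of_eq; ring
        · have h1 : log k ≤ log x := Real.log_le_log (by positivity) hkx
          have h2 : 0 ≤ Λ k / k := div_nonneg ArithmeticFunction.vonMangoldt_nonneg (by positivity)
          have h3 : 0 ≤ (Λ k)^2 / k := by positivity
          nlinarith
      refine (Finset.sum_le_sum this).trans ?_
      rw [← Finset.sum_mul]
      exact mul_le_mul_of_nonneg_right (hs.sum_le_tsum _ fun n _ => hnn n) hlx
    · refine Finset.sum_nonneg fun k _ => ?_
      have : Λ k ≤ log k := ArithmeticFunction.vonMangoldt_le_log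
      have h0 : 0 ≤ Λ k := ArithmeticFunction.vonMangoldt_nonneg
      have : (Λ k)^2 / k ≤ log k * Λ k / k := by gcongr; nlinarith
      rw [← mul_div_assoc]; linarith
  rw [abs_le] at *
  constructor <;> linarith

/-- weighted sums -/
lemma D_main {g : ℝ → ℝ} (hg : ContDiff ℝ 1 g) {b : ℝ} (hb : 0 < b) : ∃ C, 0 < C ∧ ∀ κ x, 0 < κ → x = exp (κ * b) →
    |∑ n ∈ Finset.Icc 0 ⌊x⌋₊, (Λ n)^2 / n * g (log n / κ) - κ^2 * ∫ β in (0:ℝ)..b, β * g β| ≤ C * κ := by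
  obtain ⟨C, hC, hS⟩ := S_asymp
  have hgd : ∀ t, HasDerivAt g (deriv g t) t := fun t => (hg.differentiable (by norm_num) t).hasDerivAt
  have hgc := hg.continuous
  have hdc : Continuous (deriv g) := hg.continuous_deriv (by norm_num)
  set I := ∫ β in (0:ℝ)..b, |deriv g β|
  have hI : 0 ≤ I := intervalIntegral.integral_nonneg hb.le fun _ _ => abs_nonneg _
  refine ⟨C * b * (|g b| + I) + 1, by positivity, fun κ x hκ hx => ?_⟩
  have hx1 : 1 ≤ x := by rw [hx]; exact Real.one_le_exp (by positivity)
  have hlx : log x = κ * b := by rw [hx, Real.log_exp]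
  have hcd : ∀ {F : ℝ → ℝ} {F' : ℝ} {t : ℝ}, 1 ≤ t → HasDerivAt F F' (log t / κ) → HasDerivAt (fun t => F (log t / κ)) (F' * (t⁻¹/κ)) t := by
    intro F F' t ht hF
    exact hF.comp t ((Real.hasDerivAt_log (by linarith)).div_const κ)
  have hlc : ContinuousOn log (Icc 1 x) := fun t ht => (Real.continuousAt_log (by linarith [ht.1])).continuousWithinAt
  have hic : ContinuousOn (fun t:ℝ => t⁻¹) (Icc 1 x) := fun t ht => (continuousAt_inv₀ (by linarith [ht.1])).continuousWithinAt
  have hcc : ∀ {F : ℝ → ℝ}, Continuous F → ContinuousOn (fun t => F (log t / κ)) (Icc 1 x) := fun hF =>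
    hF.comp_continuousOn (hlc.div_const κ)
  have hsub : ∀ F : ℝ → ℝ, Continuous F → ∫ t in (1:ℝ)..x, F (log t / κ) * (t⁻¹/κ) = ∫ β in (0:ℝ)..b, F β := by
    intro F hF
    have : ∫ t in (1:ℝ)..x, F (log t / κ) * (t⁻¹/κ) = (∫ β in (0:ℝ)..(log x/κ), F β) - ∫ β in (0:ℝ)..(log 1/κ), F β := by
      refine intervalIntegral.integral_eq_sub_of_hasDerivAt (f := fun t => ∫ β in (0:ℝ)..(log t/κ), F β) (fun t ht => ?_) ?_
      · rw [Set.uIcc_of_le hx1] at ht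
        exact hcd (F := fun y => ∫ β in (0:ℝ)..y, F β) ht.1 (hF.integral_hasStrictDerivAt 0 _).hasDerivAt
      · exact ((hcc hF).mul (hic.div_const κ)).intervalIntegrable_of_Icc hx1
    rw [this, hlx, mul_div_cancel_left₀ _ hκ.ne']; simp
  have h1 := abel_gen (fun n => (Λ n)^2 / n) (by simp) (f := fun t => g (log t / κ)) (f' := fun t => deriv g (log t / κ) * (t⁻¹/κ))
    (H := fun t => (log t)^2/2) (H' := fun t => log t * t⁻¹) (E := C * (κ * b)) hx1
    (fun t ht => hcd ht.1 (hgd _))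
    (fun t ht => (((Real.hasDerivAt_log (by linarith [ht.1])).fun_pow 2).div_const 2).congr_deriv (by ring))
    ((hcc hdc).mul (hic.div_const κ)) (hlc.mul hic) (by simp)
    (fun t ht => (hS t ht.1).trans (by rw [← hlx]; exact mul_le_mul_of_nonneg_left (Real.log_le_log (by linarith [ht.1]) ht.2) hC.le))
  have h2 : ∫ t in (1:ℝ)..x, g (log t / κ) * (log t * t⁻¹) = κ^2 * ∫ β in (0:ℝ)..b, β * g β := by
    rw [← hsub (fun β => β * g β) (by fun_prop), ← intervalIntegral.integral_const_mul]
    congr 1; ext t; field_simp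
  have h3 : ∫ t in (1:ℝ)..x, |deriv g (log t / κ) * (t⁻¹/κ)| = I := by
    refine Eq.trans ?_ (hsub (fun β => |deriv g β|) (by fun_prop))
    refine intervalIntegral.integral_congr fun t ht => ?_
    rw [Set.uIcc_of_le hx1] at ht
    have : 0 < t⁻¹/κ := div_pos (inv_pos.2 (by linarith [ht.1])) hκ
    simp only [abs_mul, abs_of_pos this]
  rw [h2, h3, hlx, mul_div_cancel_left₀ _ hκ.ne'] at h1
  rw [Finset.sum_congr rfl (fun n _ => mul_comm _ _)]
  refine h1.trans ?_
  nlinarith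

def wB : ContDiffBump (0:ℝ) := ⟨1/4, 1/2, by norm_num, by norm_num⟩
def ww (x : ℝ) : ℝ := wB x
def vh : ℝ → ℝ := fun x => ∫ y, ww y * ww (x - y)
def vv : ℝ → ℝ := ct vh

lemma ww_smooth : ContDiff ℝ 2 ww := wB.contDiff
lemma ww_even (x : ℝ) : ww (-x) = ww x := wB.neg x
lemma ww_nonneg (x : ℝ) : 0 ≤ ww x := wB.nonneg
lemma ww_zero {x : ℝ} (hx : 1/2 ≤ |x|) : ww x = 0 := wB.zero_of_le_dist (by simpa [wB, Real.dist_eq] using hx)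
lemma ww_cs : HasCompactSupport ww := wB.hasCompactSupport
lemma ww_cont : Continuous ww := ww_smooth.continuous
lemma ww_int : Integrable ww := ww_cont.integrable_of_hasCompactSupport ww_cs

lemma vh_conv : vh = convolution ww ww (ContinuousLinearMap.mul ℝ ℝ) volume := by
  ext x; simp [vh, convolution]

lemma vh_smooth : ContDiff ℝ 2 vh := by
  rw [vh_conv]
  exact ww_cs.contDiff_convolution_right (n := 2) _ ww_int.locallyIntegrable ww_smooth

lemma vh_cont : Continuous vh := vh_smooth.continuous
lemma vh_nonneg (x : ℝ) : 0 ≤ vh x := integral_nonneg fun y => mul_nonneg (ww_nonneg _) (ww_nonneg _)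

lemma vh_zero {x : ℝ} (hx : 1 ≤ |x|) : vh x = 0 := by
  have : (fun y => ww y * ww (x - y)) = fun _ => 0 := by
    ext y
    rcases le_total (1/2) |y| with h | h
    · rw [ww_zero h, zero_mul]
    · rw [ww_zero (x := x - y), mul_zero]
      have := abs_sub_abs_le_abs_sub x y
      linarith
  simp [vh, this]

lemma vh_even (x : ℝ) : vh (-x) = vh x := by
  rw [vh, vh, ← integral_neg_eq_self]
  congr 1; ext y
  rw [ww_even, ← ww_even (-x - -y)]; ring_nf

lemma vh_cs : HasCompactSupport vh := HasCompactSupport.intro (K := Icc (-1) 1) isCompact_Icc fun x hx => by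
  refine vh_zero ?_
  by_contra h
  rw [not_le, abs_lt] at h
  exact hx ⟨h.1.le, h.2.le⟩

lemma vh_int : Integrable vh := vh_cont.integrable_of_hasCompactSupport vh_cs

lemma vv_eq (u : ℝ) : vv u = (ct ww u)^2 := by
  have h1 : vv u = ∫ x, ∫ y, ww y * ww (x - y) * cos (x * u) := by
    rw [vv, ct]; congr 1; ext x; rw [vh, integral_mul_const]
  have hp : Integrable (fun p : ℝ × ℝ => ww p.2 * ww (p.1 - p.2) * cos (p.1 * u)) (volume.prod volume) := by
    have := Integrable.convolution_integrand (ContinuousLinearMap.mul ℝ ℝ) ww_int ww_int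
    refine Integrable.mul_bdd (c := 1) this (by fun_prop) (Eventually.of_forall fun x => Real.abs_cos_le_one _)
  rw [h1, integral_integral_swap hp]
  have h2 : ∀ y, ∫ x, ww y * ww (x - y) * cos (x * u) = ww y * cos (y * u) * ct ww u := by
    intro y
    rw [← integral_add_right_eq_self _ y]
    have : (fun x => ww y * ww (x + y - y) * cos ((x+y)*u)) = fun x => ww y * cos (y*u) * (ww x * cos (x*u)) - ww y * sin (y*u) * (ww x * sin (x*u)) := by
      ext x; rw [add_sub_cancel_right, add_mul, Real.cos_add]; ring
    rw [this, integral_sub ((int_mul_cos ww_int u).const_mul _) ((int_mul_sin ww_int u).const_mul _), integral_const_mul, integral_const_mul,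
      int_odd_zero (g := fun x => ww x * sin (x*u)) (fun x => by rw [ww_even]; simp)]
    rw [mul_zero, sub_zero, ct]
  simp_rw [h2]
  rw [integral_mul_const, ← ct, sq]

lemma vv_nonneg (u : ℝ) : 0 ≤ vv u := by rw [vv_eq]; positivity
lemma vv_cont : Continuous vv := ct_cont vh_int
lemma vv_even (u : ℝ) : vv (-u) = vv u := ct_even _ u

lemma vv_bound : ∃ C, 0 < C ∧ ∀ x, vv x ≤ C / (1+x^2)^2 := by
  obtain ⟨C, hC, h⟩ := ct_decay (B := 1/2) (by norm_num) ww_smooth (fun x hx => ww_zero (by rwa [abs_of_nonneg (by linarith)]))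
  have e : (fun x => ww |x|) = ww := by
    ext x; rcases abs_choice x with h | h <;> simp [h, ww_even]
  rw [e] at h
  refine ⟨C^2, by positivity, fun x => ?_⟩
  rw [vv_eq, ← div_pow, ← sq_abs]
  exact pow_le_pow_left₀ (abs_nonneg _) (h x) 2

lemma vv_int : Integrable vv := by
  obtain ⟨C, hC, h⟩ := vv_bound
  refine (integrable_inv_one_add_sq.const_mul C).mono' vv_cont.aestronglyMeasurable (Eventually.of_forall fun x => ?_)
  rw [Real.norm_eq_abs, abs_of_nonneg (vv_nonneg x), ← div_eq_mul_inv]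
  refine (h x).trans (div_le_div_of_nonneg_left hC.le (by positivity) ?_)
  nlinarith [sq_nonneg x]

lemma ct_vv (x : ℝ) : ct vv x = 2 * π * vh x := ct_inv vh_cont vh_int vh_even vv_int x

lemma vv0_pos : 0 < vv 0 := by
  have : 0 < ∫ x, ww x := by
    rw [integral_pos_iff_support_of_nonneg ww_nonneg ww_int]
    have : Function.support ww = Metric.ball 0 (1/2) := wB.support_eq
    rw [this]; exact Metric.measure_ball_pos _ _ (by norm_num)
  rw [vv_eq]
  have e : ct ww 0 = ∫ x, ww x := by simp [ct]
  rw [e]; positivity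

lemma vv0_eq : ∫ x, vh x = vv 0 := by simp [vv, ct]

lemma vh_bdd : ∃ C, 0 < C ∧ ∀ x, vh x ≤ C := by
  obtain ⟨C, hC⟩ := vh_cs.exists_bound_of_continuous vh_cont
  exact ⟨|C|+1, by positivity, fun x => (le_abs_self _).trans ((hC x).trans (by linarith [le_abs_self C]))⟩

lemma vh_lip : ∃ L, 0 < L ∧ ∀ x y, |vh x - vh y| ≤ L * |x - y| := by
  have hc : Continuous (deriv vh) := vh_smooth.continuous_deriv (by norm_num)
  obtain ⟨C, hC⟩ := (vh_cs.deriv).exists_bound_of_continuous hc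
  refine ⟨|C|+1, by positivity, fun x y => ?_⟩
  have := Convex.norm_image_sub_le_of_norm_deriv_le (f := vh) (s := Set.univ) (C := |C|+1) (fun x _ => vh_smooth.differentiable (by norm_num) x)
    (fun x _ => (hC x).trans (by linarith [le_abs_self C])) convex_univ (Set.mem_univ y) (Set.mem_univ x)
  exact this

def Ih : ℝ := ∫ x, (vh x)^2

lemma vh_sq_int : Integrable (fun x => (vh x)^2) :=
  (vh_cont.pow 2).integrable_of_hasCompactSupport (HasCompactSupport.intro (K := Icc (-1) 1) isCompact_Icc fun x hx => by
    have : vh x = 0 := vh_zero (by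
      by_contra h
      rw [not_le, abs_lt] at h
      exact hx ⟨h.1.le, h.2.le⟩)
    simp [this])

lemma Ih_pos : 0 < Ih := by
  have h0 : ∃ x, vh x ≠ 0 := by
    by_contra h
    push Not at h
    have := vv0_pos
    rw [← vv0_eq] at this
    simp [h] at this
  obtain ⟨x, hx⟩ := h0
  refine (vh_cont.pow 2).integral_pos_of_hasCompactSupport_nonneg_nonzero ?_ (fun x => by positivity) (x := x) (by positivity)
  exact HasCompactSupport.intro (K := Icc (-1) 1) isCompact_Icc fun x hx => by
    have : vh x = 0 := vh_zero (by
      by_contra h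
      rw [not_le, abs_lt] at h
      exact hx ⟨h.1.le, h.2.le⟩)
    simp [this]

lemma comp_aff (F : ℝ → ℝ) {τ : ℝ} (hτ : 0 < τ) (ξ : ℝ) : ∫ η, F (τ * (η - ξ)) = τ⁻¹ * ∫ x, F x := by
  rw [integral_sub_right_eq_self (fun η => F (τ * η)), Measure.integral_comp_mul_left, abs_of_pos (inv_pos.2 hτ), smul_eq_mul]

def phi (τ ξ η : ℝ) : ℝ := τ/2 * (vh (τ*(η-ξ)) + vh (τ*(η-(-ξ))))

lemma phi_smooth (τ ξ : ℝ) : ContDiff ℝ 2 (phi τ ξ) := by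
  have := vh_smooth
  unfold phi
  fun_prop

lemma phi_even (τ ξ η : ℝ) : phi τ ξ (-η) = phi τ ξ η := by
  unfold phi
  rw [← vh_even (τ*(-η-ξ)), ← vh_even (τ*(-η-(-ξ)))]
  ring_nf

lemma phi_nonneg {τ : ℝ} (hτ : 0 < τ) (ξ η : ℝ) : 0 ≤ phi τ ξ η :=
  mul_nonneg (by positivity) (add_nonneg (vh_nonneg _) (vh_nonneg _))

lemma vh_aff_int {τ : ℝ} (hτ : 0 < τ) (ξ : ℝ) : Integrable (fun η => vh (τ*(η-ξ))) :=
  (vh_int.comp_mul_left' hτ.ne').comp_sub_right ξ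

lemma phi_int {τ : ℝ} (hτ : 0 < τ) (ξ : ℝ) : Integrable (phi τ ξ) :=
  ((vh_aff_int hτ ξ).add (vh_aff_int hτ (-ξ))).const_mul _

lemma phi_total {τ : ℝ} (hτ : 0 < τ) (ξ : ℝ) : ∫ η, phi τ ξ η = vv 0 := by
  unfold phi
  rw [integral_const_mul, integral_add (vh_aff_int hτ ξ) (vh_aff_int hτ (-ξ)), comp_aff _ hτ, comp_aff _ hτ, vv0_eq]
  field_simp; ring

lemma ct_phi {τ : ℝ} (hτ : 0 < τ) (ξ u : ℝ) : ct (phi τ ξ) u = vv (u/τ) * cos (ξ * u) := by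
  have h : ∀ ξ : ℝ, ∫ η, vh (τ*(η-ξ)) * cos (η * u) = τ⁻¹ * (vv (u/τ) * cos (ξ*u)) := by
    intro ξ
    have e : (fun η => vh (τ*(η-ξ)) * cos (η * u)) = fun η => (fun x => vh x * cos ((x/τ + ξ) * u)) (τ*(η-ξ)) := by
      ext η; simp only; congr 2; field_simp; ring
    rw [e, comp_aff (fun x => vh x * cos ((x/τ + ξ) * u)) hτ]
    have e2 : (fun x => vh x * cos ((x/τ + ξ) * u)) = fun x => (vh x * cos (x * (u/τ))) * cos (ξ*u) - (vh x * sin (x * (u/τ))) * sin (ξ*u) := by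
      ext x; rw [add_mul, Real.cos_add, div_mul_eq_mul_div, mul_div_assoc]; ring
    rw [e2, integral_sub ((int_mul_cos vh_int _).mul_const _) ((int_mul_sin vh_int _).mul_const _), integral_mul_const, integral_mul_const,
      int_odd_zero (g := fun x => vh x * sin (x*(u/τ))) (fun x => by rw [vh_even]; simp), zero_mul, sub_zero, vv, ct]
  have e : (fun η => phi τ ξ η * cos (η * u)) = fun η => τ/2 * (vh (τ*(η-ξ)) * cos (η*u) + vh (τ*(η-(-ξ))) * cos (η*u)) := by
    ext η; unfold phi; ring
  rw [ct, e, integral_const_mul, integral_add (int_mul_cos (vh_aff_int hτ ξ) u) (int_mul_cos (vh_aff_int hτ (-ξ)) u), h, h, neg_mul, Real.cos_neg]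
  field_simp; ring

lemma expabs_bdd_int {φ : ℝ → ℝ} (hi : Integrable φ) {c : ℝ} (hc : 0 < c) : Integrable (fun η => φ η * exp (-c*|η|)) := by
  refine hi.mul_bdd (c := 1) (by fun_prop) (Eventually.of_forall fun x => ?_)
  rw [Real.norm_eq_abs, Real.abs_exp, Real.exp_le_one_iff]
  nlinarith [abs_nonneg x]

lemma gam1 {φ : ℝ → ℝ} (hi : Integrable φ) (hn : ∀ x, 0 ≤ φ x) {a : ℝ} (ha : 0 < a) (h0 : ∀ x, |x| < a → φ x = 0) (N : ℕ) :
    |∑ n ∈ Finset.range N, ∫ η, φ η * exp (-(2*n+5/2)*|η|)| ≤ (∫ η, φ η) / (2*a) := by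
  have hI : ∀ n ∈ Finset.range N, Integrable (fun η => φ η * exp (-(2*n+5/2)*|η|)) := fun n _ => expabs_bdd_int hi (by positivity)
  rw [← integral_finsetSum _ hI, abs_of_nonneg (integral_nonneg fun η => Finset.sum_nonneg fun n _ => mul_nonneg (hn _) (by positivity)), ← integral_div]
  refine integral_mono (integrable_finsetSum _ hI) (hi.div_const _) fun η => ?_
  simp only
  rw [← Finset.mul_sum, div_eq_mul_inv]
  rcases lt_or_ge |η| a with h | h
  · rw [h0 η h]; simp
  refine mul_le_mul_of_nonneg_left ?_ (hn η)
  have hx : 0 < |η| := ha.trans_le h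
  set x := |η|
  rw [← one_div (2*a), le_div_iff₀ (by positivity), Finset.sum_mul]
  have : ∀ n ∈ Finset.range N, exp (-(2*n+5/2)*x) * (2*a) ≤ exp (-(2*(n:ℕ)*x)) - exp (-(2*((n+1 : ℕ):ℝ)*x)) := by
    intro n _
    have h1 := Real.add_one_le_exp (2*x)
    have h2 : exp (-(2*(n:ℝ)*x)) = exp (2*x) * exp (-(2*((n+1 : ℕ):ℝ)*x)) := by
      rw [← Real.exp_add]; push_cast; ring_nf
    have h3 : exp (-(2*n+5/2)*x) ≤ exp (-(2*((n+1 : ℕ):ℝ)*x)) := by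
      rw [Real.exp_le_exp]; push_cast; nlinarith
    have h4 := Real.exp_pos (-(2*((n+1 : ℕ):ℝ)*x))
    rw [h2]
    nlinarith [Real.exp_pos (-(2*(n:ℝ)+5/2)*x)]
  refine (Finset.sum_le_sum this).trans ?_
  rw [Finset.sum_range_sub' (fun n : ℕ => exp (-(2*(n:ℝ)*x)))]
  simp only [CharP.cast_eq_zero, mul_zero, zero_mul, neg_zero, Real.exp_zero]
  linarith [Real.exp_pos (-(2*(N:ℝ)*x))]

lemma abs_exp_int {c : ℝ} (hc : 0 < c) : Integrable (fun η : ℝ => |η| * exp (-c*|η|)) ∧ ∫ η : ℝ, |η| * exp (-c*|η|) ≤ 8/c^2 := by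
  have hb : ∀ η : ℝ, |η| * exp (-c*|η|) ≤ 2/c * exp (-(c/2)*|η|) := by
    intro η
    have h1 := Real.add_one_le_exp (c/2*|η|)
    have h2 : exp (-(c/2)*|η|) = exp (c/2*|η|) * exp (-c*|η|) := by rw [← Real.exp_add]; ring_nf
    rw [h2, ← mul_assoc]
    refine mul_le_mul_of_nonneg_right ?_ (Real.exp_pos _).le
    rw [div_mul_eq_mul_div, le_div_iff₀ hc]; linarith
  have hI := (expabs_int (b := c/2) (by positivity)).const_mul (2/c)
  have hi : Integrable (fun η : ℝ => |η| * exp (-c*|η|)) := hI.mono' (by fun_prop) (Eventually.of_forall fun η => by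
    rw [Real.norm_eq_abs, abs_of_nonneg (by positivity)]; exact hb η)
  refine ⟨hi, (integral_mono hi hI hb).trans ?_⟩
  have h := ct_exp (b := c/2) (by positivity) 0
  have e : ct (fun η => exp (-(c/2)*|η|)) 0 = ∫ η : ℝ, exp (-(c/2)*|η|) := by simp [ct]
  rw [integral_const_mul, ← e, h, PP]
  apply le_of_eq; field_simp; ring

lemma gam2 {φ : ℝ → ℝ} (hi : Integrable φ) (hn : ∀ x, 0 ≤ φ x) {τ L A I0 : ℝ} (hτ : 1 ≤ τ) (hL : 0 ≤ L) (h0 : φ 0 ≤ A * τ)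
    (hl : ∀ η, |φ η - φ 0| ≤ L * τ^2 * |η|) (hI0 : ∫ η, φ η = I0) (N : ℕ) (hN : ⌈τ⌉₊ ≤ N) :
    |φ 0 * log N - (∑ n ∈ Finset.range N, ∫ η, φ η * exp (-(2*n+5/2)*|η|)) - φ 0 * log τ| ≤ (8*A + 2*I0 + 2*L) * τ := by
  set n0 := ⌈τ⌉₊ with hn0
  have hn1 : τ ≤ n0 := Nat.le_ceil τ
  have hn2 : (n0:ℝ) < τ + 1 := Nat.ceil_lt_add_one (by linarith)
  have hnp : 1 ≤ n0 := by
    have : (1:ℝ) ≤ n0 := hτ.trans hn1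
    exact_mod_cast this
  have hI0n : 0 ≤ I0 := hI0 ▸ integral_nonneg hn
  set Dn : ℕ → ℝ := fun n => ∫ η, φ η * exp (-(2*n+5/2)*|η|) with hD
  have hD1 : ∀ n, 0 ≤ Dn n ∧ Dn n ≤ I0 := by
    intro n
    refine ⟨integral_nonneg fun η => mul_nonneg (hn _) (by positivity), ?_⟩
    rw [← hI0]
    refine integral_mono (expabs_bdd_int hi (by positivity)) hi fun η => mul_le_of_le_one_right (hn _) ?_
    rw [Real.exp_le_one_iff]; nlinarith [abs_nonneg η, (Nat.cast_nonneg n : (0:ℝ) ≤ n)]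
  have hD2 : ∀ n : ℕ, |Dn n - φ 0 * 2 * (1/(2*n+4))| ≤ (2*L*τ^2 + 2*(A*τ)) * (((n+1:ℕ):ℝ)^2)⁻¹ := by
    intro n
    set c : ℝ := 2*n+5/2 with hc
    have hcp : 0 < c := by positivity
    have e1 : ∫ η : ℝ, φ 0 * exp (-c*|η|) = φ 0 * (2/c) := by
      have h := ct_exp hcp 0
      have e : ct (fun η => exp (-c*|η|)) 0 = ∫ η : ℝ, exp (-c*|η|) := by simp [ct]
      rw [integral_const_mul, ← e, h, PP]; field_simp; ring
    have e2 : |Dn n - φ 0 * (2/c)| ≤ L * τ^2 * (8/c^2) := by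
      have hd : Dn n - φ 0 * (2/c) = ∫ η, (φ η - φ 0) * exp (-c*|η|) := by
        rw [← e1, hD, ← integral_sub (expabs_bdd_int hi hcp) ((expabs_int hcp).const_mul _)]
        congr 1; ext η; ring
      rw [hd]
      refine abs_integral_le_integral_abs.trans ?_
      obtain ⟨a1, a2⟩ := abs_exp_int hcp
      refine le_trans ?_ (mul_le_mul_of_nonneg_left a2 (by positivity))
      rw [← integral_const_mul]
      refine integral_mono_of_nonneg (Eventually.of_forall fun η => abs_nonneg _) (a1.const_mul _) (Eventually.of_forall fun η => ?_)
      simp only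
      rw [abs_mul, Real.abs_exp, ← mul_assoc]
      exact mul_le_mul_of_nonneg_right (hl η) (Real.exp_pos _).le
    have e3 : φ 0 * (2/c) - φ 0 * 2 * (1/(2*n+4)) = φ 0 * (3 / (c * (2*n+4))) := by
      rw [hc]; field_simp; ring
    have hq : ((n+1:ℕ):ℝ)^2 = (n+1)^2 := by push_cast; ring
    rw [hq]
    have e4 : 8/c^2 ≤ 2 * (((n:ℝ)+1)^2)⁻¹ := by
      rw [← div_eq_mul_inv, div_le_div_iff₀ (by positivity) (by positivity), hc]; nlinarith [(Nat.cast_nonneg n : (0:ℝ) ≤ n)]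
    have e5 : 3 / (c * (2*n+4)) ≤ 2 * (((n:ℝ)+1)^2)⁻¹ := by
      rw [← div_eq_mul_inv, div_le_div_iff₀ (by positivity) (by positivity), hc]; nlinarith [(Nat.cast_nonneg n : (0:ℝ) ≤ n)]
    have e6 : |φ 0 * (3 / (c * (2*n+4)))| ≤ A * τ * (2 * (((n:ℝ)+1)^2)⁻¹) := by
      rw [abs_of_nonneg (mul_nonneg (hn 0) (by positivity))]
      exact mul_le_mul h0 e5 (by positivity) ((hn 0).trans h0)
    have e7 : L * τ^2 * (8/c^2) ≤ L * τ^2 * (2 * (((n:ℝ)+1)^2)⁻¹) := mul_le_mul_of_nonneg_left e4 (by positivity)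
    have := abs_add_le (Dn n - φ 0 * (2/c)) (φ 0 * (2/c) - φ 0 * 2 * (1/(2*n+4)))
    rw [sub_add_sub_cancel, e3] at this
    linarith
  have hA : 0 ≤ A * τ := (hn 0).trans h0
  have hsplit : ∀ f : ℕ → ℝ, ∑ n ∈ Finset.range N, f n = ∑ n ∈ Finset.range n0, f n + ∑ n ∈ Finset.Ico n0 N, f n := fun f => by
    rw [Finset.sum_range_add_sum_Ico _ hN]
  have hlow : |∑ n ∈ Finset.range n0, Dn n| ≤ 2 * I0 * τ := by
    rw [abs_of_nonneg (Finset.sum_nonneg fun n _ => (hD1 n).1)]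
    refine (Finset.sum_le_sum fun n _ => (hD1 n).2).trans ?_
    rw [Finset.sum_const, Finset.card_range, nsmul_eq_mul]
    nlinarith
  have hhigh : |∑ n ∈ Finset.Ico n0 N, (Dn n - φ 0 * 2 * (1/(2*n+4)))| ≤ 2*L*τ + 2*(A*τ) := by
    refine (Finset.abs_sum_le_sum_abs _ _).trans ((Finset.sum_le_sum fun n _ => hD2 n).trans ?_)
    rw [← Finset.mul_sum, Finset.sum_Ico_add' (fun n : ℕ => ((n:ℝ)^2)⁻¹) n0 N 1]
    have hs : ∑ n ∈ Finset.Ico (n0+1) (N+1), ((n:ℝ)^2)⁻¹ ≤ τ⁻¹ := by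
      have := sum_Ioc_inv_sq_le_sub (α := ℝ) (k := n0) (n := N) (by omega) hN
      have e : Finset.Ico (n0+1) (N+1) = Finset.Ioc n0 N := by ext; simp
      rw [e]
      refine this.trans ?_
      have : ((n0:ℝ))⁻¹ ≤ τ⁻¹ := inv_anti₀ (by linarith) hn1
      have : 0 ≤ ((N:ℝ))⁻¹ := by positivity
      linarith
    refine (mul_le_mul_of_nonneg_left hs (by positivity)).trans ?_
    have : (2*L*τ^2 + 2*(A*τ)) * τ⁻¹ = 2*L*τ + 2*A := by field_simp
    rw [this]
    have : 0 ≤ A := nonneg_of_mul_nonneg_left hA (by linarith)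
    nlinarith
  have h1 := harm_aux N (hnp.trans hN)
  have h2 := harm_aux n0 hnp
  rw [hsplit] at h1
  rw [hsplit]
  change |φ 0 * log N - (∑ n ∈ Finset.range n0, Dn n + ∑ n ∈ Finset.Ico n0 N, Dn n) - φ 0 * log τ| ≤ _
  have hl1 : log τ ≤ log n0 := Real.log_le_log (by linarith) hn1
  have hl2 : log n0 ≤ log τ + 1 := by
    have : log n0 ≤ log (τ * 2) := Real.log_le_log (by positivity) (by linarith)
    rw [Real.log_mul (by positivity) (by norm_num)] at this
    linarith [Real.log_two_lt_d9]
  set a := ∑ n ∈ Finset.range n0, 1/(2*(n:ℝ)+4)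
  set b := ∑ n ∈ Finset.Ico n0 N, 1/(2*(n:ℝ)+4)
  rw [Finset.sum_sub_distrib, ← Finset.mul_sum] at hhigh
  set d := ∑ n ∈ Finset.Ico n0 N, Dn n
  set e := ∑ n ∈ Finset.range n0, Dn n
  have key : |log N - log τ - 2 * b| ≤ 5 := by
    rw [abs_le] at *
    constructor <;> linarith
  have key2 : |φ 0 * (log N - log τ - 2 * b)| ≤ A * τ * 5 := by
    rw [abs_mul, abs_of_nonneg (hn 0)]
    exact mul_le_mul h0 key (abs_nonneg _) hA
  have hfin : φ 0 * log N - (e + d) - φ 0 * log τ = φ 0 * (log N - log τ - 2 * b) - e - (d - φ 0 * 2 * b) := by ring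
  rw [hfin]
  rw [abs_le] at *
  constructor <;> linarith

def Vt (τ ξ : ℝ) : ℝ := ∫ γ, vv (γ/τ) * cos (ξ * γ) ∂muZ
def X1 (τ ξ : ℝ) : ℝ := τ * log τ * vh (τ * ξ)
def X2 (τ : ℝ) (N : ℕ) (ξ : ℝ) : ℝ := τ * ∑ n ∈ Finset.Icc 0 N, Λ n * (n:ℝ)^(-(1:ℝ)/2) * vh (τ * (log n - ξ))

lemma vv_mu_int (hRH : RiemannHypothesis) {τ : ℝ} (hτ : 0 < τ) : Integrable (fun γ => vv (γ/τ)) muZ := by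
  have := (EF hRH (B := 1/τ) (by positivity) (phi_smooth τ 0) (phi_even τ 0) (fun x hx => ?_)).1
  · refine this.congr (Eventually.of_forall fun γ => ?_)
    simp [ct_phi hτ]
  · have : 1 ≤ τ * x := by rw [div_le_iff₀ hτ] at hx; linarith
    unfold phi
    rw [vh_zero (by simpa using this.trans (le_abs_self _)), vh_zero (by simpa using this.trans (le_abs_self _))]; simp

lemma V_main (hRH : RiemannHypothesis) : ∃ C, 0 < C ∧ ∀ N : ℕ, 1 ≤ N → ∀ τ ξ : ℝ, 2*(N+1) ≤ τ → 0 ≤ ξ → ξ ≤ log (N+1/2) →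
    |Vt τ ξ - X1 τ ξ + X2 τ N ξ| ≤ C * (exp (ξ/2) + τ/(1+τ*ξ)) := by
  obtain ⟨A, hA, hvA⟩ := vh_bdd
  obtain ⟨L, hL, hvL⟩ := vh_lip
  have hv0 := vv0_pos
  have hlp : 0 ≤ log π := Real.log_nonneg (by linarith [Real.pi_gt_three])
  set G := 8*A + 2*vv 0 + 2*L with hG
  refine ⟨2 * vv 0 + 3 * (log π * A + G + vv 0), by positivity, fun N hN τ ξ hτ hξ hξN => ?_⟩
  have hN1 : (1:ℝ) ≤ N := by exact_mod_cast hN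
  have hτ0 : 0 < τ := by linarith
  have hτ4 : 4 ≤ τ := by linarith
  set φ := phi τ ξ with hφ
  have hsupp : ∀ η, ξ + 1/τ ≤ |η| → φ η = 0 := by
    intro η hη
    have h1 : 1 ≤ τ * (|η| - ξ) := by
      have := mul_le_mul_of_nonneg_left hη hτ0.le
      rw [mul_add, mul_one_div_cancel hτ0.ne'] at this; linarith
    have h2 : ∀ y, |η| - ξ ≤ |y| → vh (τ * y) = 0 := fun y hy => vh_zero (by
      rw [abs_mul, abs_of_pos hτ0]; exact h1.trans (mul_le_mul_of_nonneg_left hy hτ0.le))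
    rw [hφ, phi, h2, h2]; · simp
    · have := abs_sub_abs_le_abs_sub η (-ξ); rw [abs_neg, abs_of_nonneg hξ] at this; exact this
    · have := abs_sub_abs_le_abs_sub η ξ; rw [abs_of_nonneg hξ] at this; exact this
  have hEF := (EF hRH (B := ξ + 1/τ) (by positivity) (phi_smooth τ ξ) (phi_even τ ξ) (fun x hx => hsupp x (hx.trans (le_abs_self x)))).2
  have hV : ∫ γ, ct (phi τ ξ) γ ∂muZ = Vt τ ξ := by
    rw [Vt]; congr 1; ext γ; exact ct_phi hτ0 ξ γ
  rw [hV, ← hφ] at hEF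
  have hφ0 : φ 0 = τ * vh (τ * ξ) := by
    rw [hφ, phi, zero_sub, mul_neg, vh_even, zero_sub, neg_neg]; ring
  have hφn : ∀ x, 0 ≤ φ x := phi_nonneg hτ0 ξ
  have hφi : Integrable φ := phi_int hτ0 ξ
  have hφt : ∫ η, φ η = vv 0 := phi_total hτ0 ξ
  -- prime sum
  have hprime : 2 * (∑' n : ℕ, Λ n * (n:ℝ)^(-(1:ℝ)/2) * φ (log n)) = X2 τ N ξ := by
    rw [tsum_eq_sum (s := Finset.Icc 0 N), X2, Finset.mul_sum, Finset.mul_sum]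
    · refine Finset.sum_congr rfl fun n _ => ?_
      rcases Nat.lt_or_ge n 2 with h | h
      · interval_cases n <;> simp
      have hl : log 2 ≤ log n := Real.log_le_log (by norm_num) (by exact_mod_cast h)
      have h2 : vh (τ * (log n - -ξ)) = 0 := by
        refine vh_zero ?_
        rw [abs_of_nonneg (mul_nonneg hτ0.le (by linarith [Real.log_two_gt_d9]))]
        nlinarith [Real.log_two_gt_d9]
      rw [hφ, phi, h2]; ring
    · intro n hn
      have hn' : N + 1 ≤ n := by simp at hn; omega
      rw [hsupp, mul_zero]
      have hl : log (N+1) ≤ log n := Real.log_le_log (by positivity) (by exact_mod_cast hn')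
      have h2 : log (N+1/2) + 1/τ ≤ log (N+1) := by
        have e : log (N+1/2) = log (N+1) + log ((N+1/2)/(N+1)) := by
          rw [← Real.log_mul (by positivity) (by positivity)]; congr 1; field_simp
        have h3 := Real.log_le_sub_one_of_pos (x := ((N:ℝ)+1/2)/(N+1)) (by positivity)
        have h4 : ((N:ℝ)+1/2)/(N+1) - 1 = -(1/(2*(N+1))) := by field_simp; ring
        have h5 : 1/τ ≤ 1/(2*((N:ℝ)+1)) := one_div_le_one_div_of_le (by positivity) hτ
        linarith
      exact (by linarith : _ ≤ log n).trans (le_abs_self _)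
  rw [hprime] at hEF
  -- pole
  have hpole : |∫ η, φ η * exp (|η|/2)| ≤ 2 * vv 0 * exp (ξ/2) := by
    rw [abs_of_nonneg (integral_nonneg fun η => mul_nonneg (hφn _) (by positivity)), mul_right_comm, mul_comm _ (vv 0), ← hφt, ← integral_mul_const]
    refine integral_mono_of_nonneg (Eventually.of_forall fun η => mul_nonneg (hφn _) (by positivity)) (hφi.mul_const _) (Eventually.of_forall fun η => ?_)
    simp only
    rcases le_total (ξ + 1/τ) |η| with h | h
    · rw [hsupp η h]; simp
    refine mul_le_mul_of_nonneg_left ?_ (hφn η)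
    have h1 : exp (|η|/2) ≤ exp (1/8) * exp (ξ/2) := by
      rw [← Real.exp_add, Real.exp_le_exp]
      have : 1/τ ≤ 1/4 := one_div_le_one_div_of_le (by norm_num) hτ4
      linarith
    have h2 : exp (1/8) ≤ 2 := by
      have : exp (1/8) ≤ exp (log 2) := Real.exp_le_exp.2 (by linarith [Real.log_two_gt_d9])
      rwa [Real.exp_log (by norm_num)] at this
    nlinarith [Real.exp_pos (ξ/2)]
  -- gamma
  have hgam : ∀ᶠ K : ℕ in atTop, |(φ 0 * log K - ∑ n ∈ Finset.range K, ∫ η, φ η * exp (-(2*n+5/2)*|η|)) - log π * φ 0 - X1 τ ξ| ≤ 3 * (log π * A + G + vv 0) * (τ/(1+τ*ξ)) := by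
    rcases le_total ξ (2/τ) with h | h
    · have h3 : τ ≤ 3 * (τ/(1+τ*ξ)) := by
        rw [le_div_iff₀ hτ0] at h
        rw [← mul_div_assoc, le_div_iff₀ (by positivity)]; nlinarith
      filter_upwards [eventually_ge_atTop ⌈τ⌉₊] with K hK
      have h0 : φ 0 ≤ A * τ := by rw [hφ0]; nlinarith [hvA (τ*ξ)]
      have hl : ∀ η, |φ η - φ 0| ≤ L * τ^2 * |η| := by
        intro η
        have h1 := hvL (τ*(η-ξ)) (τ*(0-ξ))
        have h2 := hvL (τ*(η- -ξ)) (τ*(0- -ξ))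
        rw [← mul_sub, abs_mul, abs_of_pos hτ0, sub_sub_sub_cancel_right, sub_zero] at h1 h2
        have e : φ η - φ 0 = τ/2 * ((vh (τ*(η-ξ)) - vh (τ*(0-ξ))) + (vh (τ*(η- -ξ)) - vh (τ*(0- -ξ)))) := by
          rw [hφ, phi, phi]; ring
        rw [e, abs_mul, abs_of_pos (by positivity)]
        refine (mul_le_mul_of_nonneg_left ((abs_add_le _ _).trans (add_le_add h1 h2)) (by positivity)).trans (le_of_eq (by ring))
      have hg := gam2 hφi hφn (by linarith) hL.le h0 hl hφt K hK
      have e : X1 τ ξ = φ 0 * log τ := by rw [X1, hφ0]; ring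
      rw [e]
      have h5 : |log π * φ 0| ≤ log π * A * τ := by
        rw [abs_of_nonneg (mul_nonneg hlp (hφn 0)), mul_assoc]
        exact mul_le_mul_of_nonneg_left h0 hlp
      have h6 : (log π * A + G + vv 0) * τ ≤ (log π * A + G + vv 0) * (3 * (τ/(1+τ*ξ))) := mul_le_mul_of_nonneg_left h3 (by positivity)
      have h7 : 0 ≤ vv 0 * τ := by positivity
      rw [abs_le] at *
      constructor <;> linarith
    · have hξ0 : 0 < ξ := lt_of_lt_of_le (by positivity) h
      have hx : 2 ≤ ξ * τ := by rwa [div_le_iff₀ hτ0] at h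
      have hz : vh (τ * ξ) = 0 := vh_zero (by rw [abs_of_nonneg (by positivity)]; linarith)
      refine Eventually.of_forall fun K => ?_
      rw [X1, hφ0, hz]
      simp only [mul_zero, zero_mul, zero_sub, sub_zero, abs_neg]
      have := gam1 hφi hφn (a := ξ/2) (by positivity) (fun x hx' => ?_) K
      · refine this.trans ?_
        rw [hφt, show 2 * (ξ/2) = ξ by ring, mul_assoc, ← mul_div_assoc, ← mul_div_assoc, div_le_div_iff₀ hξ0 (by positivity)]
        have : vv 0 * (1 + τ * ξ) ≤ vv 0 * (3 * (ξ * τ)) := mul_le_mul_of_nonneg_left (by linarith) hv0.le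
        have h2 : 0 ≤ (log π * A + G) * (ξ * τ) := by positivity
        linarith
      · have h2 : ∀ y, ξ/2 ≤ |y| → vh (τ * y) = 0 := fun y hy => vh_zero (by
          rw [abs_mul, abs_of_pos hτ0]
          have := mul_le_mul_of_nonneg_left hy hτ0.le
          linarith)
        rw [hφ, phi, h2, h2]; · simp
        · rw [abs_lt] at hx'
          exact le_trans (by linarith) (le_abs_self _)
        · rw [abs_lt] at hx'
          exact le_trans (by linarith) (neg_le_abs _)
  have hlim := ((hEF.sub_const (X1 τ ξ)).add_const (X2 τ N ξ)).abs
  refine le_of_tendsto hlim ?_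
  filter_upwards [hgam] with K hK
  set g := ∑ n ∈ Finset.range K, ∫ η, φ η * exp (-(2*n+5/2)*|η|)
  set p := ∫ η, φ η * exp (|η|/2)
  have e : p - log π * φ 0 - X2 τ N ξ + (φ 0 * log K - g) - X1 τ ξ + X2 τ N ξ =
    p + ((φ 0 * log K - g) - log π * φ 0 - X1 τ ξ) := by ring
  rw [e]
  refine (abs_add_le _ _).trans ((add_le_add hpole hK).trans ?_)
  have e1 := Real.exp_pos (ξ/2)
  have e2 : 0 ≤ τ/(1+τ*ξ) := by positivity
  have e3 : 0 ≤ log π * A + G + vv 0 := by positivity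
  nlinarith [mul_nonneg hv0.le e2, mul_nonneg e3 e1.le]

lemma spike {G : ℝ → ℝ} {a B c τ L : ℝ} (hτ : 0 < τ) (hG : Continuous G) (ha : a ≤ c - 1/τ) (hB : c + 1/τ ≤ B) (hL : 0 ≤ L)
    (hl : ∀ ξ ∈ Icc a B, |G ξ - G c| ≤ L * |ξ - c|) :
    |(∫ ξ in a..B, G ξ * (τ^2 * (vh (τ*(c-ξ)))^2)) - G c * (τ * Ih)| ≤ L * Ih := by
  have h1 : 0 < 1/τ := by positivity
  have hab : a ≤ B := by linarith
  have hz : ∀ ξ, ξ ∉ Set.Ioc a B → vh (τ*(c-ξ)) = 0 := fun ξ hξ => vh_zero (by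
    rw [abs_mul, abs_of_pos hτ, ← div_le_iff₀' hτ]
    by_contra! h
    rw [abs_lt] at h
    exact hξ ⟨by linarith, by linarith⟩)
  have hI : ∫ ξ in a..B, τ^2 * (vh (τ*(c-ξ)))^2 = τ * Ih := by
    rw [intervalIntegral.integral_eq_integral_of_support_subset, integral_const_mul]
    · have := comp_aff (fun x => (vh x)^2) hτ c
      have h2 : ∀ ξ, vh (τ*(c-ξ)) = vh (τ*(ξ-c)) := fun ξ => by rw [← vh_even]; congr 1; ring
      simp only [h2]; rw [this, ← Ih]; field_simp
    · intro ξ hξ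
      by_contra h
      exact hξ (by simp [hz ξ h])
  have hvc := vh_cont
  have hi1 : IntervalIntegrable (fun ξ => G ξ * (τ^2 * (vh (τ*(c-ξ)))^2)) volume a B := Continuous.intervalIntegrable (by fun_prop) _ _
  have hi2 : IntervalIntegrable (fun ξ => G c * (τ^2 * (vh (τ*(c-ξ)))^2)) volume a B := Continuous.intervalIntegrable (by fun_prop) _ _
  rw [← hI, ← intervalIntegral.integral_const_mul, ← intervalIntegral.integral_sub hi1 hi2]
  have h3 : L * Ih = ∫ ξ in a..B, (L/τ) * (τ^2 * (vh (τ*(c-ξ)))^2) := by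
    rw [intervalIntegral.integral_const_mul, hI]; field_simp
  rw [h3, ← Real.norm_eq_abs]
  refine intervalIntegral.norm_integral_le_of_norm_le hab (ae_of_all _ fun ξ hξ => ?_) (Continuous.intervalIntegrable (by fun_prop) _ _)
  rw [← sub_mul, Real.norm_eq_abs, abs_mul, abs_of_nonneg (a := τ^2 * _) (by positivity)]
  by_cases hv : vh (τ*(c-ξ)) = 0
  · simp [hv]
  refine mul_le_mul_of_nonneg_right ((hl ξ ⟨hξ.1.le, hξ.2⟩).trans ?_) (by positivity)
  rw [div_eq_mul_one_div]
  refine mul_le_mul_of_nonneg_left ?_ hL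
  by_contra! h
  refine hv (vh_zero ?_)
  rw [abs_mul, abs_of_pos hτ, abs_sub_comm, ← div_le_iff₀' hτ]; exact h.le

lemma lip_Icc {g : ℝ → ℝ} (hg : ContDiff ℝ 1 g) (b : ℝ) : ∃ L, 0 ≤ L ∧ ∀ x ∈ Icc (-b) b, ∀ y ∈ Icc (-b) b, |g x - g y| ≤ L * |x - y| := by
  have hc : Continuous (deriv g) := hg.continuous_deriv le_rfl
  obtain ⟨C, hC⟩ := isCompact_Icc.exists_bound_of_continuousOn (s := Icc (-b) b) hc.continuousOn
  refine ⟨|C|, abs_nonneg _, fun x hx y hy => ?_⟩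
  exact (convex_Icc (-b) b).norm_image_sub_le_of_norm_deriv_le (fun z _ => (hg.differentiable one_ne_zero).differentiableAt)
    (fun z hz => (hC z hz).trans (le_abs_self _)) hy hx

lemma X1X2_zero {N : ℕ} {τ ξ : ℝ} (hτ : 4 ≤ τ) (hξ : 0 ≤ ξ) : X1 τ ξ * X2 τ N ξ = 0 := by
  by_cases h : 1 ≤ τ * ξ
  · rw [X1, vh_zero (h.trans (le_abs_self _))]; ring
  push Not at h
  rw [X2, Finset.sum_eq_zero]; · ring
  intro n _
  by_cases hn : n ≤ 1
  · interval_cases n <;> simp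
  rw [vh_zero]; · ring
  refine le_trans ?_ (le_abs_self _)
  have h2 : log 2 ≤ log n := Real.log_le_log (by norm_num) (by exact_mod_cast (not_le.mp hn))
  have := Real.log_two_gt_d9
  nlinarith

lemma X2_sq {N : ℕ} {τ : ℝ} (hτ : 2*(N+1) ≤ τ) (ξ : ℝ) :
    (X2 τ N ξ)^2 = ∑ n ∈ Finset.Icc 0 N, (Λ n)^2/n * (τ^2 * (vh (τ*(log n - ξ)))^2) := by
  have hτ0 : 0 < τ := by have : (0:ℝ) ≤ N := N.cast_nonneg; linarith
  have key : ∀ m ∈ Finset.Icc 0 N, ∀ n ∈ Finset.Icc 0 N, m < n → Λ m ≠ 0 → vh (τ*(log m - ξ)) * vh (τ*(log n - ξ)) = 0 := by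
    intro m hm n hn hmn hΛ
    have hm0 : 0 < m := Nat.pos_of_ne_zero (by rintro rfl; simp at hΛ)
    have hnN : (n:ℝ) ≤ N := by exact_mod_cast (Finset.mem_Icc.mp hn).2
    have hm0' : (0:ℝ) < m := by exact_mod_cast hm0
    have hmn' : (m:ℝ) + 1 ≤ n := by exact_mod_cast hmn
    have hn0 : (0:ℝ) < n := by linarith
    have h1 : 2 / τ ≤ log n - log m := by
      have := Real.one_sub_inv_le_log_of_pos (x := (n:ℝ)/m) (by positivity)
      rw [Real.log_div hn0.ne' hm0'.ne', inv_div] at this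
      refine le_trans ?_ this
      rw [div_le_iff₀ hτ0, one_sub_div hn0.ne', div_mul_eq_mul_div, le_div_iff₀ hn0]
      nlinarith
    rw [div_le_iff₀ hτ0] at h1
    by_contra hne
    have a1 : |τ*(log m - ξ)| < 1 := by by_contra! h; exact hne (by rw [vh_zero h]; ring)
    have a2 : |τ*(log n - ξ)| < 1 := by by_contra! h; exact hne (by rw [vh_zero h]; ring)
    rw [abs_lt] at a1 a2
    nlinarith
  rw [X2, mul_pow, pow_two (Finset.sum _ _), Finset.sum_mul_sum, Finset.mul_sum]
  refine Finset.sum_congr rfl fun m hm => ?_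
  rw [Finset.sum_eq_single m]
  · by_cases h0 : m = 0
    · subst h0; simp
    have hp : ((m:ℝ)^(-(1:ℝ)/2))^2 = 1/m := by
      rw [← Real.rpow_natCast, ← Real.rpow_mul (by positivity)]; norm_num [Real.rpow_neg_one]
    calc _ = (Λ m)^2 * ((m:ℝ)^(-(1:ℝ)/2))^2 * (τ^2 * (vh (τ*(log m - ξ)))^2) := by ring
      _ = _ := by rw [hp]; ring
  · intro n hn hne
    by_cases hΛ : Λ m = 0 ∨ Λ n = 0
    · rcases hΛ with h | h <;> simp [h]
    push Not at hΛ
    have : vh (τ*(log m - ξ)) * vh (τ*(log n - ξ)) = 0 := by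
      rcases lt_or_gt_of_ne hne with h | h
      · rw [mul_comm]; exact key n hn m hm h hΛ.2
      · exact key m hm n hn h hΛ.1
    linear_combination (Λ m * (m:ℝ)^(-(1:ℝ)/2) * (Λ n * (n:ℝ)^(-(1:ℝ)/2))) * this
  · intro h; exact absurd hm h

lemma X2_cont (τ : ℝ) (N : ℕ) : Continuous (X2 τ N) := by
  have := vh_cont
  unfold X2; fun_prop

lemma X1_cont (τ : ℝ) : Continuous (X1 τ) := by
  have := vh_cont
  unfold X1; fun_prop

lemma Vt_cont (hRH : RiemannHypothesis) {τ : ℝ} (hτ : 0 < τ) : Continuous (Vt τ) := by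
  have hv := vv_cont
  refine continuous_of_dominated (bound := fun γ => vv (γ/τ)) (fun ξ => (Continuous.aestronglyMeasurable (by fun_prop))) (fun ξ => ae_of_all _ fun γ => ?_) (vv_mu_int hRH hτ) (ae_of_all _ fun γ => by fun_prop)
  rw [norm_mul, Real.norm_eq_abs, Real.norm_eq_abs, abs_of_nonneg (vv_nonneg _)]
  exact mul_le_of_le_one_right (vv_nonneg _) (Real.abs_cos_le_one _)

lemma X2_asymp {g : ℝ → ℝ} (hg : ContDiff ℝ 1 g) {b : ℝ} (hb : 0 < b) : ∃ C, 0 < C ∧ ∀ (N : ℕ) (κ τ : ℝ), 1 ≤ N → 1 ≤ κ → exp (κ*b) = N + 1/2 → 2*(N+1) ≤ τ →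
    |(∫ ξ in 0..(κ*b), g (ξ/κ) * (X2 τ N ξ)^2) - τ * Ih * (κ^2 * ∫ β in 0..b, β * g β)| ≤ C * (τ * κ) := by
  obtain ⟨C1, hC1, h1⟩ := D_main hg hb
  obtain ⟨C2, hC2, h2⟩ := D_main (g := fun _ => (1:ℝ)) contDiff_const hb
  obtain ⟨L, hL, hl⟩ := lip_Icc hg b
  have hgc := hg.continuous
  have hvc := vh_cont
  have hI := Ih_pos
  refine ⟨Ih * C1 + L * Ih * (b^2/2 + C2), by positivity, fun N κ τ hN hκ1 hx hτ => ?_⟩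
  have hκ : 0 < κ := by linarith
  have hN1 : (1:ℝ) ≤ N := by exact_mod_cast hN
  have hτ0 : 0 < τ := by linarith
  have hfl : ⌊(N:ℝ)+1/2⌋₊ = N := by
    rw [Nat.floor_eq_iff (by positivity)]; constructor <;> linarith
  have h1 := h1 κ _ hκ hx.symm
  have h2 := h2 κ _ hκ hx.symm
  rw [hfl] at h1 h2
  have hlogN : κ * b = log (N+1/2) := by rw [← hx, Real.log_exp]
  have e1 : (∫ ξ in 0..(κ*b), g (ξ/κ) * (X2 τ N ξ)^2) = ∑ n ∈ Finset.Icc 0 N, (Λ n)^2/n * ∫ ξ in 0..(κ*b), g (ξ/κ) * (τ^2 * (vh (τ*(log n - ξ)))^2) := by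
    simp_rw [X2_sq hτ, Finset.mul_sum]
    rw [intervalIntegral.integral_finsetSum fun n _ => Continuous.intervalIntegrable (by fun_prop) _ _]
    refine Finset.sum_congr rfl fun n _ => ?_
    rw [← intervalIntegral.integral_const_mul]
    congr 1; ext ξ; ring
  have e2 : ∀ n ∈ Finset.Icc 0 N, |(Λ n)^2/n * (∫ ξ in 0..(κ*b), g (ξ/κ) * (τ^2 * (vh (τ*(log n - ξ)))^2)) - (Λ n)^2/n * g (log n/κ) * (τ * Ih)| ≤ (Λ n)^2/n * (L/κ * Ih) := by
    intro n hn
    by_cases hn1 : n ≤ 1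
    · interval_cases n <;> simp
    have hn2 : (2:ℝ) ≤ n := by exact_mod_cast (not_le.mp hn1)
    have hnN : (n:ℝ) ≤ N := by exact_mod_cast (Finset.mem_Icc.mp hn).2
    have hτi : 1/τ ≤ 1/4 := one_div_le_one_div_of_le (by norm_num) (by linarith)
    have hlog2 := Real.log_two_gt_d9
    have hln : log 2 ≤ log n := Real.log_le_log (by norm_num) hn2
    have hup : log n + 1/τ ≤ κ*b := by
      rw [hlogN]
      have h3 : log n ≤ log N := Real.log_le_log (by linarith) hnN
      have := Real.one_sub_inv_le_log_of_pos (x := ((N:ℝ)+1/2)/N) (by positivity)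
      rw [Real.log_div (by positivity) (by positivity), inv_div, one_sub_div (by positivity)] at this
      have h4 : 1/τ ≤ ((N:ℝ)+1/2-N)/(N+1/2) := by
        rw [div_le_div_iff₀ hτ0 (by positivity)]; linarith
      linarith
    have hmem : ∀ ξ ∈ Icc 0 (κ*b), ξ/κ ∈ Icc (-b) b := fun ξ hξ =>
      ⟨by have := div_nonneg hξ.1 hκ.le; linarith, by rw [div_le_iff₀ hκ]; linarith [hξ.2]⟩
    have := spike (G := fun ξ => g (ξ/κ)) (a := 0) (B := κ*b) (c := log n) (L := L/κ) hτ0 (by fun_prop) (by linarith) hup (by positivity) (fun ξ hξ => by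
      refine (hl _ (hmem ξ hξ) _ (hmem _ ⟨by linarith, by have : 0 < 1/τ := by positivity
                                                          linarith⟩)).trans_eq ?_
      rw [← sub_div, abs_div, abs_of_pos hκ]; ring)
    rw [mul_assoc, ← mul_sub, abs_mul, abs_of_nonneg (by positivity)]
    exact mul_le_mul_of_nonneg_left this (by positivity)
  have e3 : |(∫ ξ in 0..(κ*b), g (ξ/κ) * (X2 τ N ξ)^2) - (∑ n ∈ Finset.Icc 0 N, (Λ n)^2/n * g (log n/κ)) * (τ * Ih)| ≤ (∑ n ∈ Finset.Icc 0 N, (Λ n)^2/n) * (L/κ * Ih) := by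
    rw [e1, Finset.sum_mul, Finset.sum_mul, ← Finset.sum_sub_distrib]
    exact (Finset.abs_sum_le_sum_abs _ _).trans (Finset.sum_le_sum e2)
  have e4 : (∑ n ∈ Finset.Icc 0 N, (Λ n)^2/n) ≤ κ^2 * (b^2/2) + C2 * κ := by
    have := (abs_le.mp h2).2
    simp only [mul_one, integral_id] at this
    linarith
  have e5 : (∑ n ∈ Finset.Icc 0 N, (Λ n)^2/n) * (L/κ * Ih) ≤ L * Ih * (κ * (b^2/2) + C2) := by
    refine (mul_le_mul_of_nonneg_right e4 (by positivity)).trans_eq ?_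
    field_simp
  have hκτ : κ ≤ τ * κ := by nlinarith
  have h1τ : 1 ≤ τ * κ := by nlinarith
  have e6 := mul_le_mul_of_nonneg_left h1 (show 0 ≤ τ * Ih by positivity)
  rw [← abs_of_pos (show 0 < τ * Ih by positivity), ← abs_mul, abs_of_pos (show 0 < τ * Ih by positivity)] at e6
  rw [abs_le] at e3 e6 ⊢
  have e7 : L * Ih * (κ * (b^2/2) + C2) ≤ L * Ih * (b^2/2 + C2) * (τ*κ) := by
    rw [mul_assoc (L*Ih)]
    refine mul_le_mul_of_nonneg_left ?_ (by positivity)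
    nlinarith [sq_nonneg b]
  constructor <;> nlinarith

lemma X1_asymp {g : ℝ → ℝ} (hg : ContDiff ℝ 1 g) {b : ℝ} (hb : 0 < b) : ∃ C, 0 < C ∧ ∀ (N : ℕ) (κ τ : ℝ), 1 ≤ N → 1 ≤ κ → exp (κ*b) = N + 1/2 → 2*(N+1) ≤ τ →
    |(∫ ξ in 0..(κ*b), g (ξ/κ) * (X1 τ ξ)^2) - τ * (log τ)^2 * Ih * g 0 / 2| ≤ C * (log τ)^2 := by
  obtain ⟨L, hL, hl⟩ := lip_Icc hg b
  have hgc := hg.continuous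
  have hvc := vh_cont
  have hI := Ih_pos
  refine ⟨(L+1) * Ih, by positivity, fun N κ τ hN hκ1 hx hτ => ?_⟩
  have hκ : 0 < κ := by linarith
  have hN1 : (1:ℝ) ≤ N := by exact_mod_cast hN
  have hτ0 : 0 < τ := by linarith
  have hτi : 1/τ ≤ 1/4 := one_div_le_one_div_of_le (by norm_num) (by linarith)
  have hbig : 1/τ ≤ κ*b := by
    by_contra! h
    have h1 : exp (κ*b) < exp (1/4) := Real.exp_lt_exp.mpr (by linarith)
    have h2 : exp (1/4) ≤ 3/2 := by
      have := Real.one_sub_le_exp_neg (1/4)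
      rw [Real.exp_neg, le_inv_comm₀ (by norm_num) (Real.exp_pos _)] at this
      linarith
    linarith
  have hs := spike (G := fun ξ => g (|ξ|/κ)) (a := -(κ*b)) (B := κ*b) (c := 0) (L := L/κ) hτ0 (by fun_prop) (by linarith) (by linarith) (by positivity) (fun ξ hξ => by
    have h0 : |ξ|/κ ≤ b := by rw [div_le_iff₀ hκ]; rw [abs_le]; constructor <;> linarith [hξ.1, hξ.2]
    refine (hl _ ⟨by have : 0 ≤ |ξ|/κ := by positivity
                     linarith, h0⟩ _ ⟨by simp; linarith, by simp; linarith⟩).trans_eq ?_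
    simp [abs_div, abs_of_pos hκ]; ring)
  have e1 : ∫ ξ in (-(κ*b))..(κ*b), g (|ξ|/κ) * (τ^2 * (vh (τ*(0-ξ)))^2) = 2 * ∫ ξ in 0..(κ*b), g (ξ/κ) * (τ^2 * (vh (τ*ξ))^2) := by
    have hc : Continuous fun ξ => g (|ξ|/κ) * (τ^2 * (vh (τ*(0-ξ)))^2) := by fun_prop
    rw [← intervalIntegral.integral_add_adjacent_intervals (b := 0) (hc.intervalIntegrable _ _) (hc.intervalIntegrable _ _)]
    have : ∀ ξ ∈ Set.uIcc 0 (κ*b), g (|ξ|/κ) * (τ^2 * (vh (τ*(0-ξ)))^2) = g (ξ/κ) * (τ^2 * (vh (τ*ξ))^2) := by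
      intro ξ hξ
      rw [Set.uIcc_of_le (by positivity)] at hξ
      rw [abs_of_nonneg hξ.1, zero_sub, mul_neg, vh_even]
    have h2 : ∫ ξ in (-(κ*b))..0, g (|ξ|/κ) * (τ^2 * (vh (τ*(0-ξ)))^2) = ∫ ξ in 0..(κ*b), g (|ξ|/κ) * (τ^2 * (vh (τ*(0-ξ)))^2) := by
      have := intervalIntegral.integral_comp_neg (a := 0) (b := κ*b) (fun ξ => g (|ξ|/κ) * (τ^2 * (vh (τ*(0-ξ)))^2))
      rw [neg_zero] at this
      rw [← this]
      congr 1; ext ξ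
      rw [abs_neg, show τ*(0 - -ξ) = -(τ*(0-ξ)) by ring, vh_even]
    rw [h2, intervalIntegral.integral_congr this]; ring
  have e2 : (∫ ξ in 0..(κ*b), g (ξ/κ) * (X1 τ ξ)^2) = (log τ)^2 * ∫ ξ in 0..(κ*b), g (ξ/κ) * (τ^2 * (vh (τ*ξ))^2) := by
    rw [← intervalIntegral.integral_const_mul]
    congr 1; ext ξ; rw [X1]; ring
  rw [e2]
  rw [e1] at hs
  simp only [abs_zero, zero_div] at hs
  have hLκ : L/κ * Ih ≤ L * Ih := mul_le_mul_of_nonneg_right (div_le_self hL hκ1) hI.le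
  rw [show ∀ A : ℝ, (log τ)^2 * A - τ * (log τ)^2 * Ih * g 0 / 2 = (log τ)^2 * ((2 * A - g 0 * (τ * Ih)) / 2) by intro A; ring,
    abs_mul, abs_of_nonneg (sq_nonneg _), mul_comm]
  refine mul_le_mul_of_nonneg_right ?_ (sq_nonneg _)
  rw [abs_div, abs_two]
  nlinarith

lemma E_bound (hRH : RiemannHypothesis) {b : ℝ} (hb : 0 < b) : ∃ C, 0 < C ∧ ∀ (N : ℕ) (κ τ : ℝ), 1 ≤ N → 1 ≤ κ → exp (κ*b) = N + 1/2 → 2*(N+1) ≤ τ →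
    (∫ ξ in 0..(κ*b), (Vt τ ξ - X1 τ ξ + X2 τ N ξ)^2) ≤ C * τ := by
  obtain ⟨C, hC, h⟩ := V_main hRH
  refine ⟨4*C^2, by positivity, fun N κ τ hN hκ1 hx hτ => ?_⟩
  have hκ : 0 < κ := by linarith
  have hN1 : (1:ℝ) ≤ N := by exact_mod_cast hN
  have hτ0 : 0 < τ := by linarith
  have hlogN : κ * b = log (N+1/2) := by rw [← hx, Real.log_exp]
  have c1 := X1_cont τ
  have c2 := X2_cont τ N
  have c3 := Vt_cont hRH hτ0
  have hB : 0 ≤ κ*b := by positivity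
  have hcd : ContinuousOn (fun ξ => τ^2/(1+τ*ξ)^2) (Set.uIcc 0 (κ*b)) := by
    rw [Set.uIcc_of_le hB]
    refine ContinuousOn.div (by fun_prop) (by fun_prop) fun ξ hξ => ?_
    have := mul_nonneg hτ0.le hξ.1
    positivity
  have hi : ∫ ξ in 0..(κ*b), τ^2/(1+τ*ξ)^2 = τ - τ/(1+τ*(κ*b)) := by
    rw [intervalIntegral.integral_eq_sub_of_hasDerivAt (f := fun ξ => -(τ/(1+τ*ξ)))]
    · simp; ring
    · intro ξ hξ
      rw [Set.uIcc_of_le hB] at hξ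
      have := mul_nonneg hτ0.le hξ.1
      have h0 : 1 + τ*ξ ≠ 0 := by positivity
      have := ((((hasDerivAt_id ξ).const_mul τ).const_add 1).inv h0).const_mul (-τ)
      refine (this.congr_of_eventuallyEq (Eventually.of_forall fun x => ?_)).congr_deriv ?_
      · simp; ring
      · simp; field_simp
    · exact hcd.intervalIntegrable
  calc _ ≤ ∫ ξ in 0..(κ*b), 2*C^2 * (exp ξ + τ^2/(1+τ*ξ)^2) := by
        refine intervalIntegral.integral_mono_on hB (Continuous.intervalIntegrable (by fun_prop) _ _) ?_ fun ξ hξ => ?_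
        · exact (continuousOn_const.mul (Real.continuous_exp.continuousOn.add hcd)).intervalIntegrable
        · have h1 := h N hN τ ξ hτ hξ.1 (hlogN ▸ hξ.2)
          have := mul_nonneg hτ0.le hξ.1
          have h2 : exp ξ = (exp (ξ/2))^2 := by rw [← Real.exp_nat_mul]; congr 1; push_cast; ring
          rw [h2, ← sq_abs, ← div_pow]
          have h3 := pow_le_pow_left₀ (abs_nonneg _) h1 2
          refine h3.trans ?_
          rw [mul_pow]
          nlinarith [mul_nonneg (sq_nonneg C) (sq_nonneg (exp (ξ/2) - τ/(1+τ*ξ)))]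
    _ = 2*C^2 * ((exp (κ*b) - 1) + (τ - τ/(1+τ*(κ*b)))) := by
        rw [intervalIntegral.integral_const_mul, intervalIntegral.integral_add (Real.continuous_exp.intervalIntegrable _ _) hcd.intervalIntegrable, hi, integral_exp, Real.exp_zero]
    _ ≤ 2*C^2 * (2*τ) := by
        refine mul_le_mul_of_nonneg_left ?_ (by positivity)
        rw [hx]
        have : 0 ≤ τ/(1+τ*(κ*b)) := by positivity
        linarith
    _ = _ := by ring

lemma E_pt {κ B q x y v : ℝ} (hκ1 : 1 ≤ κ) (hB0 : 0 ≤ B) (hgB : |q| ≤ B) (h12 : x * y = 0) :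
    q * x^2 + q * y^2 - B * (1/κ * x^2 + 1/κ * y^2 + 2*κ*(v - x + y)^2) ≤ q * v^2 := by
  have hκ : 0 < κ := by linarith
  obtain ⟨E, rfl⟩ : ∃ E, v = (x - y) + E := ⟨v - x + y, by ring⟩
  rw [show x - y + E - x + y = E by ring]
  have hX : (x-y)^2 = x^2 + y^2 := by linear_combination -2 * h12
  have hD : |2*(x-y)*E + E^2| ≤ 1/κ*x^2 + 1/κ*y^2 + 2*κ*E^2 := by
    have hq : 0 ≤ 1/κ * ((x-y) - κ*E)^2 := by positivity
    have hq' : 0 ≤ 1/κ * ((x-y) + κ*E)^2 := by positivity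
    have r1 : 1/κ * ((x-y) - κ*E)^2 = 1/κ*(x^2+y^2) - 2*(x-y)*E + κ*E^2 := by rw [← hX]; field_simp; ring
    have r2 : 1/κ * ((x-y) + κ*E)^2 = 1/κ*(x^2+y^2) + 2*(x-y)*E + κ*E^2 := by rw [← hX]; field_simp; ring
    have r3 : E^2 ≤ κ*E^2 := le_mul_of_one_le_left (sq_nonneg _) hκ1
    rw [abs_le]; constructor <;> linarith [sq_nonneg E]
  have hp : -(B * (1/κ*x^2 + 1/κ*y^2 + 2*κ*E^2)) ≤ q * (2*(x-y)*E + E^2) := by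
    refine neg_le_of_abs_le ?_
    rw [abs_mul]
    exact mul_le_mul hgB hD (abs_nonneg _) hB0
  linear_combination hp - q * hX

lemma E_lower (hRH : RiemannHypothesis) {g : ℝ → ℝ} (hg : ContDiff ℝ 1 g) {b A : ℝ} (hb : 0 < b) (hA : 0 < A) : ∃ C, 0 < C ∧ ∀ (N : ℕ) (κ τ : ℝ), 1 ≤ N → 1 ≤ κ → exp (κ*b) = N + 1/2 → 2*(N+1) ≤ τ → log τ ≤ A * κ →
    τ * (log τ)^2 * Ih * g 0 / 2 + τ * Ih * (κ^2 * ∫ β in 0..b, β * g β) - C * (τ * κ) ≤ ∫ ξ in 0..(κ*b), g (ξ/κ) * (Vt τ ξ)^2 := by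
  obtain ⟨C1, hC1, h1⟩ := X1_asymp hg hb
  obtain ⟨C1', hC1', h1'⟩ := X1_asymp (g := fun _ => (1:ℝ)) contDiff_const hb
  obtain ⟨C2, hC2, h2⟩ := X2_asymp hg hb
  obtain ⟨C2', hC2', h2'⟩ := X2_asymp (g := fun _ => (1:ℝ)) contDiff_const hb
  obtain ⟨C3, hC3, h3⟩ := E_bound hRH hb
  obtain ⟨B', hB'⟩ := isCompact_Icc.exists_bound_of_continuousOn (s := Icc 0 b) hg.continuous.continuousOn
  have hgc := hg.continuous
  have hI := Ih_pos
  set B := |B'|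
  have hB0 : 0 ≤ B := abs_nonneg _
  refine ⟨C1*(A^2/b) + C2 + B*(A^2*Ih/2 + C1'*(A^2/b) + Ih*(b^2/2) + C2' + 2*C3), by positivity, fun N κ τ hN hκ1 hx hτ hAκ => ?_⟩
  have hκ : 0 < κ := by linarith
  have hN1 : (1:ℝ) ≤ N := by exact_mod_cast hN
  have hτ0 : 0 < τ := by linarith
  have hτ1 : 1 ≤ τ := by linarith
  have c1 := X1_cont τ
  have c2 := X2_cont τ N
  have c3 := Vt_cont hRH hτ0
  have hκb : 0 ≤ κ*b := by positivity
  have h1 := h1 N κ τ hN hκ1 hx hτ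
  have h1' := h1' N κ τ hN hκ1 hx hτ
  have h2 := h2 N κ τ hN hκ1 hx hτ
  have h2' := h2' N κ τ hN hκ1 hx hτ
  have h3 := h3 N κ τ hN hκ1 hx hτ
  simp only [one_mul, mul_one, integral_id] at h1' h2'
  set I1 := ∫ ξ in 0..(κ*b), g (ξ/κ) * (X1 τ ξ)^2
  set I2 := ∫ ξ in 0..(κ*b), g (ξ/κ) * (X2 τ N ξ)^2
  set J1 := ∫ ξ in 0..(κ*b), (X1 τ ξ)^2
  set J2 := ∫ ξ in 0..(κ*b), (X2 τ N ξ)^2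
  set J3 := ∫ ξ in 0..(κ*b), (Vt τ ξ - X1 τ ξ + X2 τ N ξ)^2
  have hlow : I1 + I2 - B * (1/κ*J1 + 1/κ*J2 + 2*κ*J3) ≤ ∫ ξ in 0..(κ*b), g (ξ/κ) * (Vt τ ξ)^2 := by
    have e : I1 + I2 - B * (1/κ*J1 + 1/κ*J2 + 2*κ*J3) = ∫ ξ in 0..(κ*b), (g (ξ/κ) * (X1 τ ξ)^2 + g (ξ/κ) * (X2 τ N ξ)^2 - B * (1/κ * (X1 τ ξ)^2 + 1/κ * (X2 τ N ξ)^2 + 2*κ*(Vt τ ξ - X1 τ ξ + X2 τ N ξ)^2)) := by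
      rw [intervalIntegral.integral_sub, intervalIntegral.integral_add, intervalIntegral.integral_const_mul, intervalIntegral.integral_add, intervalIntegral.integral_add,
        intervalIntegral.integral_const_mul, intervalIntegral.integral_const_mul, intervalIntegral.integral_const_mul]
      all_goals exact Continuous.intervalIntegrable (by fun_prop) _ _
    rw [e]
    refine intervalIntegral.integral_mono_on hκb (Continuous.intervalIntegrable (by fun_prop) _ _) (Continuous.intervalIntegrable (by fun_prop) _ _) fun ξ hξ => ?_
    have hgB : |g (ξ/κ)| ≤ B := (hB' _ ⟨div_nonneg hξ.1 hκ.le, by rw [div_le_iff₀ hκ]; linarith [hξ.2]⟩).trans (le_abs_self _)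
    have h12 := X1X2_zero (N := N) (τ := τ) (by linarith) hξ.1
    set x := X1 τ ξ
    set y := X2 τ N ξ
    set v := Vt τ ξ
    exact E_pt hκ1 hB0 hgB h12
  have hκτ : κ ≤ τ/b := by
    rw [le_div_iff₀ hb]
    have := Real.add_one_le_exp (κ*b)
    linarith
  have hlog0 : 0 ≤ log τ := Real.log_nonneg hτ1
  have hl2 : (log τ)^2 ≤ A^2*κ^2 := by rw [← mul_pow]; exact pow_le_pow_left₀ hlog0 hAκ 2
  have hκ2 : κ^2 ≤ τ*κ/b := by
    rw [pow_two, mul_div_right_comm]; exact mul_le_mul_of_nonneg_right hκτ hκ.le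
  have hl3 : (log τ)^2 ≤ A^2/b*(τ*κ) := hl2.trans (by
    refine (mul_le_mul_of_nonneg_left hκ2 (sq_nonneg A)).trans_eq ?_
    ring)
  rw [abs_le] at h1 h1' h2 h2'
  have hτκ : 0 ≤ τ*κ := by positivity
  have hJ1 : 1/κ*J1 ≤ (A^2*Ih/2 + C1'*(A^2/b))*(τ*κ) := by
    rw [one_div_mul_eq_div, div_le_iff₀ hκ]
    have := mul_le_mul_of_nonneg_left hl2 (show 0 ≤ τ*Ih/2 by positivity)
    have := mul_le_mul_of_nonneg_left hl3 hC1'.le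
    have : C1'*(A^2/b)*(τ*κ) ≤ C1'*(A^2/b)*(τ*κ)*κ := le_mul_of_one_le_right (by positivity) hκ1
    linarith
  have hJ2 : 1/κ*J2 ≤ (Ih*(b^2/2) + C2')*(τ*κ) := by
    rw [one_div_mul_eq_div, div_le_iff₀ hκ]
    have : C2'*(τ*κ) ≤ C2'*(τ*κ)*κ := le_mul_of_one_le_right (by positivity) hκ1
    linarith
  have hJ3 : 2*κ*J3 ≤ 2*C3*(τ*κ) := by nlinarith
  have hJ := mul_le_mul_of_nonneg_left (add_le_add (add_le_add hJ1 hJ2) hJ3) hB0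
  have := mul_le_mul_of_nonneg_left hl3 hC1.le
  linarith

lemma E_upper (hRH : RiemannHypothesis) {g : ℝ → ℝ} (hg : ContDiff ℝ 1 g) (hg0 : ∀ x, 0 ≤ g x) {b : ℝ} (hb : 0 < b) : ∃ C, 0 < C ∧ ∀ (N : ℕ) (κ τ : ℝ), 1 ≤ N → 1 ≤ κ → exp (κ*b) = N + 1/2 → 2*(N+1) ≤ τ →
    (∫ ξ in 0..(κ*b), g (ξ/κ) * (Vt τ ξ - X1 τ ξ)^2) ≤ 2 * (τ * Ih * (κ^2 * ∫ β in 0..b, β * g β)) + C * (τ * κ) := by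
  obtain ⟨C2, hC2, h2⟩ := X2_asymp hg hb
  obtain ⟨C3, hC3, h3⟩ := E_bound hRH hb
  obtain ⟨B', hB'⟩ := isCompact_Icc.exists_bound_of_continuousOn (s := Icc 0 b) hg.continuous.continuousOn
  have hgc := hg.continuous
  set B := |B'|
  have hB0 : 0 ≤ B := abs_nonneg _
  refine ⟨2*C2 + 2*B*C3, by positivity, fun N κ τ hN hκ1 hx hτ => ?_⟩
  have hκ : 0 < κ := by linarith
  have hN1 : (1:ℝ) ≤ N := by exact_mod_cast hN
  have hτ0 : 0 < τ := by linarith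
  have c1 := X1_cont τ
  have c2 := X2_cont τ N
  have c3 := Vt_cont hRH hτ0
  have hκb : 0 ≤ κ*b := by positivity
  have h2 := (abs_le.mp (h2 N κ τ hN hκ1 hx hτ)).2
  have h3 := h3 N κ τ hN hκ1 hx hτ
  have hup : (∫ ξ in 0..(κ*b), g (ξ/κ) * (Vt τ ξ - X1 τ ξ)^2) ≤ ∫ ξ in 0..(κ*b), (2 * (g (ξ/κ) * (X2 τ N ξ)^2) + 2*B*(Vt τ ξ - X1 τ ξ + X2 τ N ξ)^2) := by
    refine intervalIntegral.integral_mono_on hκb (Continuous.intervalIntegrable (by fun_prop) _ _) (Continuous.intervalIntegrable (by fun_prop) _ _) fun ξ hξ => ?_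
    have hgB : g (ξ/κ) ≤ B := (le_abs_self _).trans ((hB' _ ⟨div_nonneg hξ.1 hκ.le, by rw [div_le_iff₀ hκ]; linarith [hξ.2]⟩).trans (le_abs_self _))
    have e1 := mul_le_mul_of_nonneg_right hgB (sq_nonneg (Vt τ ξ - X1 τ ξ + X2 τ N ξ))
    have e2 := mul_nonneg (hg0 (ξ/κ)) (sq_nonneg ((Vt τ ξ - X1 τ ξ) + 2*X2 τ N ξ))
    nlinarith
  rw [intervalIntegral.integral_add (Continuous.intervalIntegrable (by fun_prop) _ _) (Continuous.intervalIntegrable (by fun_prop) _ _), intervalIntegral.integral_const_mul, intervalIntegral.integral_const_mul] at hup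
  have : τ ≤ τ*κ := by nlinarith
  have := mul_le_mul_of_nonneg_left (h3.trans (mul_le_mul_of_nonneg_left this hC3.le)) (show 0 ≤ 2*B by positivity)
  linarith

lemma gpow_int (m : ℕ) : Integrable (fun β : ℝ => β^m * exp (-β^2/2)) := by
  have := integrable_rpow_mul_exp_neg_mul_sq (b := 1/2) (by norm_num) (s := m) (lt_of_lt_of_le (by norm_num) m.cast_nonneg)
  refine this.congr (Eventually.of_forall fun x => ?_)
  simp only [Real.rpow_natCast]; congr 2; ring

def gC (m : ℕ) (y : ℝ) : ℝ := ∫ β : ℝ, β^m * exp (-β^2/2) * cos (β*y)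
def gS (m : ℕ) (y : ℝ) : ℝ := ∫ β : ℝ, β^m * exp (-β^2/2) * sin (β*y)

lemma g_der (m : ℕ) (β : ℝ) : HasDerivAt (fun β : ℝ => β^m * exp (-β^2/2)) (m * (β^(m-1) * exp (-β^2/2)) - β^(m+1) * exp (-β^2/2)) β := by
  have h := (hasDerivAt_pow m β).fun_mul ((((hasDerivAt_pow 2 β).fun_neg).div_const 2).exp)
  refine h.congr_deriv ?_
  simp; ring

lemma gC_succ (m : ℕ) (y : ℝ) : gC (m+1) y = m * gC (m-1) y - y * gS m y := by
  have i1 : ∀ m, Integrable (fun β : ℝ => β^m * exp (-β^2/2) * cos (β*y)) := fun m => int_mul_cos (gpow_int m) y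
  have i2 := int_mul_sin (gpow_int m) y
  have := integral_eq_zero_of_hasDerivAt_of_integrable (f := fun β => β^m * exp (-β^2/2) * cos (β*y)) (fun β => (g_der m β).fun_mul (((hasDerivAt_id β).mul_const y).cos)) ?_ (i1 m)
  · have e : ∫ β : ℝ, (m * (β^(m-1) * exp (-β^2/2) * cos (β*y)) - β^(m+1) * exp (-β^2/2) * cos (β*y) - y * (β^m * exp (-β^2/2) * sin (β*y))) = 0 := by
      rw [← this]; congr 1; ext β; simp; ring
    rw [integral_sub (by fun_prop) (by fun_prop), integral_sub (by fun_prop) (by fun_prop), integral_const_mul, integral_const_mul] at e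
    unfold gC gS; linarith
  · refine ((((i1 (m-1)).const_mul (m:ℝ)).sub (i1 (m+1))).sub (i2.const_mul y)).congr (Eventually.of_forall fun β => ?_)
    simp; ring

lemma gS_succ (m : ℕ) (y : ℝ) : gS (m+1) y = m * gS (m-1) y + y * gC m y := by
  have i1 : ∀ m, Integrable (fun β : ℝ => β^m * exp (-β^2/2) * sin (β*y)) := fun m => int_mul_sin (gpow_int m) y
  have i2 := int_mul_cos (gpow_int m) y
  have := integral_eq_zero_of_hasDerivAt_of_integrable (f := fun β => β^m * exp (-β^2/2) * sin (β*y)) (fun β => (g_der m β).fun_mul (((hasDerivAt_id β).mul_const y).sin)) ?_ (i1 m)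
  · have e : ∫ β : ℝ, (m * (β^(m-1) * exp (-β^2/2) * sin (β*y)) - β^(m+1) * exp (-β^2/2) * sin (β*y) + y * (β^m * exp (-β^2/2) * cos (β*y))) = 0 := by
      rw [← this]; congr 1; ext β; simp; ring
    rw [integral_add (by fun_prop) (by fun_prop), integral_sub (by fun_prop) (by fun_prop), integral_const_mul, integral_const_mul] at e
    unfold gC gS; linarith
  · refine ((((i1 (m-1)).const_mul (m:ℝ)).sub (i1 (m+1))).add (i2.const_mul y)).congr (Eventually.of_forall fun β => ?_)
    simp; ring

lemma gC0 (y : ℝ) : gC 0 y = √(2*π) * exp (-y^2/2) := by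
  have := fourierIntegral_gaussian (b := 1/2) (by norm_num) (y:ℂ)
  have h2 : (((π:ℂ)/(1/2))^(1/2:ℂ)) = ((√(2*π) : ℝ) : ℂ) := by
    rw [Real.sqrt_eq_rpow, Complex.ofReal_cpow (by positivity)]; congr 1 <;> push_cast <;> ring
  have h3 : Complex.exp (-(y:ℂ)^2/(4*(1/2))) = ((exp (-y^2/2) : ℝ):ℂ) := by push_cast; congr 1; ring
  rw [h2, h3, ← Complex.ofReal_mul] at this
  have h4 := congrArg Complex.re this
  rw [Complex.ofReal_re] at h4
  rw [← h4, ← RCLike.re_eq_complex_re, ← integral_re]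
  · unfold gC; congr 1; ext β
    rw [show Complex.I * (y:ℂ) * β = ((β*y : ℝ):ℂ) * Complex.I by push_cast; ring, show -(1/2:ℂ)*(β:ℂ)^2 = ((-β^2/2 : ℝ):ℂ) by push_cast; ring, ← Complex.ofReal_exp]
    rw [RCLike.re_eq_complex_re, Complex.re_mul_ofReal, Complex.exp_ofReal_mul_I_re]; ring
  · refine (integrable_cexp_neg_mul_sq (b := 1/2) (by norm_num)).norm.mono' (by fun_prop) (Eventually.of_forall fun β => ?_)
    rw [norm_mul, show Complex.I * (y:ℂ) * β = ((y*β : ℝ):ℂ) * Complex.I by push_cast; ring, Complex.norm_exp_ofReal_mul_I, one_mul]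

def Qf (β : ℝ) : ℝ := (382653/2500 + 335511/625*β^2 - 349487/1250*β^4 + 3332/125*β^6 - 1139/100*β^8 + β^10) * exp (-β^2/2)

lemma Qf_smooth : ContDiff ℝ 1 Qf := by unfold Qf; fun_prop
lemma Qf_even (β : ℝ) : Qf (-β) = Qf β := by unfold Qf; congr 1 <;> ring_nf
lemma Qf_int : Integrable Qf := by
  refine ((((((gpow_int 0).const_mul (382653/2500)).add ((gpow_int 2).const_mul (335511/625))).sub ((gpow_int 4).const_mul (349487/1250))).add ((gpow_int 6).const_mul (3332/125))).sub ((gpow_int 8).const_mul (1139/100))).add (gpow_int 10) |>.congr (Eventually.of_forall fun β => ?_)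
  simp [Qf]; ring

lemma ct_Qf (y : ℝ) : ct Qf y = -(√(2*π) * exp (-y^2/2) * (y^4 * (y^2-401/100) * (y^2-74/5)^2)) := by
  have i1 : ∀ m, Integrable (fun β : ℝ => β^m * exp (-β^2/2) * cos (β*y)) := fun m => int_mul_cos (gpow_int m) y
  have e : ct Qf y = 382653/2500 * gC 0 y + 335511/625 * gC 2 y - 349487/1250 * gC 4 y + 3332/125 * gC 6 y - 1139/100 * gC 8 y + gC 10 y := by
    unfold gC
    simp only [← integral_const_mul]
    have i := fun m c => (i1 m).const_mul c
    rw [← integral_add (by fun_prop) (by fun_prop), ← integral_sub (by fun_prop) (by fun_prop), ← integral_add (by fun_prop) (by fun_prop), ← integral_sub (by fun_prop) (by fun_prop), ← integral_add (by fun_prop) (by fun_prop)]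
    unfold ct Qf
    congr 1; ext β; simp; ring
  have s1 : gS 1 y = y * gC 0 y := by have := gS_succ 0 y; simpa using this
  have c2 : gC 2 y = gC 0 y - y * gS 1 y := by have := gC_succ 1 y; norm_num at this; exact this
  have s3 : gS 3 y = 2 * gS 1 y + y * gC 2 y := by have := gS_succ 2 y; norm_num at this; exact this
  have c4 : gC 4 y = 3 * gC 2 y - y * gS 3 y := by have := gC_succ 3 y; norm_num at this; exact this
  have s5 : gS 5 y = 4 * gS 3 y + y * gC 4 y := by have := gS_succ 4 y; norm_num at this; exact this
  have c6 : gC 6 y = 5 * gC 4 y - y * gS 5 y := by have := gC_succ 5 y; norm_num at this; exact this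
  have s7 : gS 7 y = 6 * gS 5 y + y * gC 6 y := by have := gS_succ 6 y; norm_num at this; exact this
  have c8 : gC 8 y = 7 * gC 6 y - y * gS 7 y := by have := gC_succ 7 y; norm_num at this; exact this
  have s9 : gS 9 y = 8 * gS 7 y + y * gC 8 y := by have := gS_succ 8 y; norm_num at this; exact this
  have c10 : gC 10 y = 9 * gC 8 y - y * gS 9 y := by have := gC_succ 9 y; norm_num at this; exact this
  rw [e, c10, s9, c8, s7, c6, s5, c4, s3, c2, s1, gC0]; ring

lemma ct_Qf_nonpos {y : ℝ} (h : y = 0 ∨ 401/100 ≤ y^2) : ct Qf y ≤ 0 := by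
  rw [ct_Qf]
  rcases h with rfl | h
  · simp
  · have : 0 ≤ y^2 - 401/100 := by linarith
    have : 0 ≤ √(2*π) * exp (-y^2/2) * (y^4 * (y^2-401/100) * (y^2-74/5)^2) := by positivity
    linarith

lemma Qf_nonneg {β : ℝ} (h : 33/10 ≤ β) : 0 ≤ Qf β := by
  obtain ⟨t, ht, e⟩ : ∃ t, 0 ≤ t ∧ β^2 = 1089/100 + t := ⟨β^2 - 1089/100, by nlinarith, by ring⟩
  unfold Qf
  refine mul_nonneg ?_ (Real.exp_pos _).le
  rw [show 382653/2500 + 335511/625*β^2 - 349487/1250*β^4 + 3332/125*β^6 - 1139/100*β^8 + β^10 = 382653/2500 + 335511/625*β^2 - 349487/1250*(β^2)^2 + 3332/125*(β^2)^3 - 1139/100*(β^2)^4 + (β^2)^5 by ring, e]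
  ring_nf
  positivity

lemma Qf_pos : 0 < (33/10:ℝ)^2 * Qf 0 / 2 + ∫ β in 0..(33/10:ℝ), β * Qf β := by
  have hc := Qf_smooth.continuous
  rw [intervalIntegral.integral_eq_sub_of_hasDerivAt (f := fun β => (660731/2500 + 130423/625*β^2 + 232967/1250*β^4 - 1942/125*β^6 + 139/100*β^8 - β^10) * exp (-β^2/2)) (fun β _ => ?_) (Continuous.intervalIntegrable (by fun_prop) _ _)]
  · have h : (230:ℝ) ≤ exp (1089/200) := by
      have h1 : exp (1089/200) = (exp 1)^5 * exp (89/200) := by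
        rw [← Real.exp_nat_mul, ← Real.exp_add]; norm_num
      have h2 : (1.558:ℝ) ≤ exp (89/200) := by
        have := Real.sum_le_exp_of_nonneg (x := 89/200) (by norm_num) 4
        norm_num [Finset.sum_range_succ, Nat.factorial] at this
        linarith
      have h3 : (2.718:ℝ)^5 ≤ (exp 1)^5 := pow_le_pow_left₀ (by norm_num) (by linarith [Real.exp_one_gt_d9]) 5
      rw [h1]
      calc (230:ℝ) ≤ (2.718:ℝ)^5 * 1.558 := by norm_num
        _ ≤ _ := mul_le_mul h3 h2 (by norm_num) (by positivity)
    have h' : exp (-(33/10:ℝ)^2/2) ≤ 1/230 := by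
      rw [show -(33/10:ℝ)^2/2 = -(1089/200) by norm_num, Real.exp_neg, one_div]
      exact inv_anti₀ (by norm_num) h
    norm_num [Qf] at h' ⊢
    linarith
  · have h := ((((((((hasDerivAt_pow 2 β).const_mul (130423/625)).const_add (660731/2500)).fun_add ((hasDerivAt_pow 4 β).const_mul (232967/1250))).fun_sub ((hasDerivAt_pow 6 β).const_mul (1942/125))).fun_add ((hasDerivAt_pow 8 β).const_mul (139/100))).fun_sub (hasDerivAt_pow 10 β))).fun_mul ((((hasDerivAt_pow 2 β).fun_neg).div_const 2).exp)
    refine h.congr_deriv ?_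
    simp [Qf]; ring

def nuZ (τ : ℝ) : Measure ℝ := muZ.withDensity (fun γ => ofReal (vv (γ/τ)))

lemma nuZ_fin (hRH : RiemannHypothesis) {τ : ℝ} (hτ : 0 < τ) : IsFiniteMeasure (nuZ τ) :=
  isFiniteMeasure_withDensity_ofReal (vv_mu_int hRH hτ).2

lemma vv_meas (τ : ℝ) : Measurable (fun γ => ofReal (vv (γ/τ))) := by
  have := vv_cont
  exact (Continuous.measurable (by fun_prop)).ennreal_ofReal

lemma int_nuZ (τ : ℝ) (f : ℝ → ℝ) : ∫ x, f x ∂(nuZ τ) = ∫ γ, vv (γ/τ) * f γ ∂muZ := by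
  rw [nuZ, integral_withDensity_eq_integral_toReal_smul (vv_meas τ) (by simp)]
  simp [ENNReal.toReal_ofReal (vv_nonneg _)]

lemma muZ_neg : Measure.map (fun x => -x) muZ = muZ := by
  refine Measure.ext fun s hs => ?_
  rw [Measure.map_apply measurable_neg hs, ← lintegral_indicator_one hs, ← lintegral_indicator_one (measurable_neg hs),
    lintegral_muZ _ (measurable_one.indicator hs), lintegral_muZ _ (measurable_one.indicator (measurable_neg hs))]
  let e : ZS ≃ ZS := ⟨fun γ => ⟨-γ, ZS_neg γ.2⟩, fun γ => ⟨-γ, ZS_neg γ.2⟩, fun γ => by simp, fun γ => by simp⟩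
  rw [← e.tsum_eq]
  refine tsum_congr fun γ => ?_
  simp only [e, Equiv.coe_fn_mk, ordMult_neg]
  congr 1
  by_cases h : (γ:ℝ) ∈ s
  · rw [Set.indicator_of_mem h, Set.indicator_of_mem (by simpa using h)]; rfl
  · rw [Set.indicator_of_notMem h, Set.indicator_of_notMem (by simpa using h)]

lemma int_muZ_odd {g : ℝ → ℝ} (h : ∀ x, g (-x) = - g x) : ∫ x, g x ∂muZ = 0 := by
  have : ∫ x, g x ∂muZ = ∫ x, g (-x) ∂muZ := by
    conv_lhs => rw [← muZ_neg]
    exact (Homeomorph.neg ℝ).measurableEmbedding.integral_map g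
  simp only [h, integral_neg] at this
  linarith

lemma nu_sin (τ a : ℝ) : ∫ x, sin (a*x) ∂(nuZ τ) = 0 := by
  rw [int_nuZ]
  refine int_muZ_odd fun x => ?_
  rw [neg_div, vv_even, mul_neg, Real.sin_neg]; ring

lemma nu_cos (τ a : ℝ) : ∫ x, cos (a*x) ∂(nuZ τ) = Vt τ a := by rw [int_nuZ, Vt]

lemma nu_cos_sub (hRH : RiemannHypothesis) {τ : ℝ} (hτ : 0 < τ) (a t : ℝ) : ∫ x, cos (a*(x-t)) ∂(nuZ τ) = Vt τ a * cos (a*t) := by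
  have := nuZ_fin hRH hτ
  have e : ∀ x, cos (a*(x-t)) = cos (a*x) * cos (a*t) + sin (a*x) * sin (a*t) := fun x => by
    rw [mul_sub, Real.cos_sub]
  simp_rw [e]
  rw [integral_add, integral_mul_const, integral_mul_const, nu_sin, nu_cos]; · ring
  · exact Integrable.of_bound (Continuous.aestronglyMeasurable (by fun_prop)) 1 (ae_of_all _ fun x => by
      rw [← Real.cos_abs (a*x), norm_mul]; exact mul_le_one₀ (Real.abs_cos_le_one _) (norm_nonneg _) (Real.abs_cos_le_one _))
  · exact Integrable.of_bound (Continuous.aestronglyMeasurable (by fun_prop)) 1 (ae_of_all _ fun x => by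
      rw [norm_mul]; exact mul_le_one₀ (Real.abs_sin_le_one _) (norm_nonneg _) (Real.abs_sin_le_one _))

lemma nu_ct (hRH : RiemannHypothesis) {τ : ℝ} (hτ : 0 < τ) {f : ℝ → ℝ} (hf : Integrable f) (κ t : ℝ) :
    ∫ x, ct f (κ*(x-t)) ∂(nuZ τ) = ∫ η, f η * (Vt τ (η*κ) * cos (η*κ*t)) := by
  have := nuZ_fin hRH hτ
  unfold ct
  rw [integral_integral_swap]
  · congr 1; ext η
    rw [integral_const_mul, ← nu_cos_sub hRH hτ]; simp only [mul_assoc]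
  · have : Integrable (fun p : ℝ × ℝ => f p.2 * cos (p.2 * (κ*(p.1-t)))) ((nuZ τ).prod volume) :=
      (hf.comp_snd (nuZ τ)).mul_bdd (c := 1) (Continuous.aestronglyMeasurable (by fun_prop)) (Eventually.of_forall fun p => Real.abs_cos_le_one _)
    exact this

lemma ct_bdd {f : ℝ → ℝ} (hf : Integrable f) (y : ℝ) : |ct f y| ≤ ∫ η, |f η| := by
  have h := norm_integral_le_integral_norm (μ := volume) (fun η => f η * cos (η*y))
  refine h.trans (integral_mono_of_nonneg (ae_of_all _ fun _ => norm_nonneg _) hf.abs (ae_of_all _ fun x => ?_))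
  simp only [norm_mul]
  exact mul_le_of_le_one_right (norm_nonneg _) (Real.abs_cos_le_one _)

lemma Vt_bdd (hRH : RiemannHypothesis) {τ : ℝ} (hτ : 0 < τ) (a : ℝ) : ‖Vt τ a‖ ≤ ∫ x, 1 ∂(nuZ τ) := by
  have := nuZ_fin hRH hτ
  rw [← nu_cos]
  exact (norm_integral_le_integral_norm _).trans (integral_mono_of_nonneg (Eventually.of_forall fun _ => norm_nonneg _) (integrable_const _) (Eventually.of_forall fun _ => Real.abs_cos_le_one _))

lemma nu_pair (hRH : RiemannHypothesis) {τ : ℝ} (hτ : 0 < τ) {f : ℝ → ℝ} (hf : Integrable f) (κ : ℝ) :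
    ∫ p, ct f (κ*(p.1-p.2)) ∂((nuZ τ).prod (nuZ τ)) = ∫ η, f η * (Vt τ (η*κ))^2 := by
  have := nuZ_fin hRH hτ
  have hcc := ct_cont hf
  rw [integral_prod_symm]
  · have hV := Vt_cont hRH hτ
    simp only [nu_ct hRH hτ hf]
    rw [integral_integral_swap]
    · congr 1; ext η
      rw [integral_const_mul, integral_const_mul, nu_cos]; ring
    · have hb := Vt_bdd hRH hτ
      have : Integrable (fun p : ℝ × ℝ => f p.2 * (Vt τ (p.2*κ) * cos (p.2*κ*p.1))) ((nuZ τ).prod volume) :=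
        (hf.comp_snd (nuZ τ)).mul_bdd (c := ∫ x, 1 ∂(nuZ τ)) (Continuous.aestronglyMeasurable (by fun_prop)) (Eventually.of_forall fun p => by
          rw [norm_mul]; exact (mul_le_of_le_one_right (norm_nonneg _) (Real.abs_cos_le_one _)).trans (hb _))
      exact this
  · refine Integrable.of_bound (Continuous.aestronglyMeasurable (by fun_prop)) (∫ η, |f η|) (Eventually.of_forall fun p => ct_bdd hf _)

def closeP (d : ℝ) : Set (ℝ × ℝ) := {p | 0 < |p.1 - p.2| ∧ |p.1-p.2| ≤ d}

lemma closeP_meas (d : ℝ) : MeasurableSet (closeP d) :=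
  (measurableSet_lt (f := fun _ : ℝ × ℝ => (0:ℝ)) (g := fun p => |p.1 - p.2|) (by fun_prop) (by fun_prop)).inter (measurableSet_le (f := fun p : ℝ × ℝ => |p.1-p.2|) (g := fun _ => d) (by fun_prop) (by fun_prop))

lemma d_num {κ x : ℝ} (hκ : 0 < κ) (h6 : 2*π*1.0522/(κ*(33/10)) ≤ |x|) : 401/100 ≤ (κ*x)^2 := by
  rw [div_le_iff₀ (by positivity)] at h6
  have h7 : 2*3.1415*1.0522/(33/10) ≤ |κ*x| := by
    rw [abs_mul, abs_of_pos hκ, div_le_iff₀ (by norm_num)]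
    have := Real.pi_gt_d4
    linarith
  rw [← sq_abs]
  exact le_trans (by norm_num) (pow_le_pow_left₀ (by norm_num) h7 2)

set_option maxHeartbeats 800000 in
lemma F_main (hRH : RiemannHypothesis) {A : ℝ} (hA : 0 < A) : ∃ c κ0, 0 < c ∧ ∀ (N : ℕ) (κ τ : ℝ), 1 ≤ N → 1 ≤ κ → κ0 ≤ κ → exp (κ*(33/10)) = N + 1/2 → 2*(N+1) ≤ τ → log τ ≤ A * κ →
    c * (τ*κ) ≤ ((nuZ τ).prod (nuZ τ)).real (closeP (2*π*1.0522/(κ*(33/10)))) := by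
  obtain ⟨C, hC, hE⟩ := E_lower hRH Qf_smooth (b := 33/10) (by norm_num) hA
  have hI := Ih_pos
  have hp := Qf_pos
  set P := (33/10:ℝ)^2 * Qf 0 / 2 + ∫ β in 0..(33/10:ℝ), β * Qf β
  have hQ0 : 0 ≤ Qf 0 := by simp [Qf]; norm_num
  set B := (∫ η, |Qf η|) + 1 with hB
  have hB0 : 0 < B := by have : 0 ≤ ∫ η, |Qf η| := integral_nonneg fun _ => abs_nonneg _
                         linarith
  refine ⟨Ih*P/B, 2*C/(Ih*P), div_pos (mul_pos hI hp) hB0, fun N κ τ hN hκ1 hκ0 hx hτ hl => ?_⟩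
  have hκ : 0 < κ := by linarith
  have hN1 : (1:ℝ) ≤ N := by exact_mod_cast hN
  have hτ0 : 0 < τ := by linarith
  have := nuZ_fin hRH hτ0
  have hE := hE N κ τ hN hκ1 hx hτ hl
  have hV := Vt_cont hRH hτ0
  have hQc := Qf_smooth.continuous
  have hlog : κ*(33/10) ≤ log τ := by
    rw [Real.le_log_iff_exp_le hτ0, hx]; linarith
  have h1 : τ * κ^2 * Ih * P - C*(τ*κ) ≤ ∫ ξ in 0..(κ*(33/10)), Qf (ξ/κ) * (Vt τ ξ)^2 := by
    refine le_trans ?_ hE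
    have h2 : (κ*(33/10))^2 ≤ (log τ)^2 := pow_le_pow_left₀ (by positivity) hlog 2
    have := mul_le_mul_of_nonneg_left h2 (show 0 ≤ τ * Ih * Qf 0 / 2 by positivity)
    simp only [P]; linarith
  have h2 : τ*κ^2*Ih*P/2 ≤ ∫ ξ in 0..(κ*(33/10)), Qf (ξ/κ) * (Vt τ ξ)^2 := by
    refine le_trans ?_ h1
    rw [div_le_iff₀ (mul_pos hI hp)] at hκ0
    have := mul_le_mul_of_nonneg_left hκ0 (show 0 ≤ τ*κ by positivity)
    linarith
  have h3 : ∫ ξ in 0..(κ*(33/10)), Qf (ξ/κ) * (Vt τ ξ)^2 = κ * ∫ η in 0..(33/10:ℝ), Qf η * (Vt τ (η*κ))^2 := by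
    have := intervalIntegral.integral_comp_mul_right (a := 0) (b := 33/10) (fun ξ => Qf (ξ/κ) * (Vt τ ξ)^2) hκ.ne'
    simp only [mul_div_cancel_right₀ _ hκ.ne', zero_mul, smul_eq_mul] at this
    rw [this, mul_comm κ]; field_simp
  have hb := Vt_bdd hRH hτ0
  have hitg : Integrable (fun η => Qf η * (Vt τ (η*κ))^2) := Qf_int.mul_bdd (c := (∫ x, 1 ∂(nuZ τ))^2) (Continuous.aestronglyMeasurable (by fun_prop)) (Eventually.of_forall fun p => by
    rw [norm_pow]; exact pow_le_pow_left₀ (norm_nonneg _) (hb _) 2)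
  have h4 : 2 * ∫ η in 0..(33/10:ℝ), Qf η * (Vt τ (η*κ))^2 ≤ ∫ η, Qf η * (Vt τ (η*κ))^2 := by
    have e1 : ∫ η, Qf η * (Vt τ (η*κ))^2 = 2 * ∫ η in Set.Ioi 0, Qf η * (Vt τ (η*κ))^2 := by
      rw [← integral_comp_abs]
      congr 1; ext η
      rcases abs_choice η with h | h
      · rw [h]
      · rw [h, Qf_even, neg_mul, Vt, Vt]; simp only [neg_mul, Real.cos_neg]
    rw [e1, intervalIntegral.integral_of_le (by norm_num), ← Set.Ioc_union_Ioi_eq_Ioi (show (0:ℝ) ≤ 33/10 by norm_num), setIntegral_union (Set.Ioc_disjoint_Ioi le_rfl) measurableSet_Ioi hitg.integrableOn hitg.integrableOn]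
    have : 0 ≤ ∫ η in Set.Ioi (33/10:ℝ), Qf η * (Vt τ (η*κ))^2 := setIntegral_nonneg measurableSet_Ioi fun η hη => mul_nonneg (Qf_nonneg (le_of_lt hη)) (sq_nonneg _)
    linarith
  rw [← nu_pair hRH hτ0 Qf_int] at h4
  have hctB : ∀ y, |ct Qf y| ≤ B := fun y => by
    have := ct_bdd Qf_int y
    linarith
  have h5 : ∫ p, ct Qf (κ*(p.1-p.2)) ∂((nuZ τ).prod (nuZ τ)) ≤ B * ((nuZ τ).prod (nuZ τ)).real (closeP (2*π*1.0522/(κ*(33/10)))) := by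
    have hcc := ct_cont Qf_int
    rw [mul_comm, ← smul_eq_mul, ← integral_indicator_const _ (closeP_meas _)]
    refine integral_mono (Integrable.of_bound (Continuous.aestronglyMeasurable (by fun_prop)) B (Eventually.of_forall fun p => hctB _)) ((integrable_const B).indicator (closeP_meas _)) fun p => ?_
    by_cases hp : p ∈ closeP (2*π*1.0522/(κ*(33/10)))
    · simp only [Set.indicator_of_mem hp]; exact (le_abs_self _).trans (hctB _)
    · simp only [Set.indicator_of_notMem hp]
      apply ct_Qf_nonpos
      by_cases h0 : p.1 - p.2 = 0
      · left; rw [h0, mul_zero]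
      · right
        have h6 : 2*π*1.0522/(κ*(33/10)) < |p.1-p.2| := by
          by_contra! h; exact hp ⟨abs_pos.mpr h0, h⟩
        exact d_num hκ h6.le
  rw [div_mul_eq_mul_div, div_le_iff₀ hB0, mul_comm _ B]
  refine le_trans ?_ h5
  refine le_trans ?_ h4
  rw [h3] at h2
  refine le_of_mul_le_mul_left ?_ hκ
  linarith

structure Ker (c : ℝ) (f : ℝ → ℝ) : Prop where
  sm : ContDiff ℝ 1 f
  ev : ∀ x, f (-x) = f x
  nn : ∀ x, 0 ≤ f x
  z : ∀ x, 1 ≤ |x| → f x = 0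
  cn : ∀ x, 0 ≤ ct f x
  c1 : ∀ x, |x| ≤ c → 1 ≤ ct f x

lemma cs_of_z {f : ℝ → ℝ} (hz : ∀ x, 1 ≤ |x| → f x = 0) : HasCompactSupport f :=
  HasCompactSupport.intro (K := Icc (-1) 1) isCompact_Icc fun x hx => hz x (by
    by_contra h
    rw [not_le, abs_lt] at h
    exact hx ⟨h.1.le, h.2.le⟩)

lemma Ker.cs {c : ℝ} {f : ℝ → ℝ} (h : Ker c f) : HasCompactSupport f := cs_of_z h.z
lemma Ker.int {c : ℝ} {f : ℝ → ℝ} (h : Ker c f) : Integrable f := h.sm.continuous.integrable_of_hasCompactSupport h.cs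

lemma ct_scale (f : ℝ → ℝ) {s : ℝ} (hs : 0 < s) (x : ℝ) : ct (fun η => s⁻¹ * f (η/s)) x = ct f (s*x) := by
  unfold ct
  have := Measure.integral_comp_div (fun η => f η * cos (η * (s*x))) s
  rw [abs_of_pos hs, smul_eq_mul] at this
  rw [← mul_right_inj' hs.ne', ← this, ← integral_const_mul]
  congr 1; ext η; field_simp

lemma Ker.scale {c : ℝ} {f : ℝ → ℝ} (h : Ker c f) {s : ℝ} (hs : 0 < s) (hs1 : s ≤ 1) : Ker (c/s) (fun η => s⁻¹ * f (η/s)) where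
  sm := by have := h.sm; fun_prop
  ev x := by rw [neg_div, h.ev]
  nn x := mul_nonneg (by positivity) (h.nn _)
  z x hx := by
    rw [h.z, mul_zero]
    rw [abs_div, abs_of_pos hs, le_div_iff₀ hs]; linarith
  cn x := by rw [ct_scale f hs]; exact h.cn _
  c1 x hx := by
    rw [ct_scale f hs]; refine h.c1 _ ?_
    rw [abs_mul, abs_of_pos hs]
    rw [le_div_iff₀ hs] at hx; linarith

lemma Ker.mono {c c' : ℝ} {f : ℝ → ℝ} (h : Ker c f) (hc : c' ≤ c) : Ker c' f :=
  { h with c1 := fun x hx => h.c1 x (hx.trans hc) }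

lemma ct_avg {f g : ℝ → ℝ} (hf : Integrable f) (hg : Integrable g) (x : ℝ) : ct (fun η => (f η + g η)/2) x = (ct f x + ct g x)/2 := by
  unfold ct
  rw [← integral_add (int_mul_cos hf x) (int_mul_cos hg x), ← integral_div]
  congr 1; ext η; ring

lemma Ker.avg {c : ℝ} {f g : ℝ → ℝ} (h : Ker c f) (h' : Ker c g) : Ker c (fun η => (f η + g η)/2) where
  sm := by have := h.sm; have := h'.sm; fun_prop
  ev x := by rw [h.ev, h'.ev]
  nn x := by have := h.nn x; have := h'.nn x; positivity
  z x hx := by rw [h.z x hx, h'.z x hx]; simp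
  cn x := by rw [ct_avg h.int h'.int]; have := h.cn x; have := h'.cn x; positivity
  c1 x hx := by rw [ct_avg h.int h'.int]; have := h.c1 x hx; have := h'.c1 x hx; linarith

lemma Ker.base : ∃ c f, 0 < c ∧ Ker c f := by
  have h0 := vv0_pos
  have hev : ∀ᶠ x in nhds (0:ℝ), vv 0 / 2 < vv x := vv_cont.continuousAt.eventually (lt_mem_nhds (by linarith))
  obtain ⟨r, hr, hb⟩ := Metric.eventually_nhds_iff.1 hev
  have hct : ∀ x, ct (fun x => 2/vv 0 * vh x) x = 2/vv 0 * vv x := fun x => by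
    simp only [ct, vv, mul_assoc]; rw [integral_const_mul]
  refine ⟨r/2, fun x => 2/vv 0 * vh x, by linarith, ⟨?_, ?_, ?_, ?_, ?_, ?_⟩⟩
  · have := vh_smooth.of_le (m := 1) (by norm_num); fun_prop
  · intro x; rw [vh_even]
  · intro x; have := vh_nonneg x; positivity
  · intro x hx; rw [vh_zero hx, mul_zero]
  · intro x; rw [hct]; have := vv_nonneg x; positivity
  · intro x hx
    rw [hct]
    have := hb (y := x) (by rw [Real.dist_eq, sub_zero]; linarith)
    rw [div_mul_eq_mul_div, le_div_iff₀ h0]; linarith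

def En (f : ℝ → ℝ) : ℝ := ∫ x, |x| * (f x)^2

lemma Ker.e_int {c c' : ℝ} {f g : ℝ → ℝ} (h : Ker c f) (h' : Ker c' g) : Integrable (fun x => |x| * (f x * g x)) := by
  have h1 := h.sm.continuous; have h2 := h'.sm.continuous
  exact (show Continuous (fun x => |x| * (f x * g x)) by fun_prop).integrable_of_hasCompactSupport (cs_of_z fun x hx => by rw [h.z x hx]; ring)

lemma En_scale (f : ℝ → ℝ) {s : ℝ} (hs : 0 < s) : En (fun η => s⁻¹ * f (η/s)) = En f := by
  unfold En
  have := Measure.integral_comp_div (fun η => |η| * (f η)^2) s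
  rw [abs_of_pos hs, smul_eq_mul] at this
  rw [← mul_right_inj' hs.ne', ← this, ← integral_const_mul]
  congr 1; ext η; rw [abs_div, abs_of_pos hs]; field_simp

lemma Ker.cross {c : ℝ} {f : ℝ → ℝ} (h : Ker c f) : ∃ B, 0 < B ∧ ∀ s, 0 < s → s ≤ 1 → ∫ x, |x| * (f x * (s⁻¹ * f (x/s))) ≤ B * s := by
  obtain ⟨M, hM⟩ := h.cs.exists_bound_of_continuous h.sm.continuous
  have hM0 : 0 ≤ M := (norm_nonneg _).trans (hM 0)
  refine ⟨2*M^2+1, by positivity, fun s hs hs1 => ?_⟩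
  have : ∫ x, |x| * (f x * (s⁻¹ * f (x/s))) ≤ ∫ x, (Icc (-s) s).indicator (fun _ => M^2) x := by
    refine integral_mono (h.e_int (h.scale hs hs1)) ((integrable_indicator_iff measurableSet_Icc).2 (by simp)) fun x => ?_
    by_cases hx : x ∈ Icc (-s) s
    · rw [Set.indicator_of_mem hx]
      have h1 : f x ≤ M := (le_abs_self _).trans (hM x)
      have h2 : f (x/s) ≤ M := (le_abs_self _).trans (hM _)
      have h3 : |x| * s⁻¹ ≤ 1 := by rw [← div_eq_mul_inv, div_le_one hs]; exact abs_le.2 hx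
      calc |x| * (f x * (s⁻¹ * f (x/s))) = (|x| * s⁻¹) * (f x * f (x/s)) := by ring
        _ ≤ 1 * (M * M) := mul_le_mul h3 (mul_le_mul h1 h2 (h.nn _) hM0) (mul_nonneg (h.nn _) (h.nn _)) zero_le_one
        _ = M^2 := by ring
    · rw [Set.indicator_of_notMem hx, h.z (x/s)]
      · simp
      · rw [abs_div, abs_of_pos hs, le_div_iff₀ hs, one_mul]
        by_contra h; exact hx (abs_le.1 (not_le.1 h).le)
  refine this.trans ?_
  rw [integral_indicator_const _ measurableSet_Icc, smul_eq_mul, Real.volume_real_Icc_of_le (by linarith)]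
  nlinarith

lemma Ker.small (c : ℝ) {ε : ℝ} (hε : 0 < ε) : ∃ f, Ker c f ∧ En f ≤ ε := by
  have hb : ∃ f, Ker c f := by
    obtain ⟨c', f, hc, hf⟩ := Ker.base
    refine ⟨_, (hf.scale (s := min 1 (c'/(|c|+1))) (by positivity) (min_le_left _ _)).mono ?_⟩
    rw [le_div_iff₀ (by positivity)]
    have h1 := min_le_right 1 (c'/(|c|+1))
    have h0 : 0 < min 1 (c'/(|c|+1)) := by positivity
    calc c * min 1 (c'/(|c|+1)) ≤ (|c|+1) * (c'/(|c|+1)) := mul_le_mul (by linarith [le_abs_self c]) h1 h0.le (by positivity)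
      _ = c' := by field_simp
  have key : ∀ n : ℕ, ∃ f, Ker c f ∧ En f ≤ (3/4)^n * (En hb.choose + 1) := by
    have hE : 0 ≤ En hb.choose := integral_nonneg fun x => by positivity
    intro n
    induction n with
    | zero => exact ⟨_, hb.choose_spec, by linarith⟩
    | succ n ih =>
      obtain ⟨f, hf, he⟩ := ih
      set a := (3/4:ℝ)^n * (En hb.choose + 1)
      have ha : 0 < a := by positivity
      obtain ⟨B, hB, hx⟩ := hf.cross
      set s := min 1 (a/(2*B))
      have hs : 0 < s := by positivity
      have hs1 : s ≤ 1 := min_le_left _ _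
      have hsB : B * s ≤ a/2 := by
        have := mul_le_mul_of_nonneg_left (min_le_right 1 (a/(2*B))) hB.le
        refine this.trans (le_of_eq ?_); field_simp
      have hcs : Ker c (fun η => s⁻¹ * f (η/s)) := { hf.scale hs hs1 with
        c1 := fun x h => by
          rw [ct_scale f hs]; refine hf.c1 _ ?_
          rw [abs_mul, abs_of_pos hs]
          exact (mul_le_of_le_one_left (abs_nonneg _) hs1).trans h }
      refine ⟨_, hf.avg hcs, ?_⟩
      have e : En (fun η => (f η + s⁻¹ * f (η/s))/2) = (En f + En (fun η => s⁻¹ * f (η/s)) + 2 * ∫ x, |x| * (f x * (s⁻¹ * f (x/s))))/4 := by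
        unfold En
        have i1 := hf.e_int hf
        have i2 := hcs.e_int hcs
        have i3 := hf.e_int hcs
        simp only [← sq] at i1 i2
        have i4 : Integrable (fun x => |x| * f x ^ 2 + |x| * (s⁻¹ * f (x / s)) ^ 2) := i1.add i2
        rw [← integral_const_mul, ← integral_add i1 i2, ← integral_add i4 (i3.const_mul 2), ← integral_div]
        congr 1; ext x; ring
      rw [e, En_scale f hs, pow_succ]
      have := hx s hs hs1
      simp only [a] at *
      linarith
  have ht : Tendsto (fun n : ℕ => (3/4:ℝ)^n * (En hb.choose + 1)) atTop (nhds 0) := by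
    simpa using (tendsto_pow_atTop_nhds_zero_of_lt_one (by norm_num) (by norm_num : (3/4:ℝ) < 1)).mul_const (En hb.choose + 1)
  obtain ⟨n, hn⟩ := (ht.eventually (gt_mem_nhds hε)).exists
  obtain ⟨f, hf, he⟩ := key n
  exact ⟨f, hf, he.trans hn.le⟩

lemma ct_mul_formula {a g : ℝ → ℝ} (ha : Integrable a) (hg : Integrable g) : ∫ u, a u * ct g u = ∫ η, g η * ct a η := by
  unfold ct
  simp_rw [← integral_const_mul]
  rw [integral_integral_swap]
  · congr 1; ext η; congr 1; ext u; rw [mul_comm η u]; ring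
  · have : Integrable (fun p : ℝ × ℝ => (a p.1 * g p.2) * cos (p.2 * p.1)) (volume.prod volume) :=
      (ha.mul_prod hg).mul_bdd (c := 1) (Continuous.aestronglyMeasurable (by fun_prop)) (Eventually.of_forall fun p => Real.abs_cos_le_one _)
    exact this.congr (Eventually.of_forall fun p => mul_assoc _ _ _)

lemma ct_sq {f : ℝ → ℝ} (hf : Integrable f) (he : ∀ x, f (-x) = f x) (u : ℝ) : ct (fun x => ∫ y, f y * f (x - y)) u = (ct f u)^2 := by
  have h1 : ct (fun x => ∫ y, f y * f (x - y)) u = ∫ x, ∫ y, f y * f (x - y) * cos (x * u) := by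
    rw [ct]; congr 1; ext x; rw [integral_mul_const]
  have hp : Integrable (fun p : ℝ × ℝ => f p.2 * f (p.1 - p.2) * cos (p.1 * u)) (volume.prod volume) := by
    have := Integrable.convolution_integrand (ContinuousLinearMap.mul ℝ ℝ) hf hf
    refine Integrable.mul_bdd (c := 1) this (by fun_prop) (Eventually.of_forall fun x => Real.abs_cos_le_one _)
  rw [h1, integral_integral_swap hp]
  have h2 : ∀ y, ∫ x, f y * f (x - y) * cos (x * u) = f y * cos (y * u) * ct f u := by
    intro y
    rw [← integral_add_right_eq_self _ y]
    have : (fun x => f y * f (x + y - y) * cos ((x+y)*u)) = fun x => f y * cos (y*u) * (f x * cos (x*u)) - f y * sin (y*u) * (f x * sin (x*u)) := by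
      ext x; rw [add_sub_cancel_right, add_mul, Real.cos_add]; ring
    rw [this, integral_sub ((int_mul_cos hf u).const_mul _) ((int_mul_sin hf u).const_mul _), integral_const_mul, integral_const_mul,
      int_odd_zero (g := fun x => f x * sin (x*u)) (fun x => by rw [he]; simp)]
    rw [mul_zero, sub_zero, ct]
  simp_rw [h2]
  rw [integral_mul_const, ← ct, sq]

lemma planch {f : ℝ → ℝ} (hf : Integrable f) (he : ∀ x, f (-x) = f x) (h2 : Integrable (fun x => (f x)^2)) :
    ∫⁻ u, ofReal ((ct f u)^2) ≤ ofReal (2*π*∫ x, (f x)^2) := by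
  set G := ∫ x, (f x)^2
  have hG : 0 ≤ G := integral_nonneg fun x => sq_nonneg _
  have hcc := ct_cont hf
  have hv := vv0_pos
  have hvc := vv_cont
  set g : ℝ → ℝ := fun x => ∫ y, f y * f (x - y) with hg
  have hgi : Integrable g := Integrable.integrable_convolution (ContinuousLinearMap.mul ℝ ℝ) hf hf
  have hgb : ∀ x, g x ≤ G := by
    intro x
    have i2 : Integrable (fun y => (f (x - y))^2) := h2.comp_sub_left x
    have e : ∫ y, (f (x-y))^2 = G := integral_sub_left_eq_self (fun y => (f y)^2) volume x
    have : ∫ y, ((f y)^2 + (f (x-y))^2)/2 = G := by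
      rw [integral_div, integral_add h2 i2, e]; simp only [G]; ring
    rw [← this]
    by_cases hi : Integrable (fun y => f y * f (x-y))
    · exact integral_mono hi ((h2.add i2).div_const 2) fun y => by simp only; nlinarith [sq_nonneg (f y - f (x-y))]
    · rw [hg]; simp only; rw [integral_undef hi, this]; exact hG
  have hvi : ∀ s : ℝ, 0 < s → Integrable (fun u => s⁻¹ * vv (u/s)) := fun s hs => (vv_int.comp_div hs.ne').const_mul _
  have key : ∀ s : ℝ, 0 < s → ∫⁻ u, ofReal (vv (u/s) * (ct f u)^2) ≤ ofReal (2*π*vv 0*G) := by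
    intro s hs
    have h3 : ∫ u, s⁻¹ * vv (u/s) * (ct f u)^2 ≤ 2*π*vv 0*G/s := by
      have : ∫ u, s⁻¹ * vv (u/s) * (ct f u)^2 = ∫ η, g η * (2*π*vh (s*η)) := by
        simp_rw [← ct_sq hf he]
        rw [ct_mul_formula (hvi s hs) hgi]
        simp_rw [ct_scale vv hs, ct_vv]
      rw [this]
      have hvs : Integrable (fun η => vh (s*η)) := vh_int.comp_mul_left' hs.ne'
      obtain ⟨B, hB, hb⟩ := vh_bdd
      have hvhc := vh_cont
      calc ∫ η, g η * (2*π*vh (s*η)) ≤ ∫ η, G * (2*π*vh (s*η)) := by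
            refine integral_mono (hgi.mul_bdd (c := 2*π*B) (Continuous.aestronglyMeasurable (by fun_prop)) (Eventually.of_forall fun η => ?_)) ((hvs.const_mul _).const_mul _) fun η => ?_
            · have := vh_nonneg (s*η)
              rw [Real.norm_of_nonneg (by positivity)]
              exact mul_le_mul_of_nonneg_left (hb _) (by positivity)
            · exact mul_le_mul_of_nonneg_right (hgb η) (by have := vh_nonneg (s*η); positivity)
        _ = 2*π*vv 0*G/s := by
            rw [integral_const_mul, integral_const_mul, Measure.integral_comp_mul_left, abs_of_pos (inv_pos.2 hs), smul_eq_mul, vv0_eq]; field_simp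
    have h4 : ∫ u, vv (u/s) * (ct f u)^2 ≤ 2*π*vv 0*G := by
      simp only [mul_assoc] at h3
      rw [integral_const_mul, inv_mul_le_iff₀ hs] at h3
      refine h3.trans (le_of_eq ?_); field_simp
    rw [← ofReal_integral_eq_lintegral_ofReal]
    · exact ENNReal.ofReal_le_ofReal h4
    · refine (vv_int.comp_div hs.ne').mul_bdd (c := (∫ η, |f η|)^2) (Continuous.aestronglyMeasurable (by fun_prop)) (Eventually.of_forall fun u => ?_)
      rw [norm_pow]; exact pow_le_pow_left₀ (norm_nonneg _) (ct_bdd hf u) 2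
    · exact Eventually.of_forall fun u => mul_nonneg (vv_nonneg _) (sq_nonneg _)
  have h5 : ∫⁻ u, ofReal (vv 0 * (ct f u)^2) ≤ ofReal (2*π*vv 0*G) := by
    have hl : ∀ u, Tendsto (fun n : ℕ => ofReal (vv (u/((n:ℝ)+1)) * (ct f u)^2)) atTop (nhds (ofReal (vv 0 * (ct f u)^2))) := by
      intro u
      refine ENNReal.tendsto_ofReal (Tendsto.mul_const _ ((vv_cont.tendsto 0).comp ?_))
      have : Tendsto (fun n : ℕ => u * (1 / ((n:ℝ)+1))) atTop (nhds (u*0)) := tendsto_one_div_add_atTop_nhds_zero_nat.const_mul u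
      simpa [div_eq_mul_inv] using this
    calc ∫⁻ u, ofReal (vv 0 * (ct f u)^2) = ∫⁻ u, liminf (fun n : ℕ => ofReal (vv (u/((n:ℝ)+1)) * (ct f u)^2)) atTop := by
          congr 1; ext u; exact (hl u).liminf_eq.symm
      _ ≤ liminf (fun n : ℕ => ∫⁻ u, ofReal (vv (u/((n:ℝ)+1)) * (ct f u)^2)) atTop := lintegral_liminf_le fun n => (Continuous.measurable (by fun_prop)).ennreal_ofReal
      _ ≤ liminf (fun n : ℕ => ofReal (2*π*vv 0*G)) atTop := liminf_le_liminf (Eventually.of_forall fun n => key _ (by positivity))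
      _ = _ := by simp
  simp_rw [ENNReal.ofReal_mul hv.le] at h5
  rw [lintegral_const_mul' _ _ ENNReal.ofReal_ne_top, show 2*π*vv 0*G = vv 0 * (2*π*G) by ring, ENNReal.ofReal_mul hv.le] at h5
  exact (ENNReal.mul_le_mul_iff_right (by simpa using hv) ENNReal.ofReal_ne_top).1 h5

lemma Ker.lip {c : ℝ} {f : ℝ → ℝ} (h : Ker c f) : ∃ L, 0 < L ∧ ∀ x, |f x - f 0| ≤ L * |x| := by
  obtain ⟨C, hC⟩ := (h.cs.deriv).exists_bound_of_continuous (h.sm.continuous_deriv (by norm_num))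
  refine ⟨|C|+1, by positivity, fun x => ?_⟩
  have := Convex.norm_image_sub_le_of_norm_deriv_le (f := f) (s := Set.univ) (C := |C|+1) (fun x _ => h.sm.differentiable (by norm_num) x)
    (fun x _ => (hC x).trans (by linarith [le_abs_self C])) convex_univ (Set.mem_univ 0) (Set.mem_univ x)
  simpa using this

lemma Vt_even (τ ξ : ℝ) : Vt τ (-ξ) = Vt τ ξ := by simp [Vt]
lemma X1_even (τ ξ : ℝ) : X1 τ (-ξ) = X1 τ ξ := by rw [X1, X1, mul_neg, vh_even]

lemma int_even_cs {F : ℝ → ℝ} (he : ∀ x, F (-x) = F x) {R : ℝ} (hR : 0 ≤ R) (hz : ∀ x, R ≤ x → F x = 0) : ∫ x, F x = 2 * ∫ x in 0..R, F x := by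
  have e1 : ∫ x, F x = ∫ x, F |x| := by
    congr 1; ext x; rcases abs_choice x with h | h <;> simp [h, he]
  rw [e1, integral_comp_abs, intervalIntegral.integral_of_le hR]
  congr 1
  refine (setIntegral_eq_of_subset_of_forall_sdiff_eq_zero measurableSet_Ioi (fun x hx => hx.1) fun x hx => ?_)
  exact hz x (by by_contra h; exact hx.2 ⟨hx.1, (not_le.1 h).le⟩)

lemma ker_E {c : ℝ} {f : ℝ → ℝ} (h : Ker c f) : ∫ β in 0..(33/10:ℝ), β * (f β)^2 ≤ En f := by
  rw [intervalIntegral.integral_of_le (by norm_num), En]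
  have i := h.e_int h
  simp only [← sq] at i
  refine le_trans (le_of_eq ?_) (setIntegral_le_integral (s := Set.Ioc 0 (33/10)) i (Eventually.of_forall fun x => by positivity))
  exact setIntegral_congr_fun measurableSet_Ioc fun x hx => by rw [abs_of_pos hx.1]

set_option maxHeartbeats 800000 in
lemma G_main (hRH : RiemannHypothesis) {A : ℝ} (hA : 0 < A) (c : ℝ) {ε : ℝ} (hε : 0 < ε) : ∃ k κ0, 0 ≤ k ∧ ∀ (N : ℕ) (κ τ : ℝ), 1 ≤ N → 1 ≤ κ → κ0 ≤ κ → exp (κ*(33/10)) = N + 1/2 → 2*(N+1) ≤ τ → log τ ≤ A * κ →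
    ∃ n2 : ℝ → ℝ, Continuous n2 ∧ (∀ t, (nuZ τ).real (Icc (t - c/κ) (t + c/κ)) ≤ k * vv (t/τ) + n2 t) ∧ ∫⁻ t, ofReal ((n2 t)^2) ≤ ofReal (ε * τ) := by
  have hI := Ih_pos
  obtain ⟨f, hf, hfe⟩ := Ker.small c (ε := ε/(32*π*Ih)) (by positivity)
  obtain ⟨C, hC, hE⟩ := E_upper hRH (g := fun x => (f x)^2) (hf.sm.pow 2) (fun x => sq_nonneg _) (b := 33/10) (by norm_num)
  obtain ⟨L, hL, hl⟩ := hf.lip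
  refine ⟨f 0 * A, 4*π*(4*C+2*(L*A)^2*Ih)/ε, mul_nonneg (hf.nn 0) hA.le, fun N κ τ hN hκ1 hκ0 hx hτ hlg => ?_⟩
  have hκ : 0 < κ := by linarith
  have hN1 : (1:ℝ) ≤ N := by exact_mod_cast hN
  have hτ1 : 1 ≤ τ := by linarith
  have hτ0 : 0 < τ := by linarith
  have hlog0 : 0 ≤ log τ := Real.log_nonneg hτ1
  have := nuZ_fin hRH hτ0
  have hE := hE N κ τ hN hκ1 hx hτ
  have hV := Vt_cont hRH hτ0
  have hfc := hf.sm.continuous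
  have hvc := vh_cont
  have hX : Continuous (X1 τ) := X1_cont τ
  have ivs : Integrable (fun ξ => vh (τ*ξ)) := vh_int.comp_mul_left' hτ0.ne'
  have iX : Integrable (X1 τ) := ivs.const_mul _
  have hz : ∀ ξ, κ ≤ |ξ| → f (ξ/κ) = 0 := fun ξ h => hf.z _ (by rw [abs_div, abs_of_pos hκ, le_div_iff₀ hκ]; linarith)
  have hcs : ∀ g : ℝ → ℝ, HasCompactSupport (fun ξ => f (ξ/κ) * g ξ) := fun g =>
    HasCompactSupport.intro (K := Icc (-κ) κ) isCompact_Icc fun x hx => by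
      rw [hz x, zero_mul]
      by_contra h
      rw [not_le, abs_lt] at h
      exact hx ⟨h.1.le, h.2.le⟩
  have iV : Integrable (fun ξ => f (ξ/κ) * Vt τ ξ) := Continuous.integrable_of_hasCompactSupport (by fun_prop) (hcs _)
  set H : ℝ → ℝ := fun ξ => κ⁻¹ * (f (ξ/κ) * Vt τ ξ - f 0 * X1 τ ξ) with hH
  have hHi : Integrable H := (iV.sub (iX.const_mul _)).const_mul _
  have hHe : ∀ x, H (-x) = H x := fun x => by simp only [hH]; rw [neg_div, hf.ev, Vt_even, X1_even]
  have hHc : Continuous H := by simp only [hH]; fun_prop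
  -- main bound
  have iF1 : Integrable (fun ξ => (f (ξ/κ))^2 * (Vt τ ξ - X1 τ ξ)^2) := by
    have : (fun ξ => (f (ξ/κ))^2 * (Vt τ ξ - X1 τ ξ)^2) = fun ξ => f (ξ/κ) * (f (ξ/κ) * (Vt τ ξ - X1 τ ξ)^2) := by ext; ring
    rw [this]
    exact Continuous.integrable_of_hasCompactSupport (by fun_prop) (hcs _)
  have iF2 : Integrable (fun ξ => (vh (τ*ξ))^2) := vh_sq_int.comp_mul_left' hτ0.ne'
  have hpt : ∀ ξ, (H ξ)^2 ≤ (κ^2)⁻¹ * (2 * ((f (ξ/κ))^2 * (Vt τ ξ - X1 τ ξ)^2) + 2*(L*A)^2 * (vh (τ*ξ))^2) := by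
    intro ξ
    have h1 : ((f (ξ/κ) - f 0) * X1 τ ξ)^2 ≤ (L*A)^2 * (vh (τ*ξ))^2 := by
      rcases le_or_gt 1 |τ*ξ| with h | h
      · rw [X1, vh_zero h]; simp
      · rw [← mul_pow, ← sq_abs]
        refine pow_le_pow_left₀ (abs_nonneg _) ?_ 2
        have h2 := hl (ξ/κ)
        have h3 : |ξ/κ| * τ ≤ 1/κ := by
          rw [abs_mul, abs_of_pos hτ0] at h
          rw [abs_div, abs_of_pos hκ, div_mul_eq_mul_div]
          exact div_le_div_of_nonneg_right (by linarith) hκ.le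
        have h4 : log τ / κ ≤ A := by rwa [div_le_iff₀ hκ]
        rw [abs_mul, X1, abs_of_nonneg (mul_nonneg (by positivity) (vh_nonneg _)), ← mul_assoc]
        refine mul_le_mul_of_nonneg_right ?_ (vh_nonneg _)
        calc |f (ξ/κ) - f 0| * (τ * log τ) ≤ L * |ξ/κ| * (τ * log τ) := mul_le_mul_of_nonneg_right h2 (by positivity)
          _ = L * log τ * (|ξ/κ| * τ) := by ring
          _ ≤ L * log τ * (1/κ) := mul_le_mul_of_nonneg_left h3 (by positivity)
          _ = L * (log τ / κ) := by ring
          _ ≤ L * A := mul_le_mul_of_nonneg_left h4 hL.le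
    have e : (H ξ)^2 = (κ^2)⁻¹ * (f (ξ/κ) * (Vt τ ξ - X1 τ ξ) + (f (ξ/κ) - f 0) * X1 τ ξ)^2 := by
      simp only [hH]; rw [mul_pow, inv_pow]; ring
    rw [e]
    refine mul_le_mul_of_nonneg_left ?_ (by positivity)
    rw [← mul_pow]
    linarith [add_sq_le (a := f (ξ/κ) * (Vt τ ξ - X1 τ ξ)) (b := (f (ξ/κ) - f 0) * X1 τ ξ)]
  have iR : Integrable (fun ξ => (κ^2)⁻¹ * (2 * ((f (ξ/κ))^2 * (Vt τ ξ - X1 τ ξ)^2) + 2*(L*A)^2 * (vh (τ*ξ))^2)) :=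
    ((iF1.const_mul 2).add (iF2.const_mul _)).const_mul _
  have iH2 : Integrable (fun ξ => (H ξ)^2) := iR.mono' (Continuous.aestronglyMeasurable (by fun_prop)) (Eventually.of_forall fun ξ => by
    rw [Real.norm_of_nonneg (sq_nonneg _)]; exact hpt ξ)
  have hH2 : 2*π*∫ ξ, (H ξ)^2 ≤ ε * τ := by
    have h1 : ∫ ξ, (H ξ)^2 ≤ (κ^2)⁻¹ * (2 * (2 * (2 * (τ * Ih * (κ^2 * (ε/(32*π*Ih)))) + C * (τ * κ))) + 2*(L*A)^2 * (τ⁻¹ * Ih)) := by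
      refine (integral_mono iH2 iR hpt).trans ?_
      rw [integral_const_mul, integral_add (iF1.const_mul 2) (iF2.const_mul _), integral_const_mul, integral_const_mul,
        Measure.integral_comp_mul_left (fun x => (vh x)^2), abs_of_pos (inv_pos.2 hτ0), smul_eq_mul, ← Ih,
        int_even_cs (R := κ*(33/10)) (fun x => by rw [neg_div, hf.ev, Vt_even, X1_even]) (by positivity) (fun x h => by
          rw [hz x]
          · ring
          · exact le_trans (by linarith) (h.trans (le_abs_self x)))]
      have h2 : 2 * (τ * Ih * (κ^2 * ∫ β in 0..(33/10:ℝ), β * (f β)^2)) ≤ 2 * (τ * Ih * (κ^2 * (ε/(32*π*Ih)))) := by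
        have := (ker_E hf).trans hfe
        gcongr
      gcongr
      linarith
    have h3 : (κ^2)⁻¹ * (2 * (2 * (2 * (τ * Ih * (κ^2 * (ε/(32*π*Ih)))) + C * (τ * κ))) + 2*(L*A)^2 * (τ⁻¹ * Ih)) ≤ τ * (ε/(4*π)) + τ * (4*C + 2*(L*A)^2*Ih)/κ := by
      have h4 : τ⁻¹ ≤ τ := (inv_le_one_of_one_le₀ hτ1).trans hτ1
      have e : (κ^2)⁻¹ * (2 * (2 * (2 * (τ * Ih * (κ^2 * (ε/(32*π*Ih)))) + C * (τ * κ))) + 2*(L*A)^2 * (τ⁻¹ * Ih)) = τ * (ε/(4*π)) + (4*C*τ + 2*(L*A)^2*Ih*(τ⁻¹/κ))/κ := by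
        field_simp; ring
      rw [e]
      have h5 : τ⁻¹/κ ≤ τ := (div_le_self (by positivity) hκ1).trans h4
      have := mul_le_mul_of_nonneg_left h5 (show 0 ≤ 2*(L*A)^2*Ih by positivity)
      gcongr
      linarith
    have h6 : τ * (4*C + 2*(L*A)^2*Ih)/κ ≤ τ * (ε/(4*π)) := by
      rw [div_le_iff₀ hε] at hκ0
      rw [div_le_iff₀ hκ, mul_assoc τ (ε/(4*π))]
      refine mul_le_mul_of_nonneg_left ?_ hτ0.le
      rw [div_mul_eq_mul_div, le_div_iff₀ (by positivity)]; linarith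
    calc 2*π*∫ ξ, (H ξ)^2 ≤ 2*π*(τ * (ε/(4*π)) + τ * (ε/(4*π))) := mul_le_mul_of_nonneg_left (by linarith) (by positivity)
      _ = ε * τ := by field_simp; ring
  refine ⟨ct H, ct_cont hHi, fun t => ?_, (planch hHi hHe iH2).trans (ENNReal.ofReal_le_ofReal hH2)⟩
  have hcc := ct_cont hf.int
  have hct : Integrable (fun x => ct f (κ*(x-t))) (nuZ τ) := Integrable.of_bound (Continuous.aestronglyMeasurable (by fun_prop)) (∫ η, |f η|) (Eventually.of_forall fun p => ct_bdd hf.int _)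
  have h1 : (nuZ τ).real (Icc (t - c/κ) (t + c/κ)) ≤ ∫ x, ct f (κ*(x-t)) ∂(nuZ τ) := by
    rw [← integral_indicator_one measurableSet_Icc]
    refine integral_mono ((integrable_const _).indicator measurableSet_Icc) hct fun x => ?_
    by_cases hx : x ∈ Icc (t - c/κ) (t + c/κ)
    · rw [Set.indicator_of_mem hx]
      refine hf.c1 _ ?_
      rw [abs_mul, abs_of_pos hκ, mul_comm, ← le_div_iff₀ hκ, abs_le]
      constructor <;> linarith [hx.1, hx.2]
    · rw [Set.indicator_of_notMem hx]; exact hf.cn _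
  refine h1.trans ?_
  rw [nu_ct hRH hτ0 hf.int]
  have e1 : ∫ η, f η * (Vt τ (η*κ) * cos (η*κ*t)) = κ⁻¹ * ∫ ξ, (f (ξ/κ) * Vt τ ξ) * cos (ξ*t) := by
    have := Measure.integral_comp_mul_right (fun ξ => (f (ξ/κ) * Vt τ ξ) * cos (ξ*t)) κ
    rw [abs_of_pos (inv_pos.2 hκ), smul_eq_mul] at this
    rw [← this]; congr 1; ext η; rw [mul_div_cancel_right₀ _ hκ.ne']; ring
  have e2 : ∫ ξ, X1 τ ξ * cos (ξ*t) = log τ * vv (t/τ) := by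
    have := ct_scale vh (inv_pos.2 hτ0) t
    rw [ct] at this
    rw [div_eq_inv_mul, vv, ← this, ← integral_const_mul]
    congr 1; ext ξ; rw [X1, inv_inv, div_inv_eq_mul, mul_comm ξ τ]; ring
  have e3 : ct H t = κ⁻¹ * (∫ ξ, (f (ξ/κ) * Vt τ ξ) * cos (ξ*t)) - κ⁻¹ * f 0 * (log τ * vv (t/τ)) := by
    rw [← e2, ← integral_const_mul, ← integral_const_mul, ← integral_sub ((int_mul_cos iV t).const_mul _) ((int_mul_cos iX t).const_mul _), ct]
    congr 1; ext ξ; simp only [hH]; ring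
  rw [e1, e3]
  have h4 : κ⁻¹ * log τ ≤ A := by rwa [inv_mul_le_iff₀ hκ, mul_comm]
  have := mul_le_mul_of_nonneg_left h4 (mul_nonneg (hf.nn 0) (vv_nonneg (t/τ)))
  linarith

def Om (d : ℝ) : Set ℝ := ⋃ γ ∈ {γ : ℝ | γ ∈ ZS ∧ ∃ γ' ∈ ZS, γ < γ' ∧ γ' ≤ γ + d}, Icc (γ-d) γ

lemma Om_meas (d : ℝ) : MeasurableSet (Om d) :=
  MeasurableSet.biUnion (ZS_countable.mono fun _ h => h.1) fun _ _ => measurableSet_Icc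

lemma nuZ_ae (τ : ℝ) : ∀ᵐ x ∂(nuZ τ), x ∈ ZS := by
  have h : ∀ᵐ x ∂muZ, x ∈ ZS := by
    rw [ae_iff]
    have hm : MeasurableSet {a : ℝ | ¬ a ∈ ZS} := ZS_countable.measurableSet.compl
    rw [← lintegral_indicator_one hm, lintegral_muZ _ (measurable_one.indicator hm)]
    refine ENNReal.tsum_eq_zero.2 fun γ => ?_
    rw [Set.indicator_of_notMem (by simp), mul_zero]
  exact (withDensity_absolutelyContinuous _ _).ae_le h

lemma H_tonelli (hRH : RiemannHypothesis) {τ d : ℝ} (hτ : 0 < τ) :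
    ofReal d * ((nuZ τ).prod (nuZ τ)) (closeP d) ≤ ∫⁻ t in Om d, (nuZ τ (Icc (t - 2*d) (t + 2*d)))^2 := by
  have := nuZ_fin hRH hτ
  set ν := nuZ τ
  let S : Set (ℝ × (ℝ × ℝ)) := {q | |q.2.1 - q.1| ≤ 2*d ∧ |q.2.2 - q.1| ≤ 2*d}
  have hS : MeasurableSet S :=
    (measurableSet_le (f := fun q : ℝ × (ℝ × ℝ) => |q.2.1 - q.1|) (g := fun _ => 2*d) (by fun_prop) (by fun_prop)).inter
      (measurableSet_le (f := fun q : ℝ × (ℝ × ℝ) => |q.2.2 - q.1|) (g := fun _ => 2*d) (by fun_prop) (by fun_prop))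
  have e1 : ∫⁻ t in Om d, (ν (Icc (t - 2*d) (t + 2*d)))^2 = ((volume.restrict (Om d)).prod (ν.prod ν)) S := by
    rw [Measure.prod_apply hS]
    congr 1; ext t
    rw [sq, ← Measure.prod_prod]
    congr 1; ext p
    simp only [S, Set.mem_prod, Set.mem_Icc, Set.mem_preimage, Set.mem_ofPred_eq, abs_le]
    constructor
    · rintro ⟨⟨a, b⟩, c, e⟩; refine ⟨⟨?_, ?_⟩, ?_, ?_⟩ <;> linarith
    · rintro ⟨⟨a, b⟩, c, e⟩; refine ⟨⟨?_, ?_⟩, ?_, ?_⟩ <;> linarith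
  rw [e1, Measure.prod_apply_symm hS, ← lintegral_indicator_const (closeP_meas d)]
  have hae : ∀ᵐ p ∂(ν.prod ν), p.1 ∈ ZS ∧ p.2 ∈ ZS :=
    (Measure.quasiMeasurePreserving_fst.ae (nuZ_ae τ)).and (Measure.quasiMeasurePreserving_snd.ae (nuZ_ae τ))
  refine lintegral_mono_ae (hae.mono fun p hp => ?_)
  by_cases hc : p ∈ closeP d
  · rw [Set.indicator_of_mem hc]
    obtain ⟨h0, h1⟩ := hc
    have key : ∀ a b : ℝ, a ∈ ZS → b ∈ ZS → a < b → b ≤ a + d → |p.1 - a| ≤ d → a ≤ p.1 → |p.2 - a| ≤ d → a ≤ p.2 → ofReal d ≤ (volume.restrict (Om d)) ((fun t => (t, p)) ⁻¹' S) := by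
      intro a b ha hb hab hba x1 x2 x3 x4
      have hsub : Icc (a-d) a ⊆ ((fun t => (t, p)) ⁻¹' S) ∩ Om d := by
        intro t ht
        refine ⟨?_, Set.mem_biUnion (show a ∈ {γ : ℝ | γ ∈ ZS ∧ ∃ γ' ∈ ZS, γ < γ' ∧ γ' ≤ γ + d} from ⟨ha, b, hb, hab, hba⟩) ht⟩
        simp only [S, Set.mem_preimage, Set.mem_ofPred_eq]
        rw [abs_le] at x1 x3
        constructor <;> (rw [abs_le]; constructor <;> linarith [ht.1, ht.2])
      rw [Measure.restrict_apply' (Om_meas d)]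
      refine le_trans ?_ (measure_mono hsub)
      rw [Real.volume_Icc, sub_sub_cancel]
    rcases lt_or_gt_of_ne (show p.1 ≠ p.2 by intro h; rw [h, sub_self, abs_zero] at h0; exact lt_irrefl _ h0) with h | h
    · rw [abs_le] at h1
      exact key p.1 p.2 hp.1 hp.2 h (by linarith) (by rw [sub_self, abs_zero]; linarith) le_rfl (by rw [abs_le]; constructor <;> linarith) h.le
    · rw [abs_le] at h1
      exact key p.2 p.1 hp.2 hp.1 h (by linarith) (by rw [abs_le]; constructor <;> linarith) h.le (by rw [sub_self, abs_zero]; linarith) le_rfl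
  · rw [Set.indicator_of_notMem hc]; exact zero_le

set_option maxHeartbeats 400000 in
lemma H_main (hRH : RiemannHypothesis) {A : ℝ} (hA : 0 < A) : ∃ c R κ0, 0 < c ∧ 1 ≤ R ∧ ∀ (N : ℕ) (κ τ : ℝ), 1 ≤ N → 1 ≤ κ → κ0 ≤ κ → exp (κ*(33/10)) = N + 1/2 → 2*(N+1) ≤ τ → log τ ≤ A * κ →
    ofReal (c * τ) ≤ volume (Om (2*π*1.0522/(κ*(33/10))) ∩ Icc (-(R*τ)) (R*τ)) := by
  obtain ⟨c, κ1, hc, hF⟩ := F_main hRH hA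
  set c1 : ℝ := 2*π*1.0522/(33/10) with hc1
  have hc1p : 0 < c1 := by positivity
  set ε := c*c1/8 with hε
  have hεp : 0 < ε := by positivity
  obtain ⟨k, κ2, hk, hG⟩ := G_main hRH hA (2*c1) hεp
  obtain ⟨C, hC, hv⟩ := vv_bound
  set D := 2*k^2*C^2 with hD
  have hD0 : 0 ≤ D := by positivity
  set R := 1 + D*π/ε with hR
  have hR1 : 1 ≤ R := by have : 0 ≤ D*π/ε := by positivity
                         linarith
  refine ⟨c*c1/2/(D+1), R, max κ1 κ2, by positivity, hR1, fun N κ τ hN hκ1 hκ0 hx hτ hlg => ?_⟩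
  have hκ : 0 < κ := by linarith
  have hN1 : (1:ℝ) ≤ N := by exact_mod_cast hN
  have hτ0 : 0 < τ := by linarith
  have := nuZ_fin hRH hτ0
  set d := 2*π*1.0522/(κ*(33/10)) with hd
  have hdc : d = c1/κ := by rw [hd, hc1]; field_simp
  have hF := hF N κ τ hN hκ1 ((le_max_left _ _).trans hκ0) hx hτ hlg
  obtain ⟨n2, hn2, hb, hn⟩ := hG N κ τ hN hκ1 ((le_max_right _ _).trans hκ0) hx hτ hlg
  have hT := H_tonelli hRH (d := d) hτ0
  rw [mul_div_assoc, ← hdc] at hb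
  have hL : ofReal (8*ε*τ) ≤ ofReal d * ((nuZ τ).prod (nuZ τ)) (closeP d) := by
    rw [← ofReal_measureReal, ← ENNReal.ofReal_mul (by positivity)]
    refine ENNReal.ofReal_le_ofReal ?_
    refine le_trans (le_of_eq ?_) (mul_le_mul_of_nonneg_left hF (by positivity))
    rw [hdc, hε]; field_simp
  set W := Om d ∩ Icc (-(R*τ)) (R*τ)
  have hpt : ∀ t, (nuZ τ (Icc (t - 2*d) (t + 2*d)))^2 ≤ ((Icc (-(R*τ)) (R*τ)).indicator (fun _ => ofReal D) t + ofReal (D/R * (1+(t/τ)^2)⁻¹)) + 2 * ofReal ((n2 t)^2) := by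
    intro t
    have h1 : ((nuZ τ).real (Icc (t - 2*d) (t + 2*d)))^2 ≤ 2*k^2*(vv (t/τ))^2 + 2 * (n2 t)^2 := by
      refine (pow_le_pow_left₀ measureReal_nonneg (hb t) 2).trans ?_
      have := add_sq_le (a := k * vv (t/τ)) (b := n2 t)
      linarith [mul_pow k (vv (t/τ)) 2]
    have h2 : 2*k^2*(vv (t/τ))^2 ≤ D * ((1+(t/τ)^2)⁻¹)^2 := by
      have h3 : vv (t/τ) ≤ C * (1+(t/τ)^2)⁻¹ := by
        refine (hv _).trans ?_
        rw [← div_eq_mul_inv]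
        exact div_le_div_of_nonneg_left hC.le (by positivity) (by nlinarith [sq_nonneg (t/τ)])
      have := mul_le_mul_of_nonneg_left (pow_le_pow_left₀ (vv_nonneg _) h3 2) (show 0 ≤ 2*k^2 by positivity)
      rw [mul_pow] at this
      rw [hD]; linarith
    have hi1 : (1+(t/τ)^2)⁻¹ ≤ 1 := inv_le_one_of_one_le₀ (by linarith [sq_nonneg (t/τ)])
    have hi0 : 0 < (1+(t/τ)^2)⁻¹ := by positivity
    rw [← ofReal_measureReal, ← ENNReal.ofReal_pow measureReal_nonneg]
    refine (ENNReal.ofReal_le_ofReal h1).trans ?_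
    rw [ENNReal.ofReal_add (by positivity) (by positivity), ENNReal.ofReal_mul (by norm_num : (0:ℝ) ≤ 2) (q := (n2 t)^2)]
    gcongr
    swap
    · simp
    by_cases ht : t ∈ Icc (-(R*τ)) (R*τ)
    · rw [Set.indicator_of_mem ht]
      refine le_add_right (ENNReal.ofReal_le_ofReal (h2.trans ?_))
      exact mul_le_of_le_one_right hD0 (pow_le_one₀ hi0.le hi1)
    · rw [Set.indicator_of_notMem ht, zero_add]
      refine ENNReal.ofReal_le_ofReal (h2.trans ?_)
      rw [sq, ← mul_assoc]
      refine mul_le_mul_of_nonneg_right ?_ hi0.le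
      rw [← div_eq_mul_inv]
      refine div_le_div_of_nonneg_left hD0 (by linarith) ?_
      have h5 : R ≤ |t/τ| := by
        rw [abs_div, abs_of_pos hτ0, le_div_iff₀ hτ0]
        by_contra h; exact ht (abs_le.1 (not_le.1 h).le)
      have : R*1 ≤ |t/τ| * |t/τ| := mul_le_mul h5 (hR1.trans h5) zero_le_one (abs_nonneg _)
      rw [← sq_abs, sq]; linarith
  have hU : ∫⁻ t in Om d, (nuZ τ (Icc (t - 2*d) (t + 2*d)))^2 ≤ (ofReal D * volume W + ofReal (ε*τ)) + 2 * ofReal (ε*τ) := by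
    refine (lintegral_mono hpt).trans ?_
    have m1 : Measurable fun t : ℝ => ofReal (D/R * (1+(t/τ)^2)⁻¹) := by fun_prop
    have m2 : Measurable fun t : ℝ => (Icc (-(R*τ)) (R*τ)).indicator (fun _ => ofReal D) t := measurable_const.indicator measurableSet_Icc
    have m3 : Measurable fun t : ℝ => ofReal ((n2 t)^2) := by fun_prop
    have m4 : Measurable fun t : ℝ => (Icc (-(R*τ)) (R*τ)).indicator (fun _ => ofReal D) t + ofReal (D/R * (1+(t/τ)^2)⁻¹) := m2.add m1
    rw [lintegral_add_left m4, lintegral_add_left m2, lintegral_indicator_const measurableSet_Icc, Measure.restrict_apply measurableSet_Icc, Set.inter_comm, lintegral_const_mul _ m3]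
    gcongr
    · refine (setLIntegral_le_lintegral _ _).trans ?_
      have hi : Integrable (fun t : ℝ => (1+(t/τ)^2)⁻¹) := integrable_inv_one_add_sq.comp_div hτ0.ne'
      rw [← ofReal_integral_eq_lintegral_ofReal (hi.const_mul _) (Eventually.of_forall fun t => by positivity), integral_const_mul, Measure.integral_comp_div (fun x : ℝ => (1+x^2)⁻¹), abs_of_pos hτ0, smul_eq_mul, integral_univ_inv_one_add_sq]
      refine ENNReal.ofReal_le_ofReal ?_
      rw [show D/R*(τ*π) = (D*π/R)*τ by ring]
      refine mul_le_mul_of_nonneg_right ?_ hτ0.le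
      rw [div_le_iff₀ (by linarith), hR, mul_add, mul_div_cancel₀ _ hεp.ne']; linarith
    · exact (setLIntegral_le_lintegral _ _).trans hn
  have hfin : volume W ≠ ⊤ := ne_top_of_le_ne_top (by simp) (measure_mono (Set.inter_subset_right : W ⊆ Icc (-(R*τ)) (R*τ)))
  have hfinal := hL.trans (hT.trans hU)
  rw [← ENNReal.ofReal_toReal hfin, ← ENNReal.ofReal_mul hD0, ← ENNReal.ofReal_add (by positivity) (by positivity), show (2:ENNReal) = ofReal 2 by simp, ← ENNReal.ofReal_mul (by norm_num), ← ENNReal.ofReal_add (by positivity) (by positivity), ENNReal.ofReal_le_ofReal_iff (by positivity)] at hfinal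
  rw [← ENNReal.ofReal_toReal hfin]
  refine ENNReal.ofReal_le_ofReal ?_
  rw [div_mul_eq_mul_div, div_le_iff₀ (by positivity)]
  have h0 : 0 ≤ (volume W).toReal := ENNReal.toReal_nonneg
  have : c*c1/2 = 4*ε := by rw [hε]; ring
  rw [this]
  nlinarith [mul_pos hεp hτ0]

lemma zetaOrds_sub (T : ℝ) : zetaOrds T ⊆ {γ ∈ ZS | |γ| ≤ T} := fun γ h => ⟨h.2.2, by rw [abs_of_pos h.1]; exact h.2.1⟩

lemma zetaOrds_fin (T : ℝ) : (zetaOrds T).Finite := (ZS_finite T).subset (zetaOrds_sub T)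

lemma zetaN_sum (T : ℝ) : zetaN T = ∑ γ ∈ (zetaOrds_fin T).toFinset, ordMult γ := by
  rw [zetaN, finsum_mem_eq_finite_toFinset_sum]

lemma Dd_le (lam T : ℝ) : Ddcount lam T ≤ zetaN T := by
  rw [zetaN_sum, Ddcount]
  calc Nat.card {γ : ℝ | γ ∈ zetaOrds T ∧ nextOrd γ - γ ≤ 2 * π * lam / log T} ≤ Nat.card (zetaOrds T) := Nat.card_mono (zetaOrds_fin T) fun x h => h.1
    _ = ∑ γ ∈ (zetaOrds_fin T).toFinset, 1 := by rw [Finset.sum_const, smul_eq_mul, mul_one]; exact Nat.card_eq_card_finite_toFinset _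
    _ ≤ _ := Finset.sum_le_sum fun γ hγ => ordMult_pos (((zetaOrds_fin T).mem_toFinset.1 hγ).2.2)

lemma zetaN_mu (T : ℝ) : (zetaN T : ENNReal) = muZ (zetaOrds T) := by
  have hm := (zetaOrds_fin T).measurableSet
  rw [zetaN_sum, ← lintegral_indicator_one hm, lintegral_muZ _ (measurable_one.indicator hm)]
  rw [tsum_subtype ZS (fun γ => (ordMult γ : ENNReal) * (zetaOrds T).indicator 1 γ), tsum_eq_sum (s := (zetaOrds_fin T).toFinset)]
  · push_cast
    refine Finset.sum_congr rfl fun γ hγ => ?_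
    have h := (zetaOrds_fin T).mem_toFinset.1 hγ
    rw [Set.indicator_of_mem (show γ ∈ ZS from h.2.2), Set.indicator_of_mem h]; simp
  · intro γ hγ
    rw [(zetaOrds_fin T).mem_toFinset] at hγ
    by_cases h : γ ∈ ZS
    · rw [Set.indicator_of_mem h, Set.indicator_of_notMem hγ, mul_zero]
    · rw [Set.indicator_of_notMem h]

lemma N_bound (hRH : RiemannHypothesis) : ∃ C T0, 0 < C ∧ ∀ T, T0 ≤ T → (zetaN T : ℝ) ≤ C * (T * log T) := by
  obtain ⟨C, hC, hV⟩ := V_main hRH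
  have h0 := vv0_pos
  have hev : ∀ᶠ x in nhds (0:ℝ), vv 0 / 2 < vv x := vv_cont.continuousAt.eventually (lt_mem_nhds (by linarith))
  obtain ⟨r, hr, hb⟩ := Metric.eventually_nhds_iff.1 hev
  obtain ⟨B, hB, hvb⟩ := vh_bdd
  set q := max 1 (2/r)
  have hq : 1 ≤ q := le_max_left _ _
  have hqr : 2/r ≤ q := le_max_right _ _
  refine ⟨2/vv 0 * (q*(2*B + 2*C)), max 4 q, by positivity, fun T hT => ?_⟩
  have hT4 : 4 ≤ T := (le_max_left _ _).trans hT
  have hTq : q ≤ T := (le_max_right _ _).trans hT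
  have hT0 : 0 < T := by linarith
  set τ := q*T
  have hτ4 : 4 ≤ τ := by nlinarith
  have hτ0 : 0 < τ := by linarith
  have hlT : 1 ≤ log T := by
    rw [Real.le_log_iff_exp_le hT0]; linarith [Real.exp_one_lt_d9]
  have hlτ : log τ ≤ 2 * log T := by
    rw [Real.log_mul (by positivity) (by positivity)]
    linarith [Real.log_le_log (by positivity) hTq]
  have h1 := hV 1 le_rfl τ 0 (by norm_num; linarith) le_rfl (Real.log_nonneg (by norm_num))
  have hX2 : X2 τ 1 0 = 0 := by
    simp [X2, Finset.sum_Icc_succ_top]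
  have hX1 : X1 τ 0 ≤ τ * log τ * B := by
    rw [X1]; exact mul_le_mul_of_nonneg_left (hvb _) (mul_nonneg hτ0.le (by
      exact Real.log_nonneg (by linarith)))
  rw [hX2, abs_le] at h1
  have h2 : Vt τ 0 ≤ q*(2*B+2*C)*(T*log T) := by
    have h3 := h1.2
    simp only [zero_div, Real.exp_zero, mul_zero, add_zero, div_one] at h3
    have h4 : Vt τ 0 ≤ τ * log τ * B + C * (1 + τ) := by linarith
    have h5 : C * (1+τ) ≤ C * (2*τ) * log T := by
      have : C * (1+τ) ≤ C*(2*τ) := mul_le_mul_of_nonneg_left (by linarith) hC.le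
      exact this.trans (le_mul_of_one_le_right (by positivity) hlT)
    have h6 : τ * log τ * B ≤ τ * (2*log T) * B := by gcongr
    calc Vt τ 0 ≤ _ := h4
      _ ≤ τ * (2*log T) * B + C * (2*τ) * log T := by linarith
      _ = _ := by simp only [τ]; ring
  have h7 : (zetaN T : ℝ) * (vv 0 / 2) ≤ Vt τ 0 := by
    have hfin : muZ (zetaOrds T) ≠ ⊤ := by rw [← zetaN_mu]; simp
    have e : (zetaN T : ℝ) = muZ.real (zetaOrds T) := by rw [measureReal_def, ← zetaN_mu]; simp
    have hm := (zetaOrds_fin T).measurableSet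
    rw [e, ← smul_eq_mul, ← integral_indicator_const _ hm, Vt]
    have hi := vv_mu_int hRH hτ0
    refine integral_mono ((integrable_indicator_iff hm).2 (integrableOn_const hfin)) (by simpa using hi) fun γ => ?_
    by_cases h : γ ∈ zetaOrds T
    · rw [Set.indicator_of_mem h]
      have : vv 0 / 2 < vv (γ/τ) := hb (by
        rw [Real.dist_eq, sub_zero, abs_div, abs_of_pos hτ0, abs_of_pos h.1, div_lt_iff₀ hτ0]
        have h8 : 2 ≤ q * r := by rwa [div_le_iff₀ hr] at hqr
        have : 2 * T ≤ q * r * T := mul_le_mul_of_nonneg_right h8 hT0.le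
        have := h.2.1
        simp only [τ]; linarith)
      simpa using this.le
    · rw [Set.indicator_of_notMem h]; simpa using vv_nonneg _
  have h9 := h7.trans h2
  rw [← le_div_iff₀ (by positivity)] at h9
  refine h9.trans (le_of_eq ?_); field_simp

lemma gap0 : ∃ d0, 0 < d0 ∧ ∀ γ ∈ ZS, γ ≠ 0 → d0 ≤ |γ| := by
  have hf : ({γ ∈ ZS | |γ| ≤ 1} \ {0}).Finite := (ZS_finite 1).sdiff
  have hev := hf.isClosed.isOpen_compl.mem_nhds (show (0:ℝ) ∈ ({γ ∈ ZS | |γ| ≤ 1} \ {0})ᶜ by simp)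
  obtain ⟨r, hr, hb⟩ := Metric.mem_nhds_iff.1 hev
  refine ⟨min r 1, by positivity, fun γ h h0 => ?_⟩
  by_contra! h1
  exact hb (show γ ∈ Metric.ball 0 r by simpa using h1.trans_le (min_le_left _ _)) ⟨⟨h, h1.le.trans (min_le_right _ _)⟩, h0⟩

lemma next_le {γ γ' : ℝ} (h : γ < γ') (h' : γ' ∈ ZS) : nextOrd γ ≤ γ' :=
  csInf_le ⟨γ, fun _ hx => hx.1.le⟩ ⟨h, h'⟩

lemma Om_bound {d d0 lam T R : ℝ} (hd0 : ∀ γ ∈ ZS, γ ≠ 0 → d0 ≤ |γ|) (hd : 0 < d) (hdd : d < d0) (hT : R + d ≤ T) (hl : d ≤ 2*π*lam/log T) :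
    volume (Om d ∩ Icc (-R) R) ≤ ofReal (3 * d * Ddcount lam T) := by
  set S := {γ : ℝ | γ ∈ zetaOrds T ∧ nextOrd γ - γ ≤ 2 * π * lam / log T}
  have hS : S.Finite := (zetaOrds_fin T).subset fun _ h => h.1
  have hsub : Om d ∩ Icc (-R) R ⊆ ⋃ γ ∈ hS.toFinset, (Icc (γ-d) γ ∪ Icc (-γ-2*d) (-γ)) := by
    rintro t ⟨ht, htR⟩
    simp only [Om, Set.mem_iUnion] at ht
    obtain ⟨γ, ⟨hγ, γ', hγ', h1, h2⟩, h3⟩ := ht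
    simp only [Set.mem_iUnion, Set.Finite.mem_toFinset]
    rcases lt_or_ge 0 γ with h | h
    · refine ⟨γ, ⟨⟨h, ?_, hγ⟩, ?_⟩, Or.inl h3⟩
      · linarith [h3.1, htR.2]
      · linarith [next_le h1 hγ']
    · have h4 : γ' < 0 := by
        by_contra! h5
        rcases eq_or_ne γ 0 with h6 | h6
        · have := hd0 γ' hγ' (by linarith)
          rw [abs_of_nonneg h5] at this; linarith
        · have := hd0 γ hγ h6
          rw [abs_of_nonpos h] at this; linarith
      refine ⟨-γ', ⟨⟨by linarith, ?_, ZS_neg hγ'⟩, ?_⟩, Or.inr ⟨?_, ?_⟩⟩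
      · linarith [h3.2, htR.1]
      · linarith [next_le (neg_lt_neg h1) (ZS_neg hγ)]
      · linarith [h3.1]
      · linarith [h3.2]
  refine (measure_mono hsub).trans ((measure_biUnion_finset_le _ _).trans ?_)
  calc ∑ γ ∈ hS.toFinset, volume (Icc (γ-d) γ ∪ Icc (-γ-2*d) (-γ)) ≤ ∑ γ ∈ hS.toFinset, ofReal (3*d) := by
        refine Finset.sum_le_sum fun γ _ => (measure_union_le _ _).trans ?_
        rw [Real.volume_Icc, Real.volume_Icc, ← ENNReal.ofReal_add (by linarith) (by linarith)]
        exact ENNReal.ofReal_le_ofReal (by linarith)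
    _ = _ := by
        rw [Finset.sum_const, nsmul_eq_mul, Ddcount, ENNReal.ofReal_mul (p := 3*d) (by positivity), ENNReal.ofReal_natCast, mul_comm, Nat.card_eq_card_finite_toFinset hS]

/-- Assume RH. Then `μ_{D_d} ≤ 1.0522`: for every `λ > 1.0522`,
`liminf_{T→∞} D_d(λ, T) > 0`, i.e. a positive proportion of gaps between consecutive
distinct zeros are at most `λ` times the average spacing of all zeros. -/
theorem muDd_le (hRH : RiemannHypothesis) :
    ∀ lam : ℝ, 1.0522 < lam →
      0 < atTop.liminf (fun T : ℝ => Ddprop lam T) := by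
  intro lam hlam
  obtain ⟨c, R, κ0, hc, hR, hM⟩ := H_main hRH (A := 8) (by norm_num)
  obtain ⟨C, T0, hC, hN⟩ := N_bound hRH
  obtain ⟨d0, hd0, hgap⟩ := gap0
  have hR0 : 0 < R := by linarith
  have hlog : Tendsto log atTop atTop := Real.tendsto_log_atTop
  set δ := c / (24*π*R*1.0522) / C with hδ
  have hδ0 : 0 < δ := by positivity
  have hle : ∀ T, Ddprop lam T ≤ 1 := fun T => by
    rw [Ddprop]; exact div_le_one_of_le₀ (by exact_mod_cast Dd_le lam T) (by positivity)
  refine lt_of_lt_of_le hδ0 (le_liminf_of_le ?_ ?_)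
  · exact IsCoboundedUnder.of_frequently_le (a := 1) (Frequently.of_forall hle)
  set K := log (8*R) with hK
  have hK0 : 0 ≤ K := Real.log_nonneg (by linarith)
  filter_upwards [eventually_ge_atTop T0, eventually_ge_atTop (12*R), eventually_ge_atTop (2*d0), hlog.eventually_ge_atTop (2*K), hlog.eventually_ge_atTop (K+4), hlog.eventually_ge_atTop (K + 4*κ0), hlog.eventually_ge_atTop (lam*K/(lam-1.0522)), hlog.eventually_ge_atTop (4*π*1.0522*2/d0)] with T h1 h2 h3 h4 h5 h6 h7 h8
  have hT0 : 0 < T := by linarith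
  set L := log T with hL
  have hL0 : 0 < L := by linarith
  set τ := T/(2*R) with hτ
  have hRτ : R*τ = T/2 := by rw [hτ]; field_simp
  have hτ6 : 6 ≤ τ := by rw [hτ, le_div_iff₀ (by positivity)]; linarith
  have hf3 : 3 ≤ ⌊τ/2⌋₊ := Nat.le_floor (by push_cast; linarith)
  obtain ⟨N, hN1⟩ : ∃ N, ⌊τ/2⌋₊ = N + 1 := ⟨_, (Nat.sub_add_cancel (by omega)).symm⟩
  have hf1 : ((N:ℝ)+1) ≤ τ/2 := by
    have := Nat.floor_le (show 0 ≤ τ/2 by linarith); rw [hN1] at this; push_cast at this; exact this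
  have hf2 : τ/2 < (N:ℝ)+1+1 := by
    have := Nat.lt_floor_add_one (τ/2); rw [hN1] at this; push_cast at this; exact this
  set M := log ((N:ℝ)+1/2) with hMd
  have hMl : L - K ≤ M := by
    rw [hL, hK, ← Real.log_div (by positivity) (by positivity)]
    refine Real.log_le_log (by positivity) ?_
    rw [show T/(8*R) = τ/4 by rw [hτ]; field_simp; norm_num]; linarith
  have hM2 : L/2 ≤ M := by linarith
  have hM0 : 0 < M := by linarith
  have hκ : M/(33/10)*(33/10) = M := by ring
  have hlogτ : log τ ≤ L := Real.log_le_log (by linarith) (by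
    rw [hτ]; exact div_le_self hT0.le (by linarith))
  have hm := hM N (M/(33/10)) τ (by omega) (by linarith) (by
    rcases le_or_gt κ0 0 with h | h
    · exact h.trans (by positivity)
    · linarith) (by rw [hκ]; exact Real.exp_log (by positivity)) (by linarith) (by linarith)
  rw [hκ] at hm
  set d := 2*π*1.0522/M with hd
  have hd0' : 0 < d := by positivity
  have hdd : d < d0 := by
    rw [hd, div_lt_iff₀ hM0]
    rw [div_le_iff₀ hd0] at h8
    have : L/2*d0 ≤ M*d0 := mul_le_mul_of_nonneg_right hM2 hd0.le
    nlinarith [Real.pi_pos]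
  have hdl : d ≤ 2*π*lam/L := by
    rw [div_le_iff₀ (by linarith)] at h7
    have hk : 1.0522*L ≤ lam*M := by nlinarith
    rw [hd, div_le_div_iff₀ hM0 hL0]
    linarith [mul_le_mul_of_nonneg_left hk (show 0 ≤ 2*π by positivity)]
  have hb := hm.trans (Om_bound (lam := lam) hgap hd0' hdd (T := T) (by rw [hRτ]; linarith) hdl)
  rw [ENNReal.ofReal_le_ofReal_iff (by positivity)] at hb
  have hb2 : c / (24*π*R*1.0522) * (T * L) ≤ Ddcount lam T := by
    have e : c*τ = c/(24*π*R*1.0522) * (T*(2*M)) * (3*d) := by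
      rw [hd, hτ]; field_simp; norm_num
    rw [e, mul_comm (3*d)] at hb
    refine le_trans ?_ (le_of_mul_le_mul_right hb (by positivity))
    gcongr; linarith
  have hD0 : (0:ℝ) < Ddcount lam T := lt_of_lt_of_le (by positivity) hb2
  have hN0 : (0:ℝ) < zetaN T := hD0.trans_le (by exact_mod_cast Dd_le lam T)
  rw [Ddprop, le_div_iff₀ hN0]
  calc δ * zetaN T ≤ δ * (C * (T * L)) := mul_le_mul_of_nonneg_left (hN T h1) hδ0.le
    _ = c / (24*π*R*1.0522) * (T * L) := by rw [hδ]; field_simp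
    _ ≤ _ := hb2
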